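/- arXiv:1811.01851 — 4 statements merged into one kernel-verified Lean document; each statement's English description precedes it below -/
import Mathlib

section
/- Fix a prime p > 2 and a positive integer M. Let #_all(n) be the number of isomorphism classes of groups of order p^n, and let #_{B0≥M}(n) be the number of isomorphism classes of groups G of order p^n whose Bogomolov multiplier B_0(G) has order at least M. Then lim_{n→∞} (log_p #_{B0≥M}(n)) / (log_p #_all(n)) = 1. -/
open Filter

noncomputable section

/-- The multiplication of a group structure `s` on a type `α`. -/
def GroupMul {α : Type*} (s : Group α) : α → α → α := by
  letI := s; exact (· * ·)

/-- Two group structures on the same type are isomorphic if there is a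
multiplication-preserving bijection between them. -/
def GroupsIso {α : Type*} (s t : Group α) : Prop :=
  ∃ e : α ≃ α, ∀ x y, e (GroupMul s x y) = GroupMul t (e x) (e y)

/-- The setoid of group structures on `α` up to isomorphism. -/
def groupSetoid (α : Type*) : Setoid (Group α) where
  r := GroupsIso
  iseqv := by
    constructor
    · exact fun s => ⟨Equiv.refl α, fun x y => rfl⟩
    · rintro s t ⟨e, he⟩
      refine ⟨e.symm, fun x y => e.injective ?_⟩
      rw [Equiv.apply_symm_apply, he, Equiv.apply_symm_apply, Equiv.apply_symm_apply]
    · rintro s t u ⟨e, he⟩ ⟨f, hf⟩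
      exact ⟨e.trans f, fun x y => by
        simp only [Equiv.trans_apply, he, hf]⟩

/-- Isomorphism classes of groups of order `m`, realised as group structures on
`Fin m` up to isomorphism. -/
def GroupClasses (m : ℕ) := Quotient (groupSetoid (Fin m))

/-- `ℚ/ℤ` as an additive group. -/
abbrev QZ := AddCircle (1 : ℚ)

/-- Inhomogeneous 2-cocycles on `G` with values in `ℚ/ℤ` (trivial action). -/
def twoCocycles (G : Type*) [Group G] : AddSubgroup (G → G → QZ) where
  carrier := {f | ∀ g h k, f g h + f (g * h) k = f h k + f g (h * k)}
  add_mem' := by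
    intro a b ha hb g h k
    simp only [Pi.add_apply]
    rw [add_add_add_comm, ha g h k, hb g h k, add_add_add_comm]
  zero_mem' := by intro g h k; simp
  neg_mem' := by
    intro a ha g h k
    simp only [Pi.neg_apply]
    rw [← neg_add, ← neg_add, ha g h k]

/-- Inhomogeneous 2-coboundaries on `G` with values in `ℚ/ℤ` (trivial action). -/
def twoCoboundaries (G : Type*) [Group G] : AddSubgroup (G → G → QZ) where
  carrier := {f | ∃ φ : G → QZ, ∀ g h, f g h = φ g + φ h - φ (g * h)}
  add_mem' := by
    rintro a b ⟨φ, hφ⟩ ⟨ψ, hψ⟩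
    exact ⟨φ + ψ, fun g h => by simp only [Pi.add_apply, hφ g h, hψ g h]; abel⟩
  zero_mem' := ⟨0, by simp⟩
  neg_mem' := by
    rintro a ⟨φ, hφ⟩
    exact ⟨-φ, fun g h => by simp only [Pi.neg_apply, hφ g h]; abel⟩

/-- Restriction of a 2-cochain on `G` to a subgroup `A`. -/
def restrictHom (G : Type*) [Group G] (A : Subgroup G) :
    (G → G → QZ) →+ (A → A → QZ) where
  toFun f := fun a b => f a b
  map_zero' := rfl
  map_add' := fun a b => rfl

/-- The 2-cocycles representing classes of the Bogomolov multiplier: those whose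
restriction to every abelian subgroup is a coboundary. -/
def bogomolovCocycles (G : Type*) [Group G] : AddSubgroup (G → G → QZ) :=
  twoCocycles G ⊓
    ⨅ (A : Subgroup G) (_ : ∀ a ∈ A, ∀ b ∈ A, a * b = b * a),
      (twoCoboundaries A).comap (restrictHom G A)

/-- The order of the Bogomolov multiplier `B₀(G) ≤ H²(G, ℚ/ℤ)`:
the cardinality of the group of 2-cocycles that restrict to coboundaries on all
abelian subgroups, modulo coboundaries. -/
def bogomolovOrder (G : Type*) [Group G] : ℕ :=
  Nat.card (↥(bogomolovCocycles G) ⧸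
    ((twoCoboundaries G).addSubgroupOf (bogomolovCocycles G)))

/-- The order of the Bogomolov multiplier, for an explicit group structure. -/
def bogOrder {α : Type*} (s : Group α) : ℕ := @bogomolovOrder α s

/-! ### Counting isomorphism classes of groups -/

instance (m : ℕ) : Finite (GroupClasses m) := by
  have : Finite (Group (Fin m)) := Finite.of_injective (fun s => GroupMul s) fun s t h => by
    apply Group.ext
    exact h
  exact Quotient.finite _

/-- A type synonym of `Fin m` carrying the given group structure. -/
def GroupCarrier {m : ℕ} (_ : Group (Fin m)) : Type := Fin m

instance {m : ℕ} (s : Group (Fin m)) : Group (GroupCarrier s) := s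

/-- A group representing an isomorphism class of groups of order `m`. -/
def ClassCarrier {m : ℕ} (c : GroupClasses m) : Type := GroupCarrier (Quotient.out c)

instance {m : ℕ} (c : GroupClasses m) : Group (ClassCarrier c) :=
  inferInstanceAs (Group (GroupCarrier (Quotient.out c)))

instance {m : ℕ} (c : GroupClasses m) : Finite (ClassCarrier c) :=
  inferInstanceAs (Finite (Fin m))

theorem card_classCarrier {m : ℕ} (c : GroupClasses m) : Nat.card (ClassCarrier c) = m :=
  Nat.card_fin m

theorem eq_of_classCarrier_mulEquiv {m : ℕ} {c d : GroupClasses m}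
    (e : ClassCarrier c ≃* ClassCarrier d) : c = d := by
  rw [← Quotient.out_eq c, ← Quotient.out_eq d]
  exact Quotient.sound ⟨e.toEquiv, fun x y => e.map_mul x y⟩

theorem exists_mulEquiv_fin {G : Type} [Group G] {m : ℕ} [NeZero m] (h : Nat.card G = m) :
    ∃ s : Group (Fin m), Nonempty (G ≃* GroupCarrier s) := by
  have : Finite G := Nat.finite_of_card_ne_zero (h ▸ NeZero.ne m)
  let e := Finite.equivFinOfCardEq h
  refine ⟨e.symm.group, ⟨⟨e, fun x y => ?_⟩⟩⟩
  change e (x * y) = e (e.symm (e x) * e.symm (e y))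
  simp

/-- If every group of the family `G` has order `m` and a class satisfying `P`, and the groups of
the family are distinguished by isomorphisms preserving a marked tuple of elements, then the
family is not much larger than the set of classes satisfying `P`. -/
theorem card_le_card_classes_mul {S I : Type} [Finite I] {m : ℕ} (P : GroupClasses m → Prop)
    (G : S → Type) [∀ s, Group (G s)] (gen : ∀ s, I → G s)
    (hP : ∀ s, ∃ t : Group (Fin m), P (Quotient.mk (groupSetoid (Fin m)) t) ∧
      Nonempty (G s ≃* GroupCarrier t))
    (hrigid : ∀ s t (e : G s ≃* G t), (∀ i, e (gen s i) = gen t i) → s = t) :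
    Nat.card S ≤ Nat.card {c : GroupClasses m // P c} * m ^ Nat.card I := by
  have key : ∀ s, ∃ c : {c : GroupClasses m // P c}, Nonempty (G s ≃* ClassCarrier c.1) := by
    intro s
    obtain ⟨t, ht, ⟨e⟩⟩ := hP s
    obtain ⟨f, hf⟩ : GroupsIso t (Quotient.out (Quotient.mk (groupSetoid (Fin m)) t)) :=
      (groupSetoid (Fin m)).symm (Quotient.mk_out (s := groupSetoid (Fin m)) t)
    refine ⟨⟨_, ht⟩, ⟨⟨e.toEquiv.trans f, fun x y => ?_⟩⟩⟩
    change f (e.toFun (x * y)) = _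
    rw [e.map_mul']
    exact hf _ _
  choose c e using key
  have e' := fun s => (e s).some
  have h := Nat.card_le_card_of_injective
    (β := {c : GroupClasses m // P c} × (I → Fin m))
    (fun s => (c s, fun i => (e' s (gen s i) : ClassCarrier (c s).1))) (by
      intro s t hst
      have hc := congrArg Prod.fst hst
      have hg := congrArg Prod.snd hst
      have main : ∀ (a b : {c : GroupClasses m // P c}) (_ : a = b)
          (f : G s ≃* ClassCarrier a.1) (f' : G t ≃* ClassCarrier b.1),
          ((fun i => f (gen s i) : I → Fin m) = fun i => f' (gen t i)) → s = t := by
        rintro a b rfl f f' hff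
        refine hrigid s t (f.trans f'.symm) fun i => ?_
        rw [MulEquiv.trans_apply, MulEquiv.symm_apply_eq]
        exact congrFun hff i
      exact main _ _ hc _ _ hg)
  rwa [Nat.card_prod, Nat.card_fun, Nat.card_fin] at h

theorem card_le_card_groupClasses_mul {S I : Type} [Finite I] {m : ℕ} [NeZero m]
    (G : S → Type) [∀ s, Group (G s)] (gen : ∀ s, I → G s) (hG : ∀ s, Nat.card (G s) = m)
    (hrigid : ∀ s t (e : G s ≃* G t), (∀ i, e (gen s i) = gen t i) → s = t) :
    Nat.card S ≤ Nat.card (GroupClasses m) * m ^ Nat.card I := by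
  have h := card_le_card_classes_mul (fun _ => True) G gen
    (fun s => (exists_mulEquiv_fin (hG s)).imp fun _ ht => ⟨trivial, ht⟩) hrigid
  rwa [Nat.card_congr (Equiv.subtypeUnivEquiv fun _ => trivial)] at h

/-! ### Groups defined by biadditive maps -/

/-- The central extension of `V` by `W` whose cocycle is the biadditive map `β`. -/
@[ext]
structure BilinGroup {V W : Type} [AddCommGroup V] [AddCommGroup W] (β : V →+ V →+ W) where
  /-- The component in the quotient. -/
  fst : V
  /-- The component in the central subgroup. -/
  snd : W

namespace BilinGroup

variable {V W : Type} [AddCommGroup V] [AddCommGroup W] (β : V →+ V →+ W)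

instance : Mul (BilinGroup β) := ⟨fun a b => ⟨a.fst + b.fst, a.snd + b.snd + β a.fst b.fst⟩⟩

instance : One (BilinGroup β) := ⟨⟨0, 0⟩⟩

instance : Inv (BilinGroup β) := ⟨fun a => ⟨-a.fst, -a.snd + β a.fst a.fst⟩⟩

variable {β}

@[simp] theorem mul_fst (a b : BilinGroup β) : (a * b).fst = a.fst + b.fst := rfl

@[simp] theorem mul_snd (a b : BilinGroup β) :
    (a * b).snd = a.snd + b.snd + β a.fst b.fst := rfl

@[simp] theorem one_fst : (1 : BilinGroup β).fst = 0 := rfl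

@[simp] theorem one_snd : (1 : BilinGroup β).snd = 0 := rfl

@[simp] theorem inv_fst (a : BilinGroup β) : (a⁻¹).fst = -a.fst := rfl

@[simp] theorem inv_snd (a : BilinGroup β) : (a⁻¹).snd = -a.snd + β a.fst a.fst := rfl

instance : Group (BilinGroup β) := Group.ofLeftAxioms
  (fun a b c => by
    ext
    · simp [add_assoc]
    · simp only [mul_snd, mul_fst, map_add, AddMonoidHom.add_apply]; abel)
  (fun a => by ext <;> simp)
  (fun a => by ext <;> simp)

theorem card_eq (β : V →+ V →+ W) : Nat.card (BilinGroup β) = Nat.card V * Nat.card W := by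
  rw [← Nat.card_prod]
  exact Nat.card_congr ⟨fun a => (a.fst, a.snd), fun a => ⟨a.1, a.2⟩, fun _ => rfl, fun _ => rfl⟩

end BilinGroup

/-! ### Many groups of class two -/

/-- The biadditive map with structure constants `T`. -/
def tensorMap {p a c : ℕ} (T : Fin a → Fin a → Fin c → ZMod p) :
    (Fin a → ZMod p) × (Fin a → ZMod p) →+ (Fin a → ZMod p) × (Fin a → ZMod p) →+
      (Fin c → ZMod p) :=
  AddMonoidHom.mk' (fun v => AddMonoidHom.mk'
      (fun w k => ∑ i, ∑ j, v.1 i * w.2 j * T i j k)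
      (fun w w' => by
        ext k
        simp [mul_add, add_mul, Finset.sum_add_distrib]))
    (fun v v' => by
      ext w k
      simp [add_mul, Finset.sum_add_distrib])

theorem tensorMap_apply {p a c : ℕ} (T : Fin a → Fin a → Fin c → ZMod p)
    (v w : (Fin a → ZMod p) × (Fin a → ZMod p)) (k : Fin c) :
    tensorMap T v w k = ∑ i, ∑ j, v.1 i * w.2 j * T i j k := rfl

theorem tensorMap_single {p a c : ℕ} (T : Fin a → Fin a → Fin c → ZMod p) (i j : Fin a) :
    tensorMap T (Pi.single i 1, 0) (0, Pi.single j 1) = T i j := by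
  ext k
  simp [tensorMap_apply, Pi.single_apply]

/-- The standard generators of the group with structure constants `T`. -/
def tensorGen {p a c : ℕ} (T : Fin a → Fin a → Fin c → ZMod p) :
    Fin a ⊕ Fin a ⊕ Fin c → BilinGroup (tensorMap T)
  | .inl i => ⟨(Pi.single i 1, 0), 0⟩
  | .inr (.inl j) => ⟨(0, Pi.single j 1), 0⟩
  | .inr (.inr k) => ⟨0, Pi.single k 1⟩

theorem tensor_rigid {p a c : ℕ} [NeZero p] {T T' : Fin a → Fin a → Fin c → ZMod p}
    (e : BilinGroup (tensorMap T) ≃* BilinGroup (tensorMap T'))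
    (he : ∀ i, e (tensorGen T i) = tensorGen T' i) : T = T' := by
  let L : AddSubgroup (Fin c → ZMod p) :=
    { carrier := {w | e ⟨0, w⟩ = ⟨0, w⟩}
      zero_mem' := map_one e
      add_mem' := by
        intro x y hx hy
        have h : ∀ U : Fin a → Fin a → Fin c → ZMod p,
            (⟨0, x + y⟩ : BilinGroup (tensorMap U)) = ⟨0, x⟩ * ⟨0, y⟩ := fun U => by
          ext1 <;> simp
        simp only [Set.mem_ofPred_eq] at hx hy ⊢
        rw [h, h, map_mul, hx, hy]
      neg_mem' := by
        intro x hx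
        have h : ∀ U : Fin a → Fin a → Fin c → ZMod p,
            (⟨0, -x⟩ : BilinGroup (tensorMap U)) = (⟨0, x⟩)⁻¹ := fun U => by
          ext1 <;> simp
        simp only [Set.mem_ofPred_eq] at hx ⊢
        rw [h, h, map_inv, hx] }
  have hL : ∀ w, w ∈ L := by
    intro w
    have hw : w = ∑ k, (w k).val • (Pi.single k 1 : Fin c → ZMod p) := by
      ext k
      simp only [Finset.sum_apply, Pi.smul_apply]
      simp [Pi.single_apply]
    rw [hw]
    exact L.sum_mem fun k _ => L.nsmul_mem (he (.inr (.inr k))) _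
  have hrel : ∀ (U : Fin a → Fin a → Fin c → ZMod p) (i j : Fin a) (w : Fin c → ZMod p),
      tensorGen U (.inl i) * tensorGen U (.inr (.inl j)) =
        tensorGen U (.inr (.inl j)) * tensorGen U (.inl i) * ⟨0, w⟩ ↔ U i j = w := by
    intro U i j w
    have h0 : tensorMap U (0, Pi.single j 1) (Pi.single i 1, 0) = 0 := by
      ext k
      simp [tensorMap_apply]
    simp [BilinGroup.ext_iff, tensorGen, tensorMap_single, h0]
  ext1 i
  ext1 j
  have h := congrArg e ((hrel T i j _).2 rfl)
  have hij : e ⟨0, T i j⟩ = ⟨0, T i j⟩ := hL _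
  simp only [map_mul, he, hij] at h
  exact ((hrel T' i j _).1 h).symm

theorem pow_le_card_groupClasses (p a c : ℕ) [Fact p.Prime] :
    p ^ (a * a * c) ≤
      Nat.card (GroupClasses (p ^ (a + a + c))) * p ^ ((a + a + c) * (a + a + c)) := by
  have h := card_le_card_groupClasses_mul (m := p ^ (a + a + c))
    (fun T : Fin a → Fin a → Fin c → ZMod p => BilinGroup (tensorMap T)) tensorGen
    (fun T => by
      rw [BilinGroup.card_eq]
      simp [pow_add])
    (fun _ _ e he => tensor_rigid e he)
  simp only [Nat.card_fun, Nat.card_fin, Nat.card_zmod, Nat.card_sum] at h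
  rw [← pow_mul, ← pow_mul, ← pow_mul] at h
  convert h using 2
  · ring
  · ring_nf

/-! ### Extensions by a cyclic group of prime order -/

theorem exists_generators_of_card_eq_pow {G : Type} [Group G] [Finite G] {p : ℕ} [Fact p.Prime]
    (k : ℕ) (H : Subgroup G) (hH : Nat.card H = p ^ k) :
    ∃ g : Fin k → G, Subgroup.closure (Set.range g) = H := by
  have hp : p.Prime := Fact.out
  induction k generalizing H with
  | zero =>
    refine ⟨Fin.elim0, ?_⟩
    rw [pow_zero] at hH
    rw [Subgroup.eq_bot_of_card_eq H hH]
    simp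
  | succ k ih =>
    obtain ⟨K₀, hK₀⟩ := Sylow.exists_subgroup_card_pow_prime (G := H) p (n := k)
      (hH ▸ pow_dvd_pow p k.le_succ)
    obtain ⟨K, hK, hKH⟩ : ∃ K : Subgroup G, Nat.card K = p ^ k ∧ K ≤ H :=
      ⟨K₀.map H.subtype, by rw [Subgroup.card_map_of_injective H.subtype_injective, hK₀],
        Subgroup.map_subtype_le K₀⟩
    obtain ⟨g, hg⟩ := ih K hK
    obtain ⟨x, hxH, hxK⟩ : ∃ x ∈ H, x ∉ K := by
      by_contra! hcon
      have := hK.symm.trans ((congrArg (fun L : Subgroup G => Nat.card L)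
        (le_antisymm hKH hcon)).trans hH)
      exact absurd (Nat.pow_right_injective hp.two_le this) (by omega)
    refine ⟨Fin.cons x g, ?_⟩
    rw [Fin.range_cons]
    set L := Subgroup.closure (insert x (Set.range g)) with hL
    have hLH : L ≤ H := by
      rw [hL, Subgroup.closure_le, Set.insert_subset_iff]
      refine ⟨hxH, fun y hy => hKH ?_⟩
      rw [← hg]
      exact Subgroup.subset_closure hy
    have hKL : K ≤ L := hg ▸ Subgroup.closure_mono (Set.subset_insert _ _)
    have hxL : x ∈ L := Subgroup.subset_closure (Set.mem_insert _ _)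
    obtain ⟨j, hj, hLj⟩ := (Nat.dvd_prime_pow hp).1 (hH ▸ Subgroup.card_dvd_of_le hLH)
    have hkj : k < j := by
      by_contra! hjk
      have hle : Nat.card L ≤ Nat.card K := by
        rw [hLj, hK]
        exact Nat.pow_le_pow_right hp.pos hjk
      exact hxK (Subgroup.eq_of_le_of_card_ge hKL hle ▸ hxL)
    obtain rfl : j = k + 1 := by omega
    exact Subgroup.eq_of_le_of_card_ge hLH (by rw [hLj, hH])

theorem pow_mem_iff_dvd_of_index_eq_prime {G : Type} [Group G] {p : ℕ} (hp : p.Prime)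
    {H : Subgroup G} [H.Normal] (hH : H.index = p) {x : G} (hx : x ∉ H) (n : ℕ) :
    x ^ n ∈ H ↔ p ∣ n := by
  have hord : orderOf (x : G ⧸ H) = p := by
    have hdvd : orderOf (x : G ⧸ H) ∣ p := by
      rw [← hH]
      exact orderOf_dvd_natCard _
    refine ((Nat.dvd_prime hp).1 hdvd).resolve_left fun h1 => hx ?_
    rwa [orderOf_eq_one_iff, QuotientGroup.eq_one_iff] at h1
  rw [← QuotientGroup.eq_one_iff, QuotientGroup.mk_pow, ← orderOf_dvd_iff_pow_eq_one, hord]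

theorem exists_mul_pow_of_index_eq_prime {G : Type} [Group G] {p : ℕ} (hp : p.Prime)
    {H : Subgroup G} [H.Normal] (hH : H.index = p) {x : G} (hx : x ∉ H) (g : G) :
    ∃ (h : H) (n : ℕ), g = h * x ^ n := by
  have : Finite (G ⧸ H) := Nat.finite_of_card_ne_zero (by
    change H.index ≠ 0
    rw [hH]
    exact hp.ne_zero)
  have hx1 : (x : G ⧸ H) ≠ 1 := by rwa [Ne, QuotientGroup.eq_one_iff]
  have := Fact.mk hp
  obtain ⟨n, hn⟩ := (mem_powers_of_prime_card (G := G ⧸ H) hH hx1 (g' := (g : G ⧸ H)))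
  refine ⟨⟨g * (x ^ n)⁻¹, ?_⟩, n, by simp⟩
  rw [← QuotientGroup.eq_one_iff, QuotientGroup.mk_mul, QuotientGroup.mk_inv,
    QuotientGroup.mk_pow]
  simp only at hn
  rw [hn, mul_inv_cancel]

/-- A group with a normal subgroup `H` of prime index is determined by `H`, the action of an
outside element `x` on `H`, and the element `x ^ p` of `H`. -/
theorem nonempty_mulEquiv_of_index_eq_prime {G G' : Type} [Group G] [Group G'] [Finite G]
    {p : ℕ} (hp : p.Prime) {H : Subgroup G} [H.Normal] {H' : Subgroup G'} [H'.Normal]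
    (hH : H.index = p) (hH' : H'.index = p) {x : G} {x' : G'} (hx : x ∉ H) (hx' : x' ∉ H')
    (e : H ≃* H') (hconj : ∀ h, e (MulAut.conjNormal x h) = MulAut.conjNormal x' (e h))
    (hpow : ∀ y : H, (y : G) = x ^ p → (e y : G') = x' ^ p) :
    Nonempty (G ≃* G') := by
  have hpow' : ∀ (n : ℕ) (y : H), (y : G) = x ^ n → (e y : G') = x' ^ n := by
    intro n y hy
    obtain ⟨j, rfl⟩ := (pow_mem_iff_dvd_of_index_eq_prime hp hH hx n).1 (hy ▸ y.2)
    have hz : x ^ p ∈ H := (pow_mem_iff_dvd_of_index_eq_prime hp hH hx p).2 dvd_rfl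
    have hy' : y = ⟨x ^ p, hz⟩ ^ j := Subtype.ext (by rw [hy, pow_mul]; rfl)
    rw [hy', map_pow, Subgroup.coe_pow, hpow ⟨x ^ p, hz⟩ rfl, pow_mul]
  have hconj' : ∀ (n : ℕ) (h : H),
      e (MulAut.conjNormal (x ^ n) h) = MulAut.conjNormal (x' ^ n) (e h) := by
    intro n
    induction n with
    | zero => simp
    | succ n ih =>
      intro h
      rw [pow_succ, pow_succ, map_mul, map_mul, MulAut.mul_apply, MulAut.mul_apply, ih, hconj]
  have hwd : ∀ (h k : H) (m n : ℕ), (h : G) * x ^ m = k * x ^ (m + n) →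
      (e h : G') * x' ^ m = e k * x' ^ (m + n) := by
    intro h k m n heq
    have h1 : ((k⁻¹ * h : H) : G) = x ^ n := by
      rw [pow_add, (Commute.pow_pow_self x m n).eq, ← mul_assoc, mul_left_inj] at heq
      simp [heq]
    have h2 := hpow' n _ h1
    rw [map_mul, map_inv, Subgroup.coe_mul, Subgroup.coe_inv, inv_mul_eq_iff_eq_mul] at h2
    rw [h2, mul_assoc, ← pow_add, add_comm n m]
  have hwd' : ∀ (h k : H) (m n : ℕ), (h : G) * x ^ m = k * x ^ n →
      (e h : G') * x' ^ m = e k * x' ^ n := by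
    intro h k m n heq
    rcases le_total m n with hmn | hmn
    · obtain ⟨d, rfl⟩ := Nat.exists_eq_add_of_le hmn
      exact hwd h k m d heq
    · obtain ⟨d, rfl⟩ := Nat.exists_eq_add_of_le hmn
      exact (hwd k h n d heq.symm).symm
  choose h n hhn using exists_mul_pow_of_index_eq_prime hp hH hx
  have hf : ∀ (k : H) (m : ℕ), (e (h (k * x ^ m)) : G') * x' ^ n (k * x ^ m) = e k * x' ^ m :=
    fun k m => hwd' _ _ _ _ (hhn _).symm
  let f : G →* G' := MonoidHom.mk' (fun g => (e (h g) : G') * x' ^ n g) (by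
    intro a b
    have hab : a * b = ((h a * MulAut.conjNormal (x ^ n a) (h b) : H) : G) * x ^ (n a + n b) := by
      conv_lhs => rw [hhn a, hhn b]
      rw [Subgroup.coe_mul, MulAut.conjNormal_apply, pow_add]
      group
    rw [hab, hf, map_mul, hconj']
    rw [Subgroup.coe_mul, MulAut.conjNormal_apply, pow_add]
    group)
  have hsurj : Function.Surjective f := by
    intro g'
    obtain ⟨k, m, rfl⟩ := exists_mul_pow_of_index_eq_prime hp hH' hx' g'
    refine ⟨(e.symm k : H) * x ^ m, ?_⟩
    change (e (h _) : G') * x' ^ n _ = _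
    rw [hf, e.apply_symm_apply]
  have hcard : Nat.card G = Nat.card G' := by
    rw [← H.card_mul_index, ← H'.card_mul_index, hH, hH', Nat.card_congr e.toEquiv]
  have : Finite G' := Finite.of_surjective f hsurj
  exact ⟨MulEquiv.ofBijective f ((Nat.bijective_iff_surjective_and_card f).2 ⟨hsurj, hcard⟩)⟩

theorem exists_index_eq_prime {G : Type} [Group G] {p k : ℕ} [Fact p.Prime]
    (hG : Nat.card G = p ^ (k + 1)) :
    ∃ (H : Subgroup G) (x : G) (g : Fin k → H), H.Normal ∧ H.index = p ∧ Nat.card H = p ^ k ∧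
      x ∉ H ∧ Subgroup.closure (Set.range g) = ⊤ := by
  have hp : p.Prime := Fact.out
  have : Finite G := Nat.finite_of_card_ne_zero (hG ▸ pow_ne_zero _ hp.ne_zero)
  obtain ⟨H, hH⟩ := Sylow.exists_subgroup_card_pow_prime (G := G) p (n := k)
    (hG ▸ pow_dvd_pow p k.le_succ)
  have hind : H.index = p := by
    have h := H.card_mul_index
    rw [hH, hG, pow_succ] at h
    exact Nat.eq_of_mul_eq_mul_left (pow_pos hp.pos k) h
  obtain ⟨x, hx⟩ : ∃ x, x ∉ H := by
    by_contra! hcon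
    rw [(Subgroup.eq_top_iff' H).2 hcon, Subgroup.index_top] at hind
    exact hp.one_lt.ne hind
  obtain ⟨g, hg⟩ := exists_generators_of_card_eq_pow (G := H) (p := p) k ⊤
    (by rw [Subgroup.card_top, hH])
  refine ⟨H, x, g, Subgroup.normal_of_index_eq_minFac_card ?_, hind, hH, hx, hg⟩
  rw [hind, hG, hp.pow_minFac k.succ_ne_zero]

theorem card_groupClasses_succ_le (p k : ℕ) [Fact p.Prime] :
    Nat.card (GroupClasses (p ^ (k + 1))) ≤
      Nat.card (GroupClasses (p ^ k)) * (p ^ k) ^ (k + (k + 1)) := by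
  have hp : p.Prime := Fact.out
  choose H x g hnormal hind hcard hx hg using
    fun c : GroupClasses (p ^ (k + 1)) => exists_index_eq_prime (card_classCarrier c)
  have hpow : ∀ c, x c ^ p ∈ H c := fun c =>
    (pow_mem_iff_dvd_of_index_eq_prime hp (hind c) (hx c) p).2 dvd_rfl
  have h := card_le_card_groupClasses_mul (m := p ^ k) (I := Fin k ⊕ Fin k ⊕ Unit)
    (fun c => H c)
    (fun c => Sum.elim (g c)
      (Sum.elim (fun i => MulAut.conjNormal (x c) (g c i)) fun _ => ⟨x c ^ p, hpow c⟩))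
    hcard (by
      intro c d e he
      obtain ⟨f⟩ := nonempty_mulEquiv_of_index_eq_prime hp (hind c) (hind d) (hx c) (hx d) e
        (by
          have hhom : e.toMonoidHom.comp (MulAut.conjNormal (x c)).toMonoidHom =
              (MulAut.conjNormal (x d)).toMonoidHom.comp e.toMonoidHom := by
            refine MonoidHom.eq_of_eqOn_dense (hg c) ?_
            rintro _ ⟨i, rfl⟩
            have h1 := he (.inl i)
            have h2 := he (.inr (.inl i))
            simp only [Sum.elim_inl, Sum.elim_inr] at h1 h2
            change e (MulAut.conjNormal (x c) (g c i)) = MulAut.conjNormal (x d) (e (g c i))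
            rw [h2, h1]
          exact fun h => DFunLike.congr_fun hhom h)
        (by
          intro y hy
          have h3 := he (.inr (.inr ()))
          simp only [Sum.elim_inr] at h3
          rw [show y = ⟨x c ^ p, hpow c⟩ from Subtype.ext hy, h3])
      exact eq_of_classCarrier_mulEquiv f)
  simpa [Nat.card_sum] using h

/-! ### Finiteness of the Bogomolov multiplier -/

theorem exists_nsmul_eq_QZ {N : ℕ} (hN : N ≠ 0) (x : QZ) : ∃ y : QZ, N • y = x := by
  obtain ⟨q, rfl⟩ := QuotientAddGroup.mk_surjective x
  refine ⟨((q / N : ℚ) : QZ), ?_⟩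
  rw [← AddCircle.coe_nsmul, nsmul_eq_mul, mul_div_cancel₀ q (Nat.cast_ne_zero.2 hN)]

theorem exists_torsion_cocycle {G : Type*} [Group G] [Finite G] {f : G → G → QZ}
    (hf : f ∈ twoCocycles G) :
    ∃ b ∈ twoCoboundaries G, ∀ g h, Nat.card G • (f g h - b g h) = 0 := by
  have := Fintype.ofFinite G
  choose d hd using exists_nsmul_eq_QZ (Nat.card_pos (α := G)).ne'
  refine ⟨fun g h => d (∑ k, f g k) + d (∑ k, f h k) - d (∑ k, f (g * h) k),
    ⟨fun g => d (∑ k, f g k), fun _ _ => rfl⟩, fun g h => ?_⟩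
  have hsum : ∑ k, (f g h + f (g * h) k) = ∑ k, (f h k + f g (h * k)) :=
    Finset.sum_congr rfl fun k _ => hf g h k
  have hshift : ∑ k, f g (h * k) = ∑ k, f g k :=
    Fintype.sum_equiv (Equiv.mulLeft h) _ _ fun _ => rfl
  rw [Finset.sum_add_distrib, Finset.sum_add_distrib, hshift, Finset.sum_const,
    Finset.card_univ, ← Nat.card_eq_fintype_card] at hsum
  rw [smul_sub, smul_sub, smul_add, hd, hd, hd, eq_sub_of_add_eq hsum]
  abel

instance {G : Type*} [Group G] [Finite G] :
    Finite (↥(bogomolovCocycles G) ⧸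
      ((twoCoboundaries G).addSubgroupOf (bogomolovCocycles G))) := by
  let T : Set QZ := {u | Nat.card G • u = 0}
  have : Finite T := AddCircle.finite_torsion (1 : ℚ) (Nat.card_pos (α := G))
  have key : ∀ q : ↥(bogomolovCocycles G) ⧸
      ((twoCoboundaries G).addSubgroupOf (bogomolovCocycles G)),
      ∃ (t : G → G → T) (f : bogomolovCocycles G), q = QuotientAddGroup.mk f ∧
        (f : G → G → QZ) - (fun g h => (t g h : QZ)) ∈ twoCoboundaries G := by
    intro q
    obtain ⟨f, rfl⟩ := QuotientAddGroup.mk_surjective q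
    obtain ⟨b, hb, hfb⟩ := exists_torsion_cocycle f.2.1
    refine ⟨fun g h => ⟨_, hfb g h⟩, f, rfl, ?_⟩
    convert hb using 1
    ext g h
    simp
  choose t f hq ht using key
  refine Finite.of_injective t fun q r hqr => ?_
  rw [hq q, hq r, QuotientAddGroup.eq, AddSubgroup.mem_addSubgroupOf]
  have h := sub_mem (ht r) (ht q)
  rw [hqr] at h
  convert h using 1
  simp only [AddSubgroup.coe_add, AddSubgroup.coe_neg]
  abel

/-! ### Groups with large Bogomolov multiplier -/

/-- The embedding of `ℤ/p` into `ℚ/ℤ`. -/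
def zmodToQZ (p : ℕ) [NeZero p] : ZMod p →+ QZ :=
  ZMod.lift p ⟨zmultiplesHom QZ (((1 / p : ℚ)) : QZ), by
    rw [zmultiplesHom_apply, ← AddCircle.coe_zsmul, AddCircle.coe_eq_zero_iff]
    refine ⟨1, ?_⟩
    have : (p : ℚ) ≠ 0 := Nat.cast_ne_zero.2 (NeZero.ne p)
    simp [this]⟩

theorem zmodToQZ_injective (p : ℕ) [NeZero p] : Function.Injective (zmodToQZ p) := by
  rw [zmodToQZ, ZMod.lift_injective]
  intro m hm
  rw [zmultiplesHom_apply, ← AddCircle.coe_zsmul, AddCircle.coe_eq_zero_iff] at hm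
  obtain ⟨n, hn⟩ := hm
  rw [ZMod.intCast_zmod_eq_zero_iff_dvd]
  have hp : (p : ℚ) ≠ 0 := Nat.cast_ne_zero.2 (NeZero.ne p)
  refine ⟨n, ?_⟩
  simp only [zsmul_eq_mul, mul_one] at hn
  field_simp at hn
  rw [mul_comm]
  exact_mod_cast hn.symm

/-- The additive character of `(ℤ/p)^k` attached to `u`. -/
def dotQZ {p k : ℕ} [NeZero p] (u : Fin k → ZMod p) : (Fin k → ZMod p) →+ QZ :=
  (zmodToQZ p).comp (AddMonoidHom.mk' (fun a => u ⬝ᵥ a) (dotProduct_add u))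

theorem dotQZ_apply {p k : ℕ} [NeZero p] (u a : Fin k → ZMod p) :
    dotQZ u a = zmodToQZ p (u ⬝ᵥ a) := rfl

theorem dotQZ_sub {p k : ℕ} [NeZero p] (u v a : Fin k → ZMod p) :
    dotQZ (u - v) a = dotQZ u a - dotQZ v a := by
  simp only [dotQZ_apply, sub_dotProduct, map_sub]

theorem eq_zero_of_dotQZ_eq_zero {p k : ℕ} [NeZero p] {u : Fin k → ZMod p}
    (h : ∀ a, dotQZ u a = 0) : u = 0 := by
  ext i
  have hi := h (Pi.single i 1)
  rw [dotQZ_apply, ← map_zero (zmodToQZ p)] at hi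
  simpa using zmodToQZ_injective p hi

/-- The commutator structure over a commutative ring `R` in which the relations between the
generators are spanned by a single indecomposable bivector. -/
def pluckerMap (R : Type) [CommRing R] :
    R × R × R × R →+ R × R × R × R →+ R × R × R × R × R :=
  AddMonoidHom.mk' (fun v => AddMonoidHom.mk'
      (fun w => (v.1 * w.2.1 - v.2.2.1 * w.2.2.2, v.1 * w.2.2.1, v.1 * w.2.2.2,
        v.2.1 * w.2.2.1, v.2.1 * w.2.2.2))
      (fun w w' => by
        ext <;> simp <;> ring))
    (fun v v' => by
      ext w <;> simp <;> ring)

theorem pluckerMap_apply {R : Type} [CommRing R] (v w : R × R × R × R) :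
    pluckerMap R v w = (v.1 * w.2.1 - v.2.2.1 * w.2.2.2, v.1 * w.2.2.1, v.1 * w.2.2.2,
      v.2.1 * w.2.2.1, v.2.1 * w.2.2.2) := rfl

/-- By the Plücker relation, no nonzero decomposable bivector is a relation. -/
theorem plucker_symm {R : Type} [CommRing R] [IsReduced R] {v w : R × R × R × R}
    (h : pluckerMap R v w = pluckerMap R w v) : v.1 * w.2.1 = w.1 * v.2.1 := by
  obtain ⟨v₁, v₂, v₃, v₄⟩ := v
  obtain ⟨w₁, w₂, w₃, w₄⟩ := w
  simp only [pluckerMap_apply, Prod.mk.injEq] at h ⊢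
  obtain ⟨h0, h13, h14, h23, h24⟩ := h
  rw [← sub_eq_zero]
  refine pow_eq_zero_iff (two_ne_zero) |>.1 ?_
  linear_combination (v₁ * w₂ - w₁ * v₂) * h0 + (v₂ * w₄ - w₂ * v₄) * h13
    - (v₁ * w₄ - w₁ * v₄) * h23

/-- A `p`-group of class two with large Bogomolov multiplier. -/
abbrev PluckerGroup (p k : ℕ) : Type := BilinGroup (pluckerMap (Fin k → ZMod p))

theorem card_pluckerGroup (p k : ℕ) : Nat.card (PluckerGroup p k) = p ^ (9 * k) := by
  rw [BilinGroup.card_eq]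
  simp only [Nat.card_prod, Nat.card_fun, Nat.card_fin, Nat.card_zmod]
  ring

/-- The 2-cochain on `PluckerGroup p k` attached to `u`. -/
def pluckerCochain {p k : ℕ} [NeZero p] (u : Fin k → ZMod p) (g h : PluckerGroup p k) : QZ :=
  dotQZ u (g.fst.1 * h.fst.2.1)

theorem pullback_pluckerCochain_mem {p k : ℕ} [Fact p.Prime] (hp2 : 2 < p) {G : Type*} [Group G]
    (π : G →* PluckerGroup p k) (u : Fin k → ZMod p) :
    (fun g h => pluckerCochain u (π g) (π h)) ∈ bogomolovCocycles G := by
  refine ⟨fun g h l => ?_, ?_⟩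
  · simp only [pluckerCochain, map_mul, BilinGroup.mul_fst, Prod.fst_add, Prod.snd_add, add_mul,
      mul_add, map_add]
    abel
  · refine AddSubgroup.mem_iInf.2 fun A => AddSubgroup.mem_iInf.2 fun hA => ?_
    have h2 : (2 : ZMod p) * 2⁻¹ = 1 := by
      refine mul_inv_cancel₀ fun h => ?_
      have h' : ((2 : ℕ) : ZMod p) = 0 := by exact_mod_cast h
      rw [ZMod.natCast_eq_zero_iff] at h'
      exact absurd (Nat.le_of_dvd two_pos h') (by omega)
    refine ⟨fun a => -dotQZ ((2⁻¹ : ZMod p) • u) ((π a).fst.1 * (π a).fst.2.1), fun a b => ?_⟩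
    have hcomm : π a * π b = π b * π a := by
      rw [← map_mul, hA a a.2 b b.2, map_mul]
    have hsnd := congrArg BilinGroup.snd hcomm
    rw [BilinGroup.mul_snd, BilinGroup.mul_snd, add_comm (π a).snd, add_right_inj] at hsnd
    have hsymm := plucker_symm hsnd
    change dotQZ u ((π a).fst.1 * (π b).fst.2.1) = _
    have hu : u = (2⁻¹ : ZMod p) • u + (2⁻¹ : ZMod p) • u := by
      rw [← add_smul, ← two_mul, h2, one_smul]
    have hdot : dotQZ u ((π a).fst.1 * (π b).fst.2.1) =
        dotQZ ((2⁻¹ : ZMod p) • u) ((π a).fst.1 * (π b).fst.2.1) +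
        dotQZ ((2⁻¹ : ZMod p) • u) ((π b).fst.1 * (π a).fst.2.1) := by
      rw [← hsymm]
      conv_lhs => rw [hu]
      simp only [dotQZ_apply, add_dotProduct, map_add]
    rw [hdot]
    simp only [Subgroup.coe_mul, map_mul, BilinGroup.mul_fst, Prod.fst_add, Prod.snd_add, add_mul,
      mul_add, map_add]
    abel

theorem eq_zero_of_pluckerCochain_coboundary {p k : ℕ} [NeZero p] {u : Fin k → ZMod p}
    {φ : PluckerGroup p k → QZ}
    (h : ∀ g h, pluckerCochain u g h = φ g + φ h - φ (g * h)) : u = 0 := by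
  refine eq_zero_of_dotQZ_eq_zero fun a => ?_
  have hφ : ∀ g h, φ (g * h) = φ g + φ h - pluckerCochain u g h := fun g k => by
    rw [h g k]
    abel
  let c : PluckerGroup p k := ⟨0, (a, 0)⟩
  let d : PluckerGroup p k := ⟨0, (-a, 0)⟩
  let x : PluckerGroup p k := ⟨(a, 0), 0⟩
  let y : PluckerGroup p k := ⟨(0, 1, 0), 0⟩
  let z : PluckerGroup p k := ⟨(0, 0, a, 0), 0⟩
  let w : PluckerGroup p k := ⟨(0, 0, 0, 1), 0⟩
  have hxy : x * y = y * x * c := by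
    ext1 <;> simp [x, y, c, pluckerMap_apply]
  have hzw : z * w = w * z * d := by
    ext1 <;> simp [z, w, d, pluckerMap_apply]
  have hcd : c * d = 1 := by
    ext1 <;> simp [c, d]
  have h1 : φ 1 = 0 := by simpa [pluckerCochain] using hφ 1 1
  have hc : -dotQZ u a = φ c := by
    have e := congrArg φ hxy
    rw [hφ x y, hφ (y * x) c, hφ y x] at e
    simp only [pluckerCochain, BilinGroup.mul_fst, x, y, c, mul_one, Prod.fst_add,
      Prod.snd_zero, Prod.fst_zero, mul_zero, map_zero, sub_zero] at e
    rw [add_comm, sub_eq_add_neg] at e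
    exact add_left_cancel e
  have hd : φ d = 0 := by
    have e := congrArg φ hzw
    rw [hφ z w, hφ (w * z) d, hφ w z] at e
    simp only [pluckerCochain, BilinGroup.mul_fst, z, w, d, Prod.fst_add,
      Prod.snd_zero, Prod.fst_zero, mul_zero, map_zero, sub_zero] at e
    rw [add_comm] at e
    exact left_eq_add.1 e
  have e := congrArg φ hcd
  rw [hφ c d, h1, hd, ← hc] at e
  simpa [pluckerCochain, c, d] using e

theorem pow_le_bogomolovOrder {p k : ℕ} [Fact p.Prime] (hp2 : 2 < p) {G : Type*} [Group G]
    [Finite G] (π : G →* PluckerGroup p k) (σ : PluckerGroup p k →* G)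
    (hπσ : ∀ g, π (σ g) = g) : p ^ k ≤ bogomolovOrder G := by
  have h := Nat.card_le_card_of_injective
    (fun u : Fin k → ZMod p => (QuotientAddGroup.mk
      (⟨_, pullback_pluckerCochain_mem hp2 π u⟩ : bogomolovCocycles G) :
        ↥(bogomolovCocycles G) ⧸ ((twoCoboundaries G).addSubgroupOf (bogomolovCocycles G)))) (by
      intro u v huv
      rw [QuotientAddGroup.eq, AddSubgroup.mem_addSubgroupOf] at huv
      obtain ⟨φ, hφ⟩ := huv
      have h0 : v - u = 0 := by
        refine eq_zero_of_pluckerCochain_coboundary (φ := fun g => φ (σ g)) fun g h => ?_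
        rw [map_mul, ← hφ]
        simp [pluckerCochain, hπσ, dotQZ_sub, neg_add_eq_sub]
      exact (sub_eq_zero.1 h0).symm)
  rw [Nat.card_fun, Nat.card_zmod, Nat.card_fin] at h
  exact h

theorem card_groupClasses_le_card_bogOrder_ge (p k n : ℕ) [Fact p.Prime] (hp2 : 2 < p) :
    Nat.card (GroupClasses (p ^ n)) ≤
      Nat.card {c : GroupClasses (p ^ (n + 9 * k)) //
        ∃ s : Group (Fin (p ^ (n + 9 * k))),
          Quotient.mk (groupSetoid (Fin (p ^ (n + 9 * k)))) s = c ∧ p ^ k ≤ bogOrder s} *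
        (p ^ (n + 9 * k)) ^ (p ^ (9 * k)) := by
  have : Finite (PluckerGroup p k) := Nat.finite_of_card_ne_zero (by
    rw [card_pluckerGroup]
    exact pow_ne_zero _ (NeZero.ne p))
  have h := card_le_card_classes_mul (m := p ^ (n + 9 * k)) (I := PluckerGroup p k)
    (fun c => ∃ s : Group (Fin (p ^ (n + 9 * k))),
      Quotient.mk (groupSetoid (Fin (p ^ (n + 9 * k)))) s = c ∧ p ^ k ≤ bogOrder s)
    (fun c : GroupClasses (p ^ n) => ClassCarrier c × PluckerGroup p k)
    (fun c g => (1, g))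
    (fun c => by
      obtain ⟨s, ⟨e⟩⟩ := exists_mulEquiv_fin (G := ClassCarrier c × PluckerGroup p k)
        (m := p ^ (n + 9 * k))
        (by rw [Nat.card_prod, card_classCarrier, card_pluckerGroup, pow_add])
      have : Finite (GroupCarrier s) := Finite.of_equiv _ e.toEquiv
      refine ⟨s, ⟨s, rfl, ?_⟩, ⟨e⟩⟩
      exact pow_le_bogomolovOrder (G := GroupCarrier s) hp2
        ((MonoidHom.snd _ _).comp e.symm.toMonoidHom)
        (e.toMonoidHom.comp (MonoidHom.inr _ _)) (fun g => by simp))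
    (fun c d e he => by
      let f : ClassCarrier c →* ClassCarrier d :=
        (MonoidHom.fst _ _).comp (e.toMonoidHom.comp (MonoidHom.inl _ _))
      have hf : ∀ g, f g = (e (g, 1)).1 := fun _ => rfl
      have hsplit : ∀ g l, (e (g, l)).1 = f g := by
        intro g l
        have hgl : ((g, l) : ClassCarrier c × PluckerGroup p k) = (g, 1) * (1, l) := by simp
        rw [hgl, map_mul, he, Prod.fst_mul, mul_one, hf]
      have hsurj : Function.Surjective f := by
        intro g
        obtain ⟨⟨a, l⟩, hal⟩ := e.surjective (g, 1)
        exact ⟨a, by rw [← hsplit a l, hal]⟩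
      exact eq_of_classCarrier_mulEquiv (MulEquiv.ofBijective f
        ((Nat.bijective_iff_surjective_and_card f).2
          ⟨hsurj, by rw [card_classCarrier, card_classCarrier]⟩)))
  rwa [card_pluckerGroup] at h

/-! ### Asymptotics -/

theorem card_groupClasses_pos (m : ℕ) [NeZero m] : 0 < Nat.card (GroupClasses m) := by
  obtain ⟨s, -⟩ := exists_mulEquiv_fin (G := Multiplicative (ZMod m)) (m := m) (by simp)
  have : Nonempty (GroupClasses m) := ⟨Quotient.mk _ s⟩
  exact Nat.card_pos

theorem logb_le_logb_add {p X Y e : ℕ} (hp : 1 < p) (hX : 0 < X) (h : X ≤ Y * p ^ e) :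
    0 < Y ∧ Real.logb p X ≤ Real.logb p Y + e := by
  have hp1 : (1 : ℝ) < p := by exact_mod_cast hp
  have hY : 0 < Y := Nat.pos_of_mul_pos_right (hX.trans_le h)
  refine ⟨hY, ?_⟩
  have hX' : (0 : ℝ) < X := by exact_mod_cast hX
  have hY' : (Y : ℝ) ≠ 0 := by exact_mod_cast hY.ne'
  have h' : (X : ℝ) ≤ Y * (p : ℝ) ^ e := by exact_mod_cast h
  have hlog := (Real.logb_le_logb hp1 hX' (hX'.trans_le h')).2 h'
  rwa [Real.logb_mul hY' (pow_ne_zero _ (by positivity)), Real.logb_pow,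
    Real.logb_self_eq_one hp1, mul_one] at hlog

theorem logb_card_groupClasses_add_le (p n j : ℕ) [Fact p.Prime] :
    Real.logb p (Nat.card (GroupClasses (p ^ (n + j)))) ≤
      Real.logb p (Nat.card (GroupClasses (p ^ n))) + 3 * j * (n + j : ℝ) ^ 2 := by
  have hp : p.Prime := Fact.out
  induction j with
  | zero => simp
  | succ j ih =>
    have h := card_groupClasses_succ_le p (n + j)
    rw [← pow_mul] at h
    have hlog := (logb_le_logb_add hp.one_lt (card_groupClasses_pos _) h).2
    push_cast at hlog ⊢
    rw [← add_assoc n j 1]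
    have hn : (0 : ℝ) ≤ n := n.cast_nonneg
    have hj : (0 : ℝ) ≤ j := j.cast_nonneg
    nlinarith [mul_nonneg hj (add_nonneg hn hj)]

theorem cube_le_logb_card_groupClasses (p n : ℕ) [Fact p.Prime] (hn : 128 ≤ n) :
    (n : ℝ) ^ 3 / 128 ≤ Real.logb p (Nat.card (GroupClasses (p ^ n))) := by
  have hp : p.Prime := Fact.out
  obtain ⟨q, c, hc, hqc, hnq⟩ : ∃ q c : ℕ, q + q + c = n ∧ q ≤ c ∧ n ≤ 4 * q :=
    ⟨n / 3, n - 2 * (n / 3), by omega, by omega, by omega⟩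
  have h := pow_le_card_groupClasses p q c
  rw [hc] at h
  have hlog := (logb_le_logb_add hp.one_lt (pow_pos hp.pos _) h).2
  have hp1 : (1 : ℝ) < p := by exact_mod_cast hp.one_lt
  push_cast at hlog
  rw [Real.logb_pow, Real.logb_self_eq_one hp1, mul_one] at hlog
  push_cast at hlog
  have hn' : (128 : ℝ) ≤ n := by exact_mod_cast hn
  have hq' : (n : ℝ) / 4 ≤ q := by
    have : (n : ℝ) ≤ 4 * q := by exact_mod_cast hnq
    linarith
  have hc' : (n : ℝ) / 4 ≤ c := hq'.trans (by exact_mod_cast hqc)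
  have h3 : (n : ℝ) / 4 * (n / 4) * (n / 4) ≤ q * q * c := by gcongr
  have h4 : 128 * (n : ℝ) ^ 2 ≤ n * n ^ 2 := by gcongr
  nlinarith

theorem tendsto_div_of_le_of_sub_le {a b : ℕ → ℝ} {C D : ℝ} (hD : 0 < D) (hC : 0 ≤ C)
    (ha : ∀ᶠ n : ℕ in atTop, (n : ℝ) ^ 3 / D ≤ a n) (hba : ∀ᶠ n in atTop, b n ≤ a n)
    (hab : ∀ᶠ n : ℕ in atTop, a n - C * (n : ℝ) ^ 2 ≤ b n) :
    Tendsto (fun n => b n / a n) atTop (nhds 1) := by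
  have hlim : Tendsto (fun n : ℕ => 1 - C * D / (n : ℝ)) atTop (nhds 1) := by
    simpa using (tendsto_const_div_atTop_nhds_zero_nat (C * D)).const_sub 1
  refine tendsto_of_tendsto_of_tendsto_of_le_of_le' hlim tendsto_const_nhds ?_ ?_
  · filter_upwards [ha, hab, eventually_gt_atTop 0] with n h1 h2 hn
    have hn' : (0 : ℝ) < n := by exact_mod_cast hn
    have hcube : 0 < (n : ℝ) ^ 3 / D := by positivity
    have hpos : 0 < a n := hcube.trans_le h1
    rw [le_div_iff₀ hpos]
    have h3 : C * D / n * ((n : ℝ) ^ 3 / D) ≤ C * D / n * a n := by gcongr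
    have h4 : C * D / n * ((n : ℝ) ^ 3 / D) = C * (n : ℝ) ^ 2 := by field_simp
    linarith
  · filter_upwards [ha, hba, eventually_gt_atTop 0] with n h1 h2 hn
    have hn' : (0 : ℝ) < n := by exact_mod_cast hn
    have hcube : 0 < (n : ℝ) ^ 3 / D := by positivity
    exact div_le_one_of_le₀ h2 (hcube.trans_le h1).le

/-- fix a prime `p > 2` and a positive integer `M`.  With `#all(n)`
the number of isomorphism classes of groups of order `p^n` and `#B0≥M(n)` the
number of isomorphism classes of groups of order `p^n` whose Bogomolov multiplier
has order at least `M`, `lim_{n→∞} log_p #B0≥M(n) / log_p #all(n) = 1`. -/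
theorem stmt0 (p : ℕ) (hp : p.Prime) (hp2 : 2 < p) (M : ℕ) (hM : 0 < M) :
    Tendsto (fun n : ℕ =>
      Real.logb p (Nat.card {c : GroupClasses (p ^ n) //
        ∃ s : Group (Fin (p ^ n)),
          Quotient.mk (groupSetoid (Fin (p ^ n))) s = c ∧ M ≤ bogOrder s}) /
      Real.logb p (Nat.card (GroupClasses (p ^ n))))
      atTop (nhds 1) := by
  have := Fact.mk hp
  have hM' : M ≤ p ^ M := (Nat.lt_pow_self hp.one_lt).le
  have key : ∀ n, 9 * M ≤ n → _ := fun n hn =>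
    logb_le_logb_add hp.one_lt (card_groupClasses_pos (p ^ (n - 9 * M)))
      (X := Nat.card (GroupClasses (p ^ (n - 9 * M))))
      (Y := Nat.card {c : GroupClasses (p ^ n) // ∃ s : Group (Fin (p ^ n)),
        Quotient.mk (groupSetoid (Fin (p ^ n))) s = c ∧ M ≤ bogOrder s})
      (e := n * p ^ (9 * M)) (by
        obtain ⟨l, rfl⟩ := Nat.exists_eq_add_of_le' hn
        rw [Nat.add_sub_cancel, pow_mul]
        refine (card_groupClasses_le_card_bogOrder_ge p M l hp2).trans
          (Nat.mul_le_mul_right _ ?_)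
        exact Nat.card_le_card_of_injective
          (Subtype.map id fun c ⟨s, hs, h⟩ => ⟨s, hs, hM'.trans h⟩)
          (Subtype.map_injective _ Function.injective_id))
  have hp1 : (1 : ℝ) < p := by exact_mod_cast hp.one_lt
  refine tendsto_div_of_le_of_sub_le (C := p ^ (9 * M) + 3 * (9 * M : ℕ)) (D := 128) (by norm_num)
    (by positivity) ?_ ?_ ?_
  · filter_upwards [eventually_ge_atTop 128] with n hn
    exact cube_le_logb_card_groupClasses p n hn
  · filter_upwards [eventually_ge_atTop (9 * M)] with n hn
    have hle := Finite.card_subtype_le fun c : GroupClasses (p ^ n) =>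
      ∃ s : Group (Fin (p ^ n)),
        Quotient.mk (groupSetoid (Fin (p ^ n))) s = c ∧ M ≤ bogOrder s
    exact Real.logb_le_logb_of_le hp1 (by exact_mod_cast (key n hn).1) (by exact_mod_cast hle)
  · filter_upwards [eventually_ge_atTop (9 * M), eventually_ge_atTop 1] with n hn hn1
    have h1 := logb_card_groupClasses_add_le p (n - 9 * M) (9 * M)
    have h2 := (key n hn).2
    rw [Nat.sub_add_cancel hn, ← Nat.cast_add, Nat.sub_add_cancel hn] at h1
    have hn' : (1 : ℝ) ≤ n := by exact_mod_cast hn1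
    have h3 : (n : ℝ) * p ^ (9 * M) ≤ n ^ 2 * p ^ (9 * M) := by
      gcongr
      nlinarith
    push_cast at h1 h2 ⊢
    linarith

end
end

section
/- Fix integers d ≥ 4 and r with binom(d−2,2) + 1 ≤ r ≤ binom(d,2). Then liminf over primes p → ∞ of the ratio (number of r-dimensional F_p-subspaces of ⋀²(F_p^d) that are spanned by decomposables) / (number of all r-dimensional F_p-subspaces of ⋀²(F_p^d)) is at least (1/C_{d−2})^r, where C_{d−2} is the (d−2)-nd Catalan number; in particular this proportion is bounded away from 0 as p → ∞. -/
open Module Filter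

noncomputable section

variable (K : Type*) [CommRing K] (V : Type*) [AddCommGroup V] [Module K V]

/-- The set of decomposable elements of the exterior square, viewed inside the
exterior algebra: elements of the form `v ∧ w`. -/
def DecompSet : Set (ExteriorAlgebra K V) :=
  {x | ∃ v w : V, x = ExteriorAlgebra.ι K v * ExteriorAlgebra.ι K w}

/-- The second exterior power `⋀² V`, realised as the span of all decomposable
wedges inside the exterior algebra. -/
def grade2 : Submodule K (ExteriorAlgebra K V) := Submodule.span K (DecompSet K V)

/-- A subspace `L ≤ ⋀² V` is spanned by decomposables if it equals the span of the
set of decomposable elements contained in it. -/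
def SpannedByDecomposables (L : Submodule K (ExteriorAlgebra K V)) : Prop :=
  L = Submodule.span K ((L : Set (ExteriorAlgebra K V)) ∩ DecompSet K V)

/-- The number of `r`-dimensional subspaces of `⋀²(F_p^d)` that are spanned by
decomposables. -/
def numSpanned (p d r : ℕ) : ℕ :=
  Nat.card {L : Submodule (ZMod p) (ExteriorAlgebra (ZMod p) (Fin d → ZMod p)) //
    L ≤ grade2 (ZMod p) (Fin d → ZMod p) ∧ finrank (ZMod p) L = r ∧
    SpannedByDecomposables (ZMod p) (Fin d → ZMod p) L}

/-- The number of all `r`-dimensional subspaces of `⋀²(F_p^d)`. -/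
def numAll (p d r : ℕ) : ℕ :=
  Nat.card {L : Submodule (ZMod p) (ExteriorAlgebra (ZMod p) (Fin d → ZMod p)) //
    L ≤ grade2 (ZMod p) (Fin d → ZMod p) ∧ finrank (ZMod p) L = r}

/-- The proportion of `r`-dimensional subspaces of `⋀²(F_p^d)` that are spanned
by decomposables. -/
def decompRatio (p d r : ℕ) : ℝ := (numSpanned p d r : ℝ) / (numAll p d r : ℝ)

/-- The filter of primes tending to infinity. -/
def primesAtTop : Filter ℕ := atTop ⊓ 𝓟 {p : ℕ | p.Prime}

namespace ExteriorSquare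

section Wedge

variable {F E : Type*} [Field F] [AddCommGroup E] [Module F E]

/-- The wedge product `v ∧ w` as a bilinear map to the exterior square. -/
def wedge : E →ₗ[F] E →ₗ[F] ⋀[F]^2 E :=
  LinearMap.mk₂ F
    (fun v w => ⟨ExteriorAlgebra.ι F v * ExteriorAlgebra.ι F w, by
      rw [ExteriorAlgebra.exteriorPower, pow_two]
      exact Submodule.mul_mem_mul (LinearMap.mem_range_self _ v) (LinearMap.mem_range_self _ w)⟩)
    (fun v v' w => by ext; simp [add_mul])
    (fun c v w => by ext; simp)
    (fun v w w' => by ext; simp [mul_add])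
    (fun c v w => by ext; simp)

@[simp]
lemma coe_wedge (v w : E) :
    ((wedge (F := F) v w : ⋀[F]^2 E) : ExteriorAlgebra F E) =
      ExteriorAlgebra.ι F v * ExteriorAlgebra.ι F w := rfl

@[simp]
lemma wedge_self (v : E) : wedge (F := F) v v = 0 := by
  ext; simp

lemma wedge_swap (v w : E) : wedge (F := F) v w = -wedge (F := F) w v := by
  ext
  simpa using eq_neg_of_add_eq_zero_left (ExteriorAlgebra.ι_add_mul_swap (R := F) v w)

lemma span_range_wedge :
    Submodule.span F (Set.range fun p : E × E => wedge (F := F) p.1 p.2) = ⊤ := by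
  rw [← exteriorPower.ιMulti_span F 2 E]
  congr 1
  ext x
  constructor
  · rintro ⟨p, rfl⟩
    exact ⟨![p.1, p.2], by ext; simp [ExteriorAlgebra.ιMulti_apply]⟩
  · rintro ⟨f, rfl⟩
    exact ⟨(f 0, f 1), by ext; simp [ExteriorAlgebra.ιMulti_apply, Matrix.vecTail]⟩

lemma contract_eq_of_wedge_eq {v w v' w' : E} (h : wedge (F := F) v w = wedge v' w')
    (φ : Dual F E) : φ v • w - φ w • v = φ v' • w' - φ w' • v' := by
  have key (a b : E) : CliffordAlgebra.contractLeft φ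
      (ExteriorAlgebra.ι F a * ExteriorAlgebra.ι F b : ExteriorAlgebra F E) =
        ExteriorAlgebra.ι F (φ a • b - φ b • a) := by
    rw [map_sub, map_smul, map_smul]
    refine (CliffordAlgebra.contractLeft_ι_mul φ a _).trans ?_
    rw [show CliffordAlgebra.contractLeft φ (ExteriorAlgebra.ι F b : ExteriorAlgebra F E) =
      algebraMap F _ (φ b) from CliffordAlgebra.contractLeft_ι _ φ b]
    rw [← Algebra.commutes, ← Algebra.smul_def]
  have h' := congrArg (fun x : ⋀[F]^2 E => CliffordAlgebra.contractLeft φ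
    (x : ExteriorAlgebra F E)) h
  simp only [coe_wedge, key] at h'
  exact (ExteriorAlgebra.ι_inj F _ _).1 h'

lemma wedge_eq_zero_of_not_linearIndependent {v w : E}
    (h : ¬ LinearIndependent F ![v, w]) : wedge (F := F) v w = 0 := by
  rw [LinearIndependent.pair_iff] at h
  push Not at h
  obtain ⟨s, t, hst, hne⟩ := h
  by_cases hs : s = 0
  · have ht : t ≠ 0 := hne hs
    have : w = 0 := by simpa [hs, ht] using hst
    simp [this]
  · have : v = -(s⁻¹ * t) • w := by
      have : s • v = -(t • w) := eq_neg_of_add_eq_zero_left hst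
      rw [← inv_smul_smul₀ hs v, this, neg_smul, smul_neg, smul_smul]
    rw [this]; simp

lemma exists_dual_pair {v w : E} (h : LinearIndependent F ![v, w]) :
    ∃ φ : Dual F E, φ v = 1 ∧ φ w = 0 := by
  have hv : v ∉ Submodule.span F {w} := by
    intro hv
    obtain ⟨c, hc⟩ := Submodule.mem_span_singleton.1 hv
    rw [LinearIndependent.pair_iff] at h
    have := (h 1 (-c) (by rw [← hc]; simp)).1
    exact one_ne_zero this
  obtain ⟨f, hf, hf'⟩ := Submodule.exists_le_ker_of_notMem hv
  refine ⟨(f v)⁻¹ • f, by simp [hf], ?_⟩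
  have : f w = 0 := hf' (Submodule.mem_span_singleton_self w)
  simp [this]

lemma wedge_ne_zero_iff {v w : E} :
    wedge (F := F) v w ≠ 0 ↔ LinearIndependent F ![v, w] := by
  refine ⟨fun h => by_contra fun h' => h (wedge_eq_zero_of_not_linearIndependent h'),
    fun h h0 => ?_⟩
  obtain ⟨φ, hv, hw⟩ := exists_dual_pair h
  have := contract_eq_of_wedge_eq (v' := (0 : E)) (w' := 0) (by rw [h0]; simp) φ
  rw [hv, hw] at this
  have hw0 : w = 0 := by simpa using this
  exact h.ne_zero 1 (by simpa using hw0)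

lemma exists_coeff_of_wedge_eq {v w v' w' : E} (h : LinearIndependent F ![v, w])
    (he : wedge (F := F) v' w' = wedge v w) :
    ∃ m : (F × F) × F × F, m.1.1 • v + m.1.2 • w = v' ∧ m.2.1 • v + m.2.2 • w = w' := by
  have h' : LinearIndependent F ![v', w'] := by
    rw [← wedge_ne_zero_iff, he]; exact wedge_ne_zero_iff.2 h
  have h'' : LinearIndependent F ![w', v'] := by
    rw [← wedge_ne_zero_iff, wedge_swap, neg_ne_zero]; exact wedge_ne_zero_iff.2 h'
  obtain ⟨φ, hv, hw⟩ := exists_dual_pair h'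
  obtain ⟨ψ, hv', hw'⟩ := exists_dual_pair h''
  have h1 := contract_eq_of_wedge_eq he φ
  have h2 := contract_eq_of_wedge_eq he ψ
  refine ⟨((ψ w, -ψ v), (-φ w, φ v)), ?_, ?_⟩
  · rw [hv', hw'] at h2
    simp only [zero_smul, one_smul, zero_sub] at h2
    rw [← neg_inj, h2]; simp only [neg_smul]; abel
  · rw [hv, hw] at h1
    simp only [zero_smul, one_smul, sub_zero] at h1
    rw [h1]; simp only [neg_smul]; abel

lemma wedge_comb (v w : E) (a b c e : F) :
    wedge (F := F) (a • v + b • w) (c • v + e • w) = (a * e - b * c) • wedge v w := by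
  simp only [map_add, map_smul, LinearMap.add_apply, LinearMap.smul_apply, wedge_self,
    wedge_swap w v, smul_neg, smul_zero, zero_add, add_zero]
  module

end Wedge

open scoped Classical in
lemma card_det_eq_one (F : Type*) [Field F] [Fintype F] :
    (Finset.univ.filter fun m : (F × F) × F × F =>
      m.1.1 * m.2.2 - m.1.2 * m.2.1 = 1).card =
      Fintype.card F * (Fintype.card F ^ 2 - 1) := by
  have key (m : F × F) : (Finset.univ.filter fun n : F × F =>
      m.1 * n.2 - m.2 * n.1 = 1).card = if m = 0 then 0 else Fintype.card F := by
    obtain ⟨a, b⟩ := m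
    split_ifs with h
    · obtain ⟨rfl, rfl⟩ := Prod.mk_eq_zero.1 h
      simp
    · by_cases ha : a = 0
      · have hb : b ≠ 0 := fun hb => h (by simp [ha, hb])
        rw [← Finset.card_univ (α := F), ← Finset.card_image_of_injective
          (f := fun e : F => ((a * e - 1) / b, e)) Finset.univ
          (fun x y hxy => (Prod.mk.inj hxy).2)]
        congr 1
        ext ⟨c, e⟩
        simp only [Finset.mem_filter, Finset.mem_univ, true_and, Finset.mem_image, Prod.mk.injEq]
        constructor
        · intro hc
          exact ⟨e, by field_simp; linear_combination hc, rfl⟩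
        · rintro ⟨_, h1, rfl⟩
          field_simp at h1
          linear_combination h1
      · rw [← Finset.card_univ (α := F), ← Finset.card_image_of_injective
          (f := fun c : F => (c, (1 + b * c) / a)) Finset.univ
          (fun x y hxy => (Prod.mk.inj hxy).1)]
        congr 1
        ext ⟨c, e⟩
        simp only [Finset.mem_filter, Finset.mem_univ, true_and, Finset.mem_image, Prod.mk.injEq]
        constructor
        · intro hc
          exact ⟨c, rfl, by field_simp; linear_combination -hc⟩
        · rintro ⟨_, rfl, h1⟩
          field_simp at h1
          linear_combination -h1
  rw [Finset.card_filter, Fintype.sum_prod_type]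
  simp_rw [← Finset.card_filter, key]
  rw [Finset.sum_ite]
  simp only [Finset.sum_const_zero, Finset.sum_const, smul_eq_mul, zero_add]
  rw [mul_comm, Finset.filter_ne', Finset.card_erase_of_mem (Finset.mem_univ _),
    Finset.card_univ, Fintype.card_prod, pow_two]

section Count

variable {F E : Type*} [Field F] [AddCommGroup E] [Module F E]
  [Fintype F] [Fintype E] [Fintype (⋀[F]^2 E)]

local notation "q" => Fintype.card F
local notation "d" => Module.finrank F E

variable (F E) in
open scoped Classical in
/-- The nonzero decomposable elements of the exterior square. -/
def decomposables : Finset (⋀[F]^2 E) :=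
  Finset.univ.filter fun x => x ≠ 0 ∧ ∃ v w : E, x = wedge v w

lemma mem_decomposables {x : ⋀[F]^2 E} :
    x ∈ decomposables F E ↔ x ≠ 0 ∧ ∃ v w : E, x = wedge v w := by
  simp [decomposables]

lemma smul_mem_decomposables {c : F} (hc : c ≠ 0) {x : ⋀[F]^2 E}
    (hx : x ∈ decomposables F E) : c • x ∈ decomposables F E := by
  rw [mem_decomposables] at hx ⊢
  obtain ⟨h0, v, w, rfl⟩ := hx
  exact ⟨smul_ne_zero hc h0, c • v, w, by simp⟩

open scoped Classical in
lemma card_fiber_wedge {x : ⋀[F]^2 E} (hx : x ∈ decomposables F E) :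
    (Finset.univ.filter fun p : E × E => wedge (F := F) p.1 p.2 = x).card =
      q * (q ^ 2 - 1) := by
  obtain ⟨h0, v, w, rfl⟩ := mem_decomposables.1 hx
  have hli := wedge_ne_zero_iff.1 h0
  rw [← card_det_eq_one F]
  symm
  refine Finset.card_bij (fun m _ => (m.1.1 • v + m.1.2 • w, m.2.1 • v + m.2.2 • w)) ?_ ?_ ?_
  · rintro ⟨⟨a, b⟩, c, e⟩ hm
    simp only [Finset.mem_filter, Finset.mem_univ, true_and] at hm ⊢
    rw [wedge_comb, hm, one_smul]
  · rintro ⟨⟨a, b⟩, c, e⟩ - ⟨⟨a', b'⟩, c', e'⟩ - h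
    simp only [Prod.mk.injEq] at h ⊢
    rw [LinearIndependent.pair_iff] at hli
    have h1 := hli (a - a') (b - b') (by rw [← sub_eq_zero.2 h.1]; module)
    have h2 := hli (c - c') (e - e') (by rw [← sub_eq_zero.2 h.2]; module)
    simp only [sub_eq_zero] at h1 h2
    exact ⟨h1, h2⟩
  · rintro ⟨v', w'⟩ hp
    simp only [Finset.mem_filter, Finset.mem_univ, true_and] at hp
    obtain ⟨⟨⟨a, b⟩, c, e⟩, h1, h2⟩ := exists_coeff_of_wedge_eq hli hp
    refine ⟨⟨⟨a, b⟩, c, e⟩, ?_, by simp only [h1, h2]⟩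
    simp only [Finset.mem_filter, Finset.mem_univ, true_and]
    rw [← h1, ← h2, wedge_comb] at hp
    exact smul_left_injective F h0 (by simpa using hp)

/-- Counting pairs of vectors whose wedge lies in a set of decomposables. -/
lemma card_filter_wedge_mem (Y : Finset (⋀[F]^2 E)) (hY : Y ⊆ decomposables F E)
    [DecidablePred fun p : E × E => wedge (F := F) p.1 p.2 ∈ Y] :
    (Finset.univ.filter fun p : E × E => wedge (F := F) p.1 p.2 ∈ Y).card =
      Y.card * (q * (q ^ 2 - 1)) := by
  classical
  rw [Finset.card_eq_sum_card_fiberwise (f := fun p : E × E => wedge (F := F) p.1 p.2) (t := Y)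
    (fun p hp => by simpa using hp), ← smul_eq_mul, ← Finset.sum_const]
  refine Finset.sum_congr rfl fun y hy => ?_
  rw [← card_fiber_wedge (hY hy)]
  congr 1
  ext p
  simp only [Finset.mem_filter, Finset.mem_univ, true_and]
  exact ⟨fun h => h.2, fun h => ⟨by rw [h]; exact hy, h⟩⟩

lemma card_decomposables (hd : 2 ≤ d) :
    (decomposables F E).card * (q * (q ^ 2 - 1)) = (q ^ d - 1) * (q ^ d - q) := by
  classical
  rw [← card_filter_wedge_mem _ subset_rfl]
  have h := card_linearIndependent (K := F) (V := E) hd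
  rw [Fin.prod_univ_two] at h
  simp only [Fin.val_zero, pow_zero, Fin.val_one, pow_one] at h
  rw [← h, Nat.card_eq_fintype_card, Fintype.card_subtype]
  refine Finset.card_bij' (fun p _ => ![p.1, p.2]) (fun s _ => (s 0, s 1)) ?_ ?_ ?_ ?_
  · intro p hp
    simp only [Finset.mem_filter, Finset.mem_univ, true_and, mem_decomposables] at hp ⊢
    exact wedge_ne_zero_iff.1 hp.1
  · intro s hs
    simp only [Finset.mem_filter, Finset.mem_univ, true_and, mem_decomposables] at hs ⊢
    refine ⟨wedge_ne_zero_iff.2 ?_, _, _, rfl⟩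
    convert hs using 1
    ext i; fin_cases i <;> rfl
  · intro p _; rfl
  · intro s _
    ext i; fin_cases i <;> rfl

open scoped Classical in
/-- A nonzero functional on the exterior square vanishes on few decomposables. -/
lemma card_decomposables_ker_le (l : Dual F (⋀[F]^2 E)) (hl : l ≠ 0) :
    ((decomposables F E).filter fun x => l x = 0).card * (q * (q ^ 2 - 1)) * q ≤
      2 * q ^ (2 * d) := by
  rw [← card_filter_wedge_mem _ (Finset.filter_subset _ _)]
  have hcardE : Fintype.card E = q ^ d := Module.card_eq_pow_finrank
  have hker (g : Dual F E) (hg : g ≠ 0) :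
      (Finset.univ.filter fun w => g w = 0).card * q = q ^ d := by
    have h1 := Module.Dual.finrank_ker_add_one_of_ne_zero hg
    have h2 : (Finset.univ.filter fun w => g w = 0).card = q ^ finrank F (LinearMap.ker g) := by
      rw [← Module.card_eq_pow_finrank (K := F) (V := LinearMap.ker g), Fintype.card_subtype]
      simp only [LinearMap.mem_ker]
    rw [h2, ← pow_succ, h1]
  set B : E →ₗ[F] Dual F E := (wedge (F := F) (E := E)).compr₂ l with hB
  have hB0 : B ≠ 0 := by
    intro h0
    apply hl
    apply LinearMap.ext_on_range (v := fun p : E × E => wedge (F := F) p.1 p.2) span_range_wedge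
    intro p
    exact LinearMap.congr_fun (LinearMap.congr_fun h0 p.1) p.2
  obtain ⟨w₀, hw₀⟩ : ∃ w, B.flip w ≠ 0 := by
    by_contra! h
    exact hB0 (by ext v w; exact LinearMap.congr_fun (h w) v)
  calc _ ≤ ((Finset.univ.filter fun p : E × E => B p.1 p.2 = 0).card) * q := by
        gcongr
        intro h
        exact (Finset.mem_filter.1 h).2
    _ = ∑ v : E, (Finset.univ.filter fun w => B v w = 0).card * q := by
        rw [Finset.card_filter, Fintype.sum_prod_type, Finset.sum_mul]
        simp_rw [← Finset.card_filter]
    _ ≤ ∑ v : E, ((if B.flip w₀ v = 0 then q ^ d * q else 0) + q ^ d) := by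
        refine Finset.sum_le_sum fun v _ => ?_
        by_cases hv : B v = 0
        · have : B.flip w₀ v = 0 := by simp [hv]
          rw [if_pos this]
          refine le_trans ?_ (Nat.le_add_right _ _)
          gcongr
          exact (Finset.card_le_univ _).trans hcardE.le
        · rw [hker (B v) hv]; exact Nat.le_add_left _ _
    _ = 2 * q ^ (2 * d) := by
        rw [Finset.sum_add_distrib, ← Finset.sum_filter, Finset.sum_const, Finset.sum_const,
          Finset.card_univ, hcardE, smul_eq_mul, smul_eq_mul, mul_left_comm, hker _ hw₀]
        ring

end Count

section Subspaces

variable {F U : Type*} [Field F] [AddCommGroup U] [Module F U] [Fintype F]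

local notation "q" => Fintype.card F

variable (F U) in
lemma card_submodule_finrank_mul_le [Finite U] (r : ℕ) :
    Nat.card {L : Submodule F U // finrank F L = r} * ∏ i : Fin r, (q ^ r - q ^ (i : ℕ)) ≤
      q ^ (finrank F U * r) := by
  classical
  have := Fintype.ofFinite {L : Submodule F U // finrank F L = r}
  have hcard (L : {L : Submodule F U // finrank F L = r}) :
      Nat.card {s : Fin r → L.1 // LinearIndependent F s} =
        ∏ i : Fin r, (q ^ r - q ^ (i : ℕ)) := by
    rw [card_linearIndependent L.2.ge, L.2]
  have hsig : Nat.card (Σ L : {L : Submodule F U // finrank F L = r},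
      {s : Fin r → L.1 // LinearIndependent F s}) =
      Nat.card {L : Submodule F U // finrank F L = r} * ∏ i : Fin r, (q ^ r - q ^ (i : ℕ)) := by
    rw [Nat.card_sigma, Finset.sum_congr rfl fun L _ => hcard L, Finset.sum_const,
      Finset.card_univ, smul_eq_mul, Nat.card_eq_fintype_card]
  have hU : Nat.card (Fin r → U) = q ^ (finrank F U * r) := by
    have := Fintype.ofFinite U
    rw [Nat.card_eq_fintype_card, Fintype.card_fun, Module.card_eq_pow_finrank (K := F) (V := U),
      Fintype.card_fin, pow_mul]
  rw [← hsig, ← hU]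
  have hspan (L : {L : Submodule F U // finrank F L = r})
      (s : {s : Fin r → L.1 // LinearIndependent F s}) :
      Submodule.span F (Set.range fun i => (s.1 i : U)) = L.1 := by
    have h1 : LinearIndependent F fun i => (s.1 i : U) := s.2.map' L.1.subtype L.1.ker_subtype
    apply Submodule.eq_of_le_of_finrank_eq
    · rw [Submodule.span_le]; rintro _ ⟨i, rfl⟩; exact (s.1 i).2
    · rw [finrank_span_eq_card h1, Fintype.card_fin, L.2]
  refine Nat.card_le_card_of_injective (fun p i => (p.2.1 i : U)) ?_
  rintro ⟨L, s⟩ ⟨L', s'⟩ h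
  obtain rfl : L = L' := by
    apply Subtype.ext
    rw [← hspan L s, ← hspan L' s']
    exact congrArg (fun f : Fin r → U => Submodule.span F (Set.range f)) h
  congr 1
  apply Subtype.ext
  funext i
  exact Subtype.ext (congrFun h i)

variable (F U) in
lemma card_submodule_finrank_mul_pow_le [Finite U] (s : ℕ) :
    Nat.card {L : Submodule F U // finrank F L = s} * q ^ (s * s) ≤
      2 ^ s * q ^ (finrank F U * s) := by
  have hq : 2 ≤ q := Fintype.one_lt_card
  have h : q ^ (s * s) ≤ 2 ^ s * ∏ i : Fin s, (q ^ s - q ^ (i : ℕ)) := by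
    calc q ^ (s * s) = ∏ _i : Fin s, q ^ s := by simp [pow_mul]
      _ ≤ ∏ i : Fin s, 2 * (q ^ s - q ^ (i : ℕ)) := by
          refine Finset.prod_le_prod' fun i _ => ?_
          have h1 : q ^ (i : ℕ) * 2 ≤ q ^ s := by
            calc q ^ (i : ℕ) * 2 ≤ q ^ (i : ℕ) * q := by gcongr
              _ = q ^ ((i : ℕ) + 1) := (pow_succ _ _).symm
              _ ≤ q ^ s := Nat.pow_le_pow_right (by omega) i.2
          omega
      _ = _ := by simp [Finset.prod_mul_distrib]
  calc _ ≤ Nat.card {L : Submodule F U // finrank F L = s} *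
        (2 ^ s * ∏ i : Fin s, (q ^ s - q ^ (i : ℕ))) := by gcongr
    _ = 2 ^ s * (Nat.card {L : Submodule F U // finrank F L = s} *
        ∏ i : Fin s, (q ^ s - q ^ (i : ℕ))) := by ring
    _ ≤ _ := by gcongr; exact card_submodule_finrank_mul_le F U s

open scoped Classical in
lemma card_filter_map_mem_mul_le {A : Type*} [AddCommGroup A] [Module F A] [Fintype A]
    (T : A →ₗ[F] U) (Y : Finset U) :
    (Finset.univ.filter fun a => T a ∈ Y).card * q ^ finrank F (LinearMap.range T) ≤
      (Y.filter fun x => x ∈ LinearMap.range T).card * q ^ finrank F A := by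
  have hfib (x : U) : (Finset.univ.filter fun a => T a = x).card ≤
      q ^ finrank F (LinearMap.ker T) := by
    by_cases hx : ∃ a, T a = x
    · obtain ⟨a₀, rfl⟩ := hx
      rw [← Module.card_eq_pow_finrank (K := F) (V := LinearMap.ker T), Fintype.card_subtype]
      refine Finset.card_le_card_of_injOn (fun a => a - a₀) ?_
        (fun a _ b _ h => sub_left_injective h)
      intro a ha
      have ha : T a = T a₀ := by simpa using ha
      simp [LinearMap.mem_ker, ha]
    · rw [Finset.filter_false_of_mem fun a _ h => hx ⟨a, h⟩]; simp
  have hle : (Finset.univ.filter fun a => T a ∈ Y).card ≤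
      (Y.filter fun x => x ∈ LinearMap.range T).card * q ^ finrank F (LinearMap.ker T) := by
    rw [Finset.card_eq_sum_card_fiberwise (f := T) (t := Y.filter fun x => x ∈ LinearMap.range T)
      (fun a ha => by simpa using ha), ← smul_eq_mul]
    refine Finset.sum_le_card_nsmul _ _ _ fun x _ => ?_
    refine le_trans (Finset.card_le_card ?_) (hfib x)
    intro a ha
    simp only [Finset.mem_filter, Finset.mem_univ, true_and] at ha ⊢
    exact ha.2
  calc _ ≤ _ * q ^ finrank F (LinearMap.range T) := Nat.mul_le_mul_right _ hle
    _ = _ := by rw [mul_assoc, ← pow_add, add_comm, LinearMap.finrank_range_add_finrank_ker]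

end Subspaces

section WedgeSubspace

variable {F E : Type*} [Field F] [AddCommGroup E] [Module F E]

local notation "d" => Module.finrank F E

lemma wedge_eq_ιMulti (v w : E) :
    wedge (F := F) v w = exteriorPower.ιMulti F 2 ![v, w] := by
  ext; simp [ExteriorAlgebra.ιMulti_apply]

lemma map_wedge {E' : Type*} [AddCommGroup E'] [Module F E'] (g : E →ₗ[F] E') (v w : E) :
    exteriorPower.map 2 g (wedge (F := F) v w) = wedge (F := F) (g v) (g w) := by
  rw [wedge_eq_ιMulti, wedge_eq_ιMulti, exteriorPower.map_apply_ιMulti]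
  congr 1
  ext i; fin_cases i <;> rfl

/-- The subspace `E ∧ S` of the exterior square. -/
abbrev wedgeSubspace (S : Submodule F E) : Submodule F (⋀[F]^2 E) :=
  Submodule.map₂ wedge ⊤ S

lemma choose_finrank_le [FiniteDimensional F E] (S : Submodule F E) :
    Nat.choose d 2 ≤ finrank F (wedgeSubspace S) + (d - finrank F S).choose 2 := by
  obtain ⟨C, hC⟩ := S.exists_isCompl
  have htop : wedgeSubspace S ⊔ LinearMap.range (exteriorPower.map 2 C.subtype) = ⊤ := by
    rw [eq_top_iff, ← span_range_wedge, Submodule.span_le]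
    rintro _ ⟨⟨v, w⟩, rfl⟩
    obtain ⟨s, hs, c, hc, rfl⟩ := Submodule.mem_sup.1
      (show v ∈ S ⊔ C by rw [hC.sup_eq_top]; trivial)
    obtain ⟨s', hs', c', hc', rfl⟩ := Submodule.mem_sup.1
      (show w ∈ S ⊔ C by rw [hC.sup_eq_top]; trivial)
    have key : wedge (F := F) (s + c) (s' + c') =
        (wedge (s + c) s' - wedge c' s) + wedge c c' := by
      simp only [map_add, LinearMap.add_apply, wedge_swap c' s]
      abel
    simp only [SetLike.mem_coe, key]
    refine Submodule.add_mem_sup (Submodule.sub_mem _ ?_ ?_) ?_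
    · exact Submodule.apply_mem_map₂ _ trivial hs'
    · exact Submodule.apply_mem_map₂ _ trivial hs
    · exact ⟨wedge ⟨c, hc⟩ ⟨c', hc'⟩, by rw [map_wedge]; rfl⟩
  have h1 := Submodule.finrank_add_le_finrank_add_finrank (wedgeSubspace S)
    (LinearMap.range (exteriorPower.map 2 C.subtype))
  have h2 := LinearMap.finrank_range_le (exteriorPower.map (R := F) 2 C.subtype)
  have h3 := Submodule.finrank_add_eq_of_isCompl hC
  rw [htop, finrank_top, exteriorPower.finrank_eq] at h1
  rw [exteriorPower.finrank_eq] at h2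
  rw [show d - finrank F S = finrank F C by omega]
  omega

lemma exists_wedge_of_mem_wedgeSubspace {S : Submodule F E} {a b : E}
    (h : wedge (F := F) a b ∈ wedgeSubspace S) :
    ∃ u ∈ S, ∃ v, wedge (F := F) a b = wedge u v := by
  have h0 : wedge (F := F) (S.mkQ a) (S.mkQ b) = 0 := by
    rw [← map_wedge, ← LinearMap.mem_ker]
    refine (Submodule.map₂_le.2 fun v _ u hu => ?_ : wedgeSubspace S ≤ _) h
    have hu' : S.mkQ u = 0 := by simpa using hu
    rw [LinearMap.mem_ker, map_wedge, hu', map_zero]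
  have h1 : ¬ LinearIndependent F ![S.mkQ a, S.mkQ b] := fun hl => wedge_ne_zero_iff.2 hl h0
  rw [LinearIndependent.pair_iff] at h1
  push Not at h1
  obtain ⟨s, t, hst, hne⟩ := h1
  have hmem : s • a + t • b ∈ S := by
    rw [← map_smul, ← map_smul, ← map_add] at hst
    rwa [← Submodule.ker_mkQ S]
  refine ⟨_, hmem, ?_⟩
  by_cases hs : s = 0
  · refine ⟨-t⁻¹ • a, ?_⟩
    simp [hs, hne hs, wedge_swap a b]
  · exact ⟨s⁻¹ • b, by simp [hs]⟩

variable [Fintype F] [Fintype E] [Fintype (⋀[F]^2 E)]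

local notation "q" => Fintype.card F

open scoped Classical in
lemma card_decomposables_wedgeSubspace_le (S : Submodule F E) :
    ((decomposables F E).filter fun x => x ∈ wedgeSubspace S).card * q ^ 2 ≤
      2 * q ^ (finrank F S + d) := by
  have hq : 2 ≤ q := Fintype.one_lt_card
  have hfib (x) (hx : x ∈ (decomposables F E).filter fun x => x ∈ wedgeSubspace S) :
      (q - 1) * q ≤ (((Finset.univ.filter fun u => u ∈ S) ×ˢ (Finset.univ : Finset E)).filter
        fun p => wedge (F := F) p.1 p.2 = x).card := by
    obtain ⟨hx, hS⟩ := Finset.mem_filter.1 hx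
    obtain ⟨h0, a, b, rfl⟩ := mem_decomposables.1 hx
    obtain ⟨u, hu, v, huv⟩ := exists_wedge_of_mem_wedgeSubspace hS
    rw [huv] at h0 ⊢
    have hli := wedge_ne_zero_iff.1 h0
    rw [LinearIndependent.pair_iff] at hli
    have hc : (q - 1) * q = ((Finset.univ.erase (0 : F)) ×ˢ (Finset.univ : Finset F)).card := by
      simp [Finset.card_product]
    rw [hc]
    refine Finset.card_le_card_of_injOn (fun m => (m.1 • u, m.1⁻¹ • v + m.2 • u)) ?_ ?_
    · rintro ⟨c, t⟩ hm
      have hm : c ≠ 0 := by simpa using hm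
      simp [S.smul_mem c hu, hm]
    · rintro ⟨c, t⟩ - ⟨c', t'⟩ - h
      simp only [Prod.mk.injEq] at h ⊢
      have hc : c = c' := by
        have := hli (c - c') 0 (by rw [← sub_eq_zero.2 h.1]; module)
        exact sub_eq_zero.1 this.1
      subst hc
      have := hli (t - t') 0 (by rw [← sub_eq_zero.2 h.2]; module)
      exact ⟨rfl, sub_eq_zero.1 this.1⟩
  have hS : (Finset.univ.filter fun u => u ∈ S).card = q ^ finrank F S := by
    rw [← Module.card_eq_pow_finrank (K := F) (V := S), Fintype.card_subtype]
  have h1 : ((decomposables F E).filter fun x => x ∈ wedgeSubspace S).card * ((q - 1) * q) ≤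
      q ^ (finrank F S + d) := by
    calc _ ≤ ∑ x ∈ (decomposables F E).filter fun x => x ∈ wedgeSubspace S,
          (((Finset.univ.filter fun u => u ∈ S) ×ˢ (Finset.univ : Finset E)).filter
            fun p => wedge (F := F) p.1 p.2 = x).card := by
          rw [← smul_eq_mul]; exact Finset.card_nsmul_le_sum _ _ _ hfib
      _ ≤ ((Finset.univ.filter fun u => u ∈ S) ×ˢ (Finset.univ : Finset E)).card :=
          (Finset.sum_card_fiberwise_eq_card_filter _ _ _).trans_le (Finset.card_filter_le _ _)
      _ = _ := by
          rw [Finset.card_product, hS, Finset.card_univ,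
            Module.card_eq_pow_finrank (K := F) (V := E), pow_add]
  calc _ ≤ ((decomposables F E).filter fun x => x ∈ wedgeSubspace S).card *
        (2 * ((q - 1) * q)) := by
        gcongr
        rw [pow_two, ← mul_assoc]
        gcongr
        omega
    _ = 2 * (((decomposables F E).filter fun x => x ∈ wedgeSubspace S).card *
        ((q - 1) * q)) := by ring
    _ ≤ _ := by gcongr

end WedgeSubspace

section Pairs

variable {F E ι : Type*} [Field F] [AddCommGroup E] [Module F E]

local notation "d" => Module.finrank F E

/-- The linear map `v ↦ ∑ i ∈ J, v i ∧ w i`. -/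
def sumWedge (J : Finset ι) (w : ι → E) : (ι → E) →ₗ[F] ⋀[F]^2 E :=
  ∑ i ∈ J, (wedge (F := F)).flip (w i) ∘ₗ LinearMap.proj i

lemma sumWedge_apply (J : Finset ι) (w v : ι → E) :
    sumWedge (F := F) J w v = ∑ i ∈ J, wedge (v i) (w i) := by
  simp [sumWedge]

lemma range_sumWedge (J : Finset ι) (w : ι → E) :
    LinearMap.range (sumWedge (F := F) J w) = wedgeSubspace (Submodule.span F (w '' J)) := by
  classical
  apply le_antisymm
  · rintro _ ⟨v, rfl⟩
    rw [sumWedge_apply]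
    exact Submodule.sum_mem _ fun i hi => Submodule.apply_mem_map₂ _ trivial
      (Submodule.subset_span ⟨i, hi, rfl⟩)
  · rw [Submodule.map₂_le]
    intro v _ u hu
    suffices h : Submodule.span F (w '' J) ≤
        (LinearMap.range (sumWedge (F := F) J w)).comap (wedge (F := F) v) from h hu
    rw [Submodule.span_le]
    rintro _ ⟨i, hi, rfl⟩
    refine ⟨Pi.single i v, ?_⟩
    rw [sumWedge_apply, Finset.sum_eq_single i]
    · simp
    · intro j _ hj; simp [hj]
    · intro h; exact absurd hi h

variable [Fintype F] [Fintype E] [Fintype (⋀[F]^2 E)] [Fintype ι]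

local notation "q" => Fintype.card F

open scoped Classical in
lemma card_filter_sumWedge_mem_mul_le (J : Finset ι) (w : ι → E) :
    (Finset.univ.filter fun v => sumWedge (F := F) J w v ∈ decomposables F E).card *
      q ^ (Nat.choose d 2) ≤
    ((decomposables F E).filter fun x => x ∈ wedgeSubspace (Submodule.span F (w '' J))).card *
      q ^ (d * Fintype.card ι + (d - finrank F (Submodule.span F (w '' J))).choose 2) := by
  have hq : 0 < q := Fintype.card_pos
  have h := card_filter_map_mem_mul_le (sumWedge (F := F) J w) (decomposables F E)
  rw [range_sumWedge, Module.finrank_pi_fintype, Finset.sum_const, Finset.card_univ,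
    smul_eq_mul, mul_comm (Fintype.card ι)] at h
  calc _ ≤ (Finset.univ.filter fun v => sumWedge (F := F) J w v ∈ decomposables F E).card *
        q ^ (finrank F (wedgeSubspace (Submodule.span F (w '' J))) +
          (d - finrank F (Submodule.span F (w '' J))).choose 2) := by
        gcongr
        exact choose_finrank_le _
    _ ≤ _ := by
        rw [pow_add, pow_add, ← mul_assoc, ← mul_assoc]
        refine Nat.mul_le_mul_right _ ?_
        convert h

end Pairs

section Sums

variable {F E ι : Type*} [Field F] [AddCommGroup E] [Module F E]
  [Fintype F] [Fintype E] [Fintype (⋀[F]^2 E)] [Fintype ι]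

local notation "q" => Fintype.card F
local notation "d" => Module.finrank F E
local notation "n" => Fintype.card ι

variable (F E) in
open scoped Classical in
/-- The number of tuples of nonzero decomposables whose partial sum over `J` is again a nonzero
decomposable. -/
def numSum (J : Finset ι) : ℕ :=
  ((Fintype.piFinset fun _ : ι => decomposables F E).filter
    fun ω => ∑ i ∈ J, ω i ∈ decomposables F E).card

lemma numSum_le (J : Finset ι) : numSum F E J ≤ (decomposables F E).card ^ n := by
  classical
  refine (Finset.card_filter_le _ _).trans ?_
  rw [Fintype.card_piFinset, Finset.prod_const, Finset.card_univ]

lemma numSum_empty : numSum F E (∅ : Finset ι) = 0 := by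
  classical
  simp [numSum, mem_decomposables]

open scoped Classical in
lemma numSum_mul_le (J : Finset ι) :
    numSum F E J * (q * (q ^ 2 - 1)) ^ n ≤
      ∑ w : ι → E, (Finset.univ.filter
        fun v => sumWedge (F := F) J w v ∈ decomposables F E).card := by
  set A := (Fintype.piFinset fun _ : ι => decomposables F E).filter
    fun ω => ∑ i ∈ J, ω i ∈ decomposables F E
  set P := (Finset.univ : Finset (ι → E × E)).filter
    fun p => ∑ i ∈ J, wedge (F := F) (p i).1 (p i).2 ∈ decomposables F E
  have h1 (ω) (hω : ω ∈ A) : (q * (q ^ 2 - 1)) ^ n ≤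
      (P.filter fun p => (fun i => wedge (F := F) (p i).1 (p i).2) = ω).card := by
    obtain ⟨hX, hs⟩ := Finset.mem_filter.1 hω
    rw [Fintype.mem_piFinset] at hX
    rw [show (q * (q ^ 2 - 1)) ^ n = ∏ _i : ι, q * (q ^ 2 - 1) by simp]
    rw [Finset.prod_congr rfl fun i _ => (card_fiber_wedge (hX i)).symm, ← Fintype.card_piFinset]
    refine Finset.card_le_card fun p hp => ?_
    simp only [Fintype.mem_piFinset, Finset.mem_filter, Finset.mem_univ, true_and] at hp
    simp only [P, Finset.mem_filter, Finset.mem_univ, true_and, hp]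
    exact ⟨hs, trivial⟩
  calc _ = A.card * (q * (q ^ 2 - 1)) ^ n := rfl
    _ ≤ ∑ ω ∈ A, (P.filter fun p => (fun i => wedge (F := F) (p i).1 (p i).2) = ω).card := by
        rw [← smul_eq_mul]; exact Finset.card_nsmul_le_sum _ _ _ h1
    _ ≤ P.card :=
        (Finset.sum_card_fiberwise_eq_card_filter _ _ _).trans_le (Finset.card_filter_le _ _)
    _ = (Finset.univ.filter fun p : (ι → E) × (ι → E) =>
          sumWedge (F := F) J p.1 p.2 ∈ decomposables F E).card := by
        refine Finset.card_equiv
          ((Equiv.arrowProdEquivProdArrow ι (fun _ => E) (fun _ => E)).trans (Equiv.prodComm _ _))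
          fun p => ?_
        simp [P, sumWedge_apply, Equiv.arrowProdEquivProdArrow]
    _ = _ := by
        rw [Finset.card_filter, Fintype.sum_prod_type]
        simp_rw [← Finset.card_filter]

open scoped Classical in
lemma card_tuples_mem_subspace (J : Finset ι) (S : Submodule F E) :
    (Finset.univ.filter fun w : ι → E => ∀ i ∈ J, w i ∈ S).card =
      q ^ (finrank F S * J.card + d * (n - J.card)) := by
  have hS : (Finset.univ.filter fun u => u ∈ S).card = q ^ finrank F S := by
    rw [← Module.card_eq_pow_finrank (K := F) (V := S), Fintype.card_subtype]
  have h : (Finset.univ.filter fun w : ι → E => ∀ i ∈ J, w i ∈ S) =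
      Fintype.piFinset fun i => if i ∈ J then Finset.univ.filter fun u => u ∈ S
        else Finset.univ := by
    ext w
    simp only [Finset.mem_filter, Finset.mem_univ, true_and, Fintype.mem_piFinset]
    refine forall_congr' fun i => ?_
    split_ifs with hi <;> simp [hi]
  rw [h, Fintype.card_piFinset]
  simp_rw [apply_ite Finset.card, hS, Finset.card_univ,
    Module.card_eq_pow_finrank (K := F) (V := E)]
  rw [Finset.prod_ite, Finset.prod_const, Finset.prod_const, ← pow_mul, ← pow_mul, ← pow_add]
  congr 3
  · simp
  · rw [Finset.filter_not, Finset.card_sdiff_of_subset (Finset.filter_subset _ _)]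
    simp

open scoped Classical in
lemma sum_card_sumWedge_mul_le (J : Finset ι) :
    (∑ w : ι → E, (Finset.univ.filter
        fun v => sumWedge (F := F) J w v ∈ decomposables F E).card) *
        q ^ (Nat.choose d 2) * q ^ 2 ≤
      q ^ (d * n) * (q ^ (d * n) * (decomposables F E).card * q ^ 2) +
      ∑ s ∈ (Finset.range (d - 1)).filter fun s => s ≤ J.card,
        Nat.card {S : Submodule F E // finrank F S = s} *
          (q ^ (s * J.card + d * (n - J.card)) *
            (2 * q ^ (s + d) * q ^ (d * n + Nat.choose (d - s) 2))) := by
  set c : ℕ → ℕ := fun s => 2 * q ^ (s + d) * q ^ (d * n + Nat.choose (d - s) 2)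
  set R := (Finset.range (d - 1)).filter fun s => s ≤ J.card
  have key (w : ι → E) : (Finset.univ.filter
      fun v => sumWedge (F := F) J w v ∈ decomposables F E).card * q ^ (Nat.choose d 2) * q ^ 2 ≤
      q ^ (d * n) * (decomposables F E).card * q ^ 2 +
        ∑ s ∈ R, ∑ S ∈ (Finset.univ : Finset (Submodule F E)).filter
            fun S : Submodule F E => finrank F S = s,
          if ∀ i ∈ J, w i ∈ S then c s else 0 := by
    have h := card_filter_sumWedge_mem_mul_le (F := F) J w
    set S := Submodule.span F (w '' J) with hS
    by_cases hs : d - 1 ≤ finrank F S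
    · refine le_trans ?_ (Nat.le_add_right _ _)
      rw [Nat.choose_eq_zero_of_lt (show d - finrank F S < 2 by omega), add_zero] at h
      refine Nat.mul_le_mul_right _ (h.trans ?_)
      rw [mul_comm]
      exact Nat.mul_le_mul_left _ (Finset.card_le_card (Finset.filter_subset _ _))
    · refine le_trans ?_ (Nat.le_add_left _ _)
      have hsJ : finrank F S ≤ J.card := by
        have := finrank_span_finset_le_card (R := F) (J.image w)
        rw [Finset.coe_image] at this
        exact this.trans Finset.card_image_le
      have hR : finrank F S ∈ R := by
        simp only [R, Finset.mem_filter, Finset.mem_range]; omega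
      refine le_trans ?_ (Finset.single_le_sum (f := fun s =>
        ∑ S ∈ (Finset.univ : Finset (Submodule F E)).filter
            fun S : Submodule F E => finrank F S = s,
          if ∀ i ∈ J, w i ∈ S then c s else 0) (fun _ _ => Nat.zero_le _) hR)
      refine le_trans ?_ (Finset.single_le_sum (f := fun S' : Submodule F E =>
          if ∀ i ∈ J, w i ∈ S' then c (finrank F S) else 0) (fun _ _ => Nat.zero_le _)
          (show S ∈ Finset.univ.filter fun S' : Submodule F E => finrank F S' = finrank F S by
            simp))
      rw [if_pos (show ∀ i ∈ J, w i ∈ S from fun i hi => Submodule.subset_span ⟨i, hi, rfl⟩)]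
      calc _ ≤ _ * q ^ 2 := Nat.mul_le_mul_right _ h
        _ = (((decomposables F E).filter fun x => x ∈ wedgeSubspace S).card * q ^ 2) *
            q ^ (d * n + Nat.choose (d - finrank F S) 2) := by ring
        _ ≤ _ := Nat.mul_le_mul_right _ (card_decomposables_wedgeSubspace_le S)
  rw [Finset.sum_mul, Finset.sum_mul]
  refine (Finset.sum_le_sum fun w _ => key w).trans ?_
  rw [Finset.sum_add_distrib]
  refine Nat.add_le_add ?_ ?_
  · rw [Finset.sum_const, Finset.card_univ, Fintype.card_fun,
      Module.card_eq_pow_finrank (K := F) (V := E), smul_eq_mul, ← pow_mul]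
  · rw [Finset.sum_comm]
    refine Finset.sum_le_sum fun s _ => ?_
    rw [Finset.sum_comm, Nat.card_eq_fintype_card, Fintype.card_subtype, ← smul_eq_mul]
    refine Finset.sum_le_card_nsmul _ _ _ fun S hS => ?_
    obtain rfl : finrank F S = s := by simpa using hS
    rw [← Finset.sum_filter, Finset.sum_const, card_tuples_mem_subspace, smul_eq_mul]

lemma exponent_le {D s j m t : ℕ} (hs : s + 2 ≤ D) (hsj : s ≤ j) (hj : 2 ≤ j) (hjm : j ≤ m)
    (ht : t ≤ 1) (htD : t + 4 ≤ D) :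
    D * s + (s * j + D * (m - j)) + (s + D) + (D * m + Nat.choose (D - s) 2) + (j - 1 + t) ≤
      2 * (D * m) + Nat.choose D 2 + 2 + s * s := by
  obtain ⟨e, rfl⟩ := Nat.exists_eq_add_of_le hs
  obtain ⟨k, rfl⟩ := Nat.exists_eq_add_of_le hjm
  have h1 := Nat.triangle_succ (s + 1 + e)
  have h2 := Nat.triangle_succ (1 + e)
  have hc (a : ℕ) : (a + 1).choose 2 * 2 = (a + 1) * a := by
    rw [Nat.choose_two_right, Nat.add_sub_cancel, Nat.div_mul_cancel]
    simpa [mul_comm] using (Nat.even_mul_succ_self a).two_dvd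
  have h1 := hc (s + 1 + e)
  have h2 := hc (1 + e)
  rw [show s + 2 + e - s = 1 + e + 1 by omega, show j + k - j = k by omega]
  rw [show s + 1 + e + 1 = s + 2 + e by ring] at h1
  set A := (s + 2 + e).choose 2
  set B := (1 + e + 1).choose 2
  obtain ⟨i, rfl⟩ := Nat.exists_eq_add_of_le hj
  rw [show 2 + i - 1 = 1 + i by omega]
  have key : 2 * s * (2 + i) + 3 * s + 2 * (s + 2 + e) + 2 * (2 + i) + 2 * t ≤
      2 * (s + 2 + e) * (2 + i) + s * s + 6 := by
    rcases s with _ | _ | s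
    · nlinarith
    · nlinarith
    · obtain ⟨l, rfl⟩ : ∃ l, i = s + l := ⟨i - s, by omega⟩
      have : t * 2 ≤ (s + 1) * (2 * e + s) := by
        interval_cases t
        · simp
        · nlinarith [Nat.zero_le (s * e)]
      nlinarith [Nat.zero_le (s * e), Nat.zero_le (l * e)]
  nlinarith

lemma numSum_mul_pow_le {t : ℕ} (ht : t ≤ 1) (htd : t + 4 ≤ d) (J : Finset ι) (hJ : 2 ≤ J.card) :
    numSum F E J * (q * (q ^ 2 - 1)) ^ n * q ^ (Nat.choose d 2) * q ^ (J.card - 1 + t) ≤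
      q ^ (2 * (d * n)) *
        ((decomposables F E).card * q ^ (J.card - 1 + t) + 2 ^ d * q ^ (Nat.choose d 2)) := by
  classical
  have hq : 0 < q := Fintype.card_pos
  have h := (Nat.mul_le_mul_right _ (Nat.mul_le_mul_right _
    (numSum_mul_le (F := F) (E := E) J))).trans
    (sum_card_sumWedge_mul_le (F := F) (E := E) J)
  refine Nat.le_of_mul_le_mul_right ?_ (pow_pos hq 2)
  have hterm (s) (hs : s ∈ (Finset.range (d - 1)).filter fun s => s ≤ J.card) :
      Nat.card {S : Submodule F E // finrank F S = s} *
          (q ^ (s * J.card + d * (n - J.card)) *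
            (2 * q ^ (s + d) * q ^ (d * n + Nat.choose (d - s) 2))) * q ^ (J.card - 1 + t) ≤
        2 ^ (s + 1) * (q ^ (2 * (d * n)) * q ^ (Nat.choose d 2) * q ^ 2) := by
    simp only [Finset.mem_filter, Finset.mem_range] at hs
    refine Nat.le_of_mul_le_mul_right ?_ (pow_pos hq (s * s))
    calc _ = 2 * (Nat.card {S : Submodule F E // finrank F S = s} * q ^ (s * s)) *
          q ^ ((s * J.card + d * (n - J.card)) + (s + d) + (d * n + Nat.choose (d - s) 2) +
            (J.card - 1 + t)) := by
          rw [pow_add _ _ (J.card - 1 + t), pow_add _ _ (d * n + Nat.choose (d - s) 2),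
            pow_add _ _ (s + d)]
          ring
      _ ≤ 2 * (2 ^ s * q ^ (d * s)) *
          q ^ ((s * J.card + d * (n - J.card)) + (s + d) + (d * n + Nat.choose (d - s) 2) +
            (J.card - 1 + t)) := by
          exact Nat.mul_le_mul_right _
            (Nat.mul_le_mul_left 2 (card_submodule_finrank_mul_pow_le F E s))
      _ = 2 ^ (s + 1) * q ^ (d * s + (s * J.card + d * (n - J.card)) + (s + d) +
            (d * n + Nat.choose (d - s) 2) + (J.card - 1 + t)) := by
          ring
      _ ≤ 2 ^ (s + 1) * q ^ (2 * (d * n) + Nat.choose d 2 + 2 + s * s) := by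
          exact Nat.mul_le_mul_left _ (Nat.pow_le_pow_right hq
            (exponent_le (by omega) hs.2 hJ (Finset.card_le_univ J) ht htd))
      _ = _ := by rw [pow_add, pow_add, pow_add]; ring
  have hsum : ∑ s ∈ (Finset.range (d - 1)).filter (fun s => s ≤ J.card), 2 ^ (s + 1) ≤ 2 ^ d := by
    calc _ ≤ ∑ s ∈ Finset.range (d - 1), 2 ^ (s + 1) :=
          Finset.sum_le_sum_of_subset (Finset.filter_subset _ _)
      _ = 2 * ∑ s ∈ Finset.range (d - 1), 2 ^ s := by
          rw [Finset.mul_sum]; simp_rw [pow_succ']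
      _ ≤ 2 * 2 ^ (d - 1) := by
          exact Nat.mul_le_mul_left 2 (Nat.geomSum_lt le_rfl (by simp)).le
      _ = 2 ^ d := by rw [← pow_succ']; congr 1; omega
  calc _ = numSum F E J * (q * (q ^ 2 - 1)) ^ n * q ^ (Nat.choose d 2) * q ^ 2 *
        q ^ (J.card - 1 + t) := by ring
    _ ≤ _ := Nat.mul_le_mul_right _ h
    _ ≤ q ^ (d * n) * (q ^ (d * n) * (decomposables F E).card * q ^ 2) * q ^ (J.card - 1 + t) +
        ∑ s ∈ (Finset.range (d - 1)).filter (fun s => s ≤ J.card),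
          2 ^ (s + 1) * (q ^ (2 * (d * n)) * q ^ (Nat.choose d 2) * q ^ 2) := by
        rw [add_mul, Finset.sum_mul]
        exact Nat.add_le_add_left (Finset.sum_le_sum hterm) _
    _ ≤ q ^ (d * n) * (q ^ (d * n) * (decomposables F E).card * q ^ 2) * q ^ (J.card - 1 + t) +
          2 ^ d * (q ^ (2 * (d * n)) * q ^ (Nat.choose d 2) * q ^ 2) := by
        rw [← Finset.sum_mul]
        gcongr
    _ = _ := by rw [two_mul (d * n), pow_add]; ring

open scoped Classical in
lemma sum_card_comb_le :
    ∑ ω ∈ Fintype.piFinset fun _ : ι => decomposables F E,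
      (Finset.univ.filter fun c : ι → F => ∑ i, c i • ω i ∈ decomposables F E).card ≤
    ∑ J : Finset ι, (q - 1) ^ J.card * numSum F E J := by
  set X := Fintype.piFinset fun _ : ι => decomposables F E
  let supp : (ι → F) → Finset ι := fun c => Finset.univ.filter fun i => c i ≠ 0
  have h1 (c : ι → F) : (X.filter fun ω => ∑ i, c i • ω i ∈ decomposables F E).card ≤
      numSum F E (supp c) := by
    refine Finset.card_le_card_of_injOn (fun ω i => if c i = 0 then ω i else c i • ω i) ?_ ?_
    · intro ω hω
      simp only [Finset.coe_filter, X, Fintype.mem_piFinset, Set.mem_ofPred_eq] at hω ⊢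
      refine ⟨fun i => ?_, ?_⟩
      · split_ifs with hc
        · exact hω.1 i
        · exact smul_mem_decomposables hc (hω.1 i)
      · convert hω.2 using 1
        rw [Finset.sum_filter]
        refine Finset.sum_congr rfl fun i _ => ?_
        split_ifs <;> simp_all
    · intro ω _ ω' _ h
      funext i
      have := congrFun h i
      simp only at this
      split_ifs at this with hc
      · exact this
      · exact smul_right_injective _ hc this
  have h2 (J : Finset ι) : (Finset.univ.filter fun c : ι → F => supp c = J).card =
      (q - 1) ^ J.card := by
    have : (Finset.univ.filter fun c : ι → F => supp c = J) =
        Fintype.piFinset fun i => if i ∈ J then Finset.univ.erase (0 : F) else {0} := by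
      ext c
      simp only [Finset.mem_filter, Finset.mem_univ, true_and, Fintype.mem_piFinset,
        Finset.ext_iff, supp]
      refine forall_congr' fun i => ?_
      split_ifs with hi <;> simp [hi]
    rw [this, Fintype.card_piFinset]
    simp_rw [apply_ite Finset.card, Finset.card_erase_of_mem (Finset.mem_univ _),
      Finset.card_singleton, Finset.card_univ]
    simp
  calc _ = ∑ c : ι → F, (X.filter fun ω => ∑ i, c i • ω i ∈ decomposables F E).card := by
        simp_rw [Finset.card_filter]
        exact Finset.sum_comm
    _ ≤ ∑ c : ι → F, numSum F E (supp c) := Finset.sum_le_sum fun c _ => h1 c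
    _ = ∑ J : Finset ι, ∑ c ∈ Finset.univ.filter fun c : ι → F => supp c = J,
          numSum F E (supp c) := (Finset.sum_fiberwise _ _ _).symm
    _ = _ := by
        refine Finset.sum_congr rfl fun J _ => ?_
        rw [← h2 J, ← smul_eq_mul, ← Finset.sum_const]
        refine Finset.sum_congr rfl fun c hc => ?_
        rw [(Finset.mem_filter.1 hc).2]

open scoped Classical in
lemma sum_card_span_le (G : Finset (ι → ⋀[F]^2 E))
    (hG : G ⊆ Fintype.piFinset fun _ : ι => decomposables F E) :
    ∑ ω ∈ G, ((decomposables F E).filter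
      fun x => x ∈ Submodule.span F (Set.range ω)).card ≤
    ∑ J : Finset ι, (q - 1) ^ J.card * numSum F E J := by
  have key (ω : ι → ⋀[F]^2 E) : ((decomposables F E).filter
      fun x => x ∈ Submodule.span F (Set.range ω)).card ≤
      (Finset.univ.filter fun c : ι → F => ∑ i, c i • ω i ∈ decomposables F E).card := by
    refine (Finset.card_le_card fun x hx => ?_).trans
      (Finset.card_image_le (f := fun c : ι → F => ∑ i, c i • ω i))
    obtain ⟨hx, hs⟩ := Finset.mem_filter.1 hx
    obtain ⟨c, rfl⟩ := (Submodule.mem_span_range_iff_exists_fun F).1 hs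
    exact Finset.mem_image.2 ⟨c, by simpa using hx, rfl⟩
  calc _ ≤ ∑ ω ∈ G, (Finset.univ.filter
          fun c : ι → F => ∑ i, c i • ω i ∈ decomposables F E).card :=
        Finset.sum_le_sum fun ω _ => key ω
    _ ≤ ∑ ω ∈ Fintype.piFinset fun _ : ι => decomposables F E, (Finset.univ.filter
          fun c : ι → F => ∑ i, c i • ω i ∈ decomposables F E).card :=
        Finset.sum_le_sum_of_subset hG
    _ ≤ _ := sum_card_comb_le

end Sums

lemma card_pow_le_mul_sum_pow {α : Type*} (G : Finset α) (f : α → ℝ) (hf : ∀ a ∈ G, 0 < f a)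
    (r : ℕ) {c : ℝ} (hc : ∑ a ∈ G, (f a ^ r)⁻¹ ≤ c) :
    (G.card : ℝ) ^ (r + 1) ≤ c * (∑ a ∈ G, f a) ^ r := by
  rcases G.eq_empty_or_nonempty with rfl | hne
  · simp at hc ⊢
    positivity
  have hg : (0 : ℝ) < G.card := by exact_mod_cast hne.card_pos
  have hS : 0 < ∑ a ∈ G, f a := Finset.sum_pos hf hne
  have hJ := Real.zpow_arith_mean_le_arith_mean_zpow G (fun _ => (G.card : ℝ)⁻¹) f
    (fun _ _ => by positivity) (by simp [hg.ne']) hf (-r)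
  simp only [← Finset.mul_sum, zpow_neg, zpow_natCast, mul_pow, mul_inv, inv_pow, inv_inv] at hJ
  have h2 := hJ.trans (mul_le_mul_of_nonneg_left hc (by positivity))
  have h3 := mul_le_mul_of_nonneg_left h2
    (show 0 ≤ (G.card : ℝ) * (∑ a ∈ G, f a) ^ r by positivity)
  calc _ = (G.card : ℝ) * (∑ a ∈ G, f a) ^ r *
        ((G.card : ℝ) ^ r * ((∑ a ∈ G, f a) ^ r)⁻¹) := by field_simp; ring
    _ ≤ _ := h3
    _ = _ := by field_simp

section Tuples

variable {F U : Type*} [Field F] [AddCommGroup U] [Module F U]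

open scoped Classical in
/-- If no hyperplane contains more than `h` elements of `X`, then most tuples in `X` are linearly
independent. -/
lemma pow_le_card_linearIndependent [FiniteDimensional F U] (X : Finset U) (h : ℕ)
    (hX : ∀ l : Dual F U, l ≠ 0 → (X.filter fun x => l x = 0).card ≤ h) (r : ℕ)
    (hr : r ≤ finrank F U) :
    (X.card - h) ^ r ≤ ((Fintype.piFinset fun _ : Fin r => X).filter
      fun ω => LinearIndependent F ω).card := by
  induction r with
  | zero => simp
  | succ r ih =>
    set S := (Fintype.piFinset fun _ : Fin r => X).filter fun ω => LinearIndependent F ω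
    have key (ω) (_ : ω ∈ S) : X.card - h ≤
        (X.filter fun x => x ∉ Submodule.span F (Set.range ω)).card := by
      have hlt : Submodule.span F (Set.range ω) < ⊤ := by
        refine lt_top_iff_ne_top.2 fun htop => ?_
        have := finrank_range_le_card (R := F) ω
        rw [Set.finrank, htop, finrank_top, Fintype.card_fin] at this
        omega
      obtain ⟨l, hl, hle⟩ := Submodule.exists_le_ker_of_lt_top _ hlt
      have h1 := hX l hl
      have h2 := Finset.card_filter_add_card_filter_not (s := X) (fun x => l x = 0)
      have h3 : (X.filter fun x => ¬ l x = 0).card ≤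
          (X.filter fun x => x ∉ Submodule.span F (Set.range ω)).card :=
        Finset.card_le_card (Finset.monotone_filter_right _ fun x _ hx hm => hx (hle hm))
      omega
    calc (X.card - h) ^ (r + 1) = (X.card - h) ^ r * (X.card - h) := pow_succ _ _
      _ ≤ S.card * (X.card - h) := Nat.mul_le_mul_right _ (ih (by omega))
      _ ≤ ∑ ω ∈ S, (X.filter fun x => x ∉ Submodule.span F (Set.range ω)).card := by
          rw [← smul_eq_mul]; exact Finset.card_nsmul_le_sum _ _ _ key
      _ = (S.sigma fun ω => X.filter fun x => x ∉ Submodule.span F (Set.range ω)).card :=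
          (Finset.card_sigma _ _).symm
      _ ≤ _ := by
          refine Finset.card_le_card_of_injOn (fun a => (Fin.cons a.2 a.1 : Fin (r + 1) → U)) ?_ ?_
          · rintro ⟨ω, x⟩ ha
            simp only [Finset.coe_sigma, Set.mem_sigma_iff, Finset.mem_coe, Finset.mem_filter, S,
              Fintype.mem_piFinset] at ha
            simp only [Finset.coe_filter, Set.mem_ofPred_eq, Fintype.mem_piFinset,
              linearIndependent_finCons]
            exact ⟨Fin.cases ha.2.1 ha.1.1, ha.1.2, ha.2.2⟩
          · rintro ⟨ω, x⟩ _ ⟨ω', x'⟩ _ hab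
            obtain ⟨rfl, rfl⟩ := Fin.cons_injective2 hab
            rfl

open scoped Classical in
/-- A lower bound for the number of subspaces spanned by subsets of `X`, through Jensen's
inequality. -/
lemma card_pow_le_card_spanned_mul [Finite U] {r : ℕ} (hr : r ≠ 0) (X : Finset U)
    (G : Finset (Fin r → U)) (hG : G ⊆ Fintype.piFinset fun _ => X)
    (hli : ∀ ω ∈ G, LinearIndependent F ω) :
    (G.card : ℝ) ^ (r + 1) ≤
      Nat.card {L : Submodule F U // finrank F L = r ∧ L = Submodule.span F (L ∩ X)} *
        (∑ ω ∈ G, (X.filter fun x => x ∈ Submodule.span F (Set.range ω)).card : ℝ) ^ r := by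
  have := Fintype.ofFinite U
  set M : Submodule F U → ℕ := fun L => (X.filter fun x => x ∈ L).card
  set P : Finset (Submodule F U) := Finset.univ.filter
    fun L => finrank F L = r ∧ L = Submodule.span F (L ∩ X)
  set sp : (Fin r → U) → Submodule F U := fun ω => Submodule.span F (Set.range ω)
  have hX (ω) (hω : ω ∈ G) (i) : ω i ∈ X := Fintype.mem_piFinset.1 (hG hω) i
  have hsp (ω) (hω : ω ∈ G) : sp ω ∈ P := by
    simp only [P, Finset.mem_filter, Finset.mem_univ, true_and, sp]
    refine ⟨by simpa using finrank_span_eq_card (hli ω hω), le_antisymm ?_ ?_⟩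
    · refine Submodule.span_mono ?_
      rintro _ ⟨i, rfl⟩
      exact ⟨Submodule.subset_span ⟨i, rfl⟩, hX ω hω i⟩
    · exact Submodule.span_le.2 Set.inter_subset_left
  have hM (ω) (hω : ω ∈ G) : 0 < M (sp ω) :=
    Finset.card_pos.2 ⟨ω ⟨0, Nat.pos_of_ne_zero hr⟩,
      Finset.mem_filter.2 ⟨hX ω hω _, Submodule.subset_span ⟨_, rfl⟩⟩⟩
  have hsum : ∑ ω ∈ G, ((M (sp ω) : ℝ) ^ r)⁻¹ ≤ P.card := by
    rw [← Finset.sum_fiberwise_of_maps_to hsp]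
    calc _ ≤ ∑ _L ∈ P, (1 : ℝ) := Finset.sum_le_sum fun L _ => ?_
      _ = _ := by simp
    have h1 : (G.filter fun ω => sp ω = L).card ≤ M L ^ r := by
      calc _ ≤ (Fintype.piFinset fun _ : Fin r => X.filter fun x => x ∈ L).card := by
            refine Finset.card_le_card fun ω hω => ?_
            obtain ⟨hG, rfl⟩ := Finset.mem_filter.1 hω
            exact Fintype.mem_piFinset.2 fun i =>
              Finset.mem_filter.2 ⟨hX ω hG i, Submodule.subset_span ⟨i, rfl⟩⟩
        _ = _ := by simp [M]
    calc _ = ∑ ω ∈ G.filter fun ω => sp ω = L, ((M L : ℝ) ^ r)⁻¹ :=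
          Finset.sum_congr rfl fun ω hω => by rw [(Finset.mem_filter.1 hω).2]
      _ = (G.filter fun ω => sp ω = L).card / (M L : ℝ) ^ r := by
          rw [Finset.sum_const, nsmul_eq_mul, div_eq_mul_inv]
      _ ≤ 1 := div_le_one_of_le₀ (by exact_mod_cast h1) (by positivity)
  have hP : Nat.card {L : Submodule F U // finrank F L = r ∧ L = Submodule.span F (L ∩ X)} =
      P.card := by rw [Nat.card_eq_fintype_card, Fintype.card_subtype]
  rw [hP]
  exact card_pow_le_mul_sum_pow G _ (fun ω hω => by exact_mod_cast hM ω hω) r hsum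

end Tuples

section FourDim

variable {F E : Type*} [Field F] [AddCommGroup E] [Module F E]

lemma ι_mul_ι_eq_neg (v w : E) :
    ExteriorAlgebra.ι F v * ExteriorAlgebra.ι F w =
      -(ExteriorAlgebra.ι F w * ExteriorAlgebra.ι F v) :=
  eq_neg_of_add_eq_zero_left (ExteriorAlgebra.ι_add_mul_swap v w)

lemma wedge_mul_wedge_self (v w : E) :
    (wedge (F := F) v w : ExteriorAlgebra F E) * wedge (F := F) v w = 0 := by
  rw [coe_wedge, mul_assoc, ← mul_assoc (ExteriorAlgebra.ι F w), ι_mul_ι_eq_neg w v]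
  simp [mul_assoc]

lemma wedge_mul_wedge_comm (v w x y : E) :
    (wedge (F := F) v w : ExteriorAlgebra F E) * wedge (F := F) x y =
      wedge (F := F) x y * wedge (F := F) v w := by
  simp only [coe_wedge]
  have h (a b : E) (z : ExteriorAlgebra F E) :
      ExteriorAlgebra.ι F a * (ExteriorAlgebra.ι F b * z) =
        -(ExteriorAlgebra.ι F b * (ExteriorAlgebra.ι F a * z)) := by
    rw [← mul_assoc, ι_mul_ι_eq_neg, neg_mul, mul_assoc]
  rw [mul_assoc, mul_assoc, h w x, ι_mul_ι_eq_neg w y]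
  simp only [mul_neg, neg_neg]
  rw [h v x, h v y, mul_neg, neg_neg]

lemma exists_dual_mul_ne_zero (hd : finrank F E = 4) {v w : E} (h : wedge (F := F) v w ≠ 0) :
    ∃ l : Dual F (⋀[F]^2 E), l ≠ 0 ∧ ∀ z : ⋀[F]^2 E,
      (wedge (F := F) v w : ExteriorAlgebra F E) * z = 0 → l z = 0 := by
  have := Module.finite_of_finrank_pos (hd ▸ (by norm_num) : 0 < finrank F E)
  have hext {k : ℕ} (u : Fin k → E) (hk : k < 4) : ∃ x, x ∉ Submodule.span F (Set.range u) := by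
    by_contra! hx
    have h1 := finrank_range_le_card (R := F) u
    rw [Set.finrank, (eq_top_iff.2 fun x _ => hx x : Submodule.span F (Set.range u) = ⊤),
      finrank_top, Fintype.card_fin] at h1
    omega
  have h2 := wedge_ne_zero_iff.1 h
  obtain ⟨x, hx⟩ := hext ![v, w] (by norm_num)
  have h3 := linearIndependent_finCons.2 ⟨h2, hx⟩
  obtain ⟨y, hy⟩ := hext _ (show 3 < 4 by norm_num)
  have h4 := linearIndependent_finCons.2 ⟨h3, hy⟩
  let b := basisOfLinearIndependentOfCardEqFinrank h4 (by simp [hd])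
  let D : ExteriorAlgebra F E →ₗ[F] F := ExteriorAlgebra.liftAlternating (Pi.single 4 b.det)
  let l : Dual F (⋀[F]^2 E) := D ∘ₗ
    LinearMap.mulLeft F (wedge (F := F) v w : ExteriorAlgebra F E) ∘ₗ Submodule.subtype _
  refine ⟨l, fun hl => ?_, fun z hz => (congrArg D hz).trans (map_zero D)⟩
  have hl1 : l (wedge y x) = b.det b := by
    have h5 : (wedge (F := F) v w : ExteriorAlgebra F E) * wedge (F := F) y x =
        ExteriorAlgebra.ιMulti F 4 b := by
      rw [wedge_mul_wedge_comm]
      simp [b, ExteriorAlgebra.ιMulti_apply, mul_assoc]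
    calc l (wedge y x) =
          D ((wedge (F := F) v w : ExteriorAlgebra F E) * wedge (F := F) y x) := rfl
      _ = b.det b := by
          rw [h5, ExteriorAlgebra.liftAlternating_apply_ιMulti, Pi.single_eq_same]
  rw [hl, b.det_self] at hl1
  simp at hl1

variable [Fintype F] [Fintype E] [Fintype (⋀[F]^2 E)]

local notation "q" => Fintype.card F

open scoped Classical in
lemma card_span_pair_le (h2 : (2 : F) ≠ 0) (ω : Fin 2 → ⋀[F]^2 E)
    (hω : ∀ i, ω i ∈ decomposables F E)
    (h : (ω 0 : ExteriorAlgebra F E) * ω 1 ≠ 0) :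
    ((decomposables F E).filter fun x => x ∈ Submodule.span F (Set.range ω)).card ≤ 2 * q := by
  have hsq {x : ⋀[F]^2 E} (hx : x ∈ decomposables F E) : (x : ExteriorAlgebra F E) * x = 0 := by
    obtain ⟨-, v, w, rfl⟩ := mem_decomposables.1 hx
    exact wedge_mul_wedge_self v w
  have hcomm : (ω 1 : ExteriorAlgebra F E) * ω 0 = ω 0 * ω 1 := by
    obtain ⟨-, v, w, h0⟩ := mem_decomposables.1 (hω 0)
    obtain ⟨-, x, y, h1⟩ := mem_decomposables.1 (hω 1)
    rw [h0, h1, wedge_mul_wedge_comm]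
  have hsub : ((decomposables F E).filter fun x => x ∈ Submodule.span F (Set.range ω)) ⊆
      (Finset.univ : Finset (Fin 2 × F)).image fun p => p.2 • ω p.1 := by
    intro x hx
    obtain ⟨hx, hs⟩ := Finset.mem_filter.1 hx
    obtain ⟨c, rfl⟩ := (Submodule.mem_span_range_iff_exists_fun F).1 hs
    have h3 := hsq hx
    rw [Fin.sum_univ_two] at h3 ⊢
    have h4 : (2 * (c 0 * c 1)) • ((ω 0 : ExteriorAlgebra F E) * ω 1) = 0 := by
      rw [← h3]
      simp only [Submodule.coe_add, Submodule.coe_smul, mul_add, add_mul, smul_mul_smul_comm,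
        hsq (hω 0), hsq (hω 1), hcomm]
      module
    have h5 : c 0 = 0 ∨ c 1 = 0 := by
      simpa [h2, h] using h4
    rcases h5 with h5 | h5
    · exact Finset.mem_image.2 ⟨(1, c 1), Finset.mem_univ _, by simp [h5]⟩
    · exact Finset.mem_image.2 ⟨(0, c 0), Finset.mem_univ _, by simp [h5]⟩
  simpa using (Finset.card_le_card hsub).trans Finset.card_image_le

lemma linearIndependent_of_mul_ne_zero (ω : Fin 2 → ⋀[F]^2 E)
    (hω : ∀ i, ω i ∈ decomposables F E)
    (h : (ω 0 : ExteriorAlgebra F E) * ω 1 ≠ 0) : LinearIndependent F ω := by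
  obtain ⟨h0, v, w, hvw⟩ := mem_decomposables.1 (hω 0)
  have h2 := (LinearIndependent.pair_iff' (K := F) (y := ω 1) h0).2 fun c hc => h <| by
    rw [← hc, hvw, Submodule.coe_smul, mul_smul_comm, wedge_mul_wedge_self, smul_zero]
  rwa [show ![ω 0, ω 1] = ω by ext i; fin_cases i <;> rfl] at h2

open scoped Classical in
lemma le_card_mul_ne_zero (hd : finrank F E = 4) (h : ℕ)
    (hX : ∀ l : Dual F (⋀[F]^2 E), l ≠ 0 →
      ((decomposables F E).filter fun x => l x = 0).card ≤ h) :
    (decomposables F E).card * ((decomposables F E).card - h) ≤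
      ((Fintype.piFinset fun _ : Fin 2 => decomposables F E).filter
        fun ω => (ω 0 : ExteriorAlgebra F E) * ω 1 ≠ 0).card := by
  have key (a) (ha : a ∈ decomposables F E) : (decomposables F E).card - h ≤
      ((decomposables F E).filter fun z : ⋀[F]^2 E => (a : ExteriorAlgebra F E) * z ≠ 0).card := by
    obtain ⟨h0, v, w, rfl⟩ := mem_decomposables.1 ha
    obtain ⟨l, hl, hle⟩ := exists_dual_mul_ne_zero hd h0
    have h1 := hX l hl
    have h2 := Finset.card_filter_add_card_filter_not (s := decomposables F E) (fun x => l x = 0)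
    have h3 : ((decomposables F E).filter fun x => ¬ l x = 0).card ≤ ((decomposables F E).filter
        fun z : ⋀[F]^2 E => (wedge (F := F) v w : ExteriorAlgebra F E) * z ≠ 0).card :=
      Finset.card_le_card (Finset.monotone_filter_right _ fun x _ hx hm => hx (hle x hm))
    omega
  calc _ ≤ ∑ a ∈ decomposables F E,
        ((decomposables F E).filter
          fun z : ⋀[F]^2 E => (a : ExteriorAlgebra F E) * z ≠ 0).card := by
        rw [← smul_eq_mul]; exact Finset.card_nsmul_le_sum _ _ _ key
    _ = _ := (Finset.card_sigma _ _).symm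
    _ ≤ _ := by
        refine Finset.card_le_card_of_injOn (fun a => ![a.1, a.2]) ?_ ?_
        · rintro ⟨a, z⟩ haz
          simpa [Fin.forall_fin_two, and_assoc] using haz
        · rintro ⟨a, z⟩ _ ⟨a', z'⟩ _ h
          have h0 := congrFun h 0
          have h1 := congrFun h 1
          simp at h0 h1
          rw [h0, h1]

end FourDim

section Estimates

/-- The number of pairs of linearly independent vectors in dimension `e` over a field with `z⁻¹`
elements, divided by `z ^ (-2 * e)`. -/
def pairDensity (e : ℕ) (z : ℝ) : ℝ := (1 - z ^ e) * (1 - z ^ (e - 1))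

/-- The number of nonzero decomposables in dimension `e` over a field with `z⁻¹` elements, divided
by `z ^ (-(2 * e - 3))`. -/
def decompDensity (e : ℕ) (z : ℝ) : ℝ := pairDensity e z / (1 - z ^ 2)

/-- A lower bound for the proportion of the decomposables outside a given hyperplane. -/
def avoidDensity (e : ℕ) (z : ℝ) : ℝ := 1 - 2 * z / pairDensity e z

/-- The number of linearly independent `r`-tuples in a space of dimension `r` over a field with
`z⁻¹` elements, divided by `z ^ (-(r * r))`. -/
def frameDensity (r : ℕ) (z : ℝ) : ℝ := ∏ i : Fin r, (1 - z ^ (r - i : ℕ))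

/-- An upper bound for the normalised average number of decomposables in the span of `r`
decomposables. -/
def spanDensity (e r k t : ℕ) (z : ℝ) : ℝ :=
  r * z ^ k + ∑ J : Finset (Fin r), if 2 ≤ J.card then
    (decompDensity e z * z ^ (r - J.card) + 2 ^ e * z ^ (t + k)) / pairDensity e z ^ r else 0

variable {F E : Type*} [Field F] [AddCommGroup E] [Module F E]
  [Fintype F] [Fintype E] [Fintype (⋀[F]^2 E)]

local notation "q" => Fintype.card F
local notation "d" => Module.finrank F E

variable (F) in
lemma one_lt_cast_card : (1 : ℝ) < q := by exact_mod_cast Fintype.one_lt_card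

lemma pairDensity_pos {e : ℕ} (he : 2 ≤ e) {z : ℝ} (h0 : 0 ≤ z) (h1 : z < 1) :
    0 < pairDensity e z :=
  mul_pos (sub_pos.2 (pow_lt_one₀ h0 h1 (by omega))) (sub_pos.2 (pow_lt_one₀ h0 h1 (by omega)))

lemma card_decomposables_mul_eq (hd : 2 ≤ d) :
    ((decomposables F E).card : ℝ) * (q * (q ^ 2 - 1)) =
      q ^ (2 * d) * pairDensity d (q : ℝ)⁻¹ := by
  have hq := one_lt_cast_card F
  have h := congrArg (Nat.cast : ℕ → ℝ) (card_decomposables (F := F) (E := E) hd)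
  have h1 : 1 ≤ q := Fintype.card_pos
  rw [Nat.cast_mul, Nat.cast_mul, Nat.cast_mul, Nat.cast_sub (Nat.one_le_pow _ _ h1),
    Nat.cast_sub (Nat.one_le_pow _ _ h1), Nat.cast_sub (Nat.le_self_pow (by omega) _)] at h
  push_cast at h
  rw [h, pairDensity]
  have h2 : (q : ℝ) ^ d * (q : ℝ)⁻¹ ^ d = 1 := by
    rw [← mul_pow, mul_inv_cancel₀ (by positivity), one_pow]
  have h3 : (q : ℝ) ^ d * (q : ℝ)⁻¹ ^ (d - 1) = q := by
    rw [inv_pow, ← pow_sub₀ _ (by positivity) (Nat.sub_le _ _), Nat.sub_sub_self (by omega),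
      pow_one]
  calc _ = ((q : ℝ) ^ d - q ^ d * (q : ℝ)⁻¹ ^ d) * (q ^ d - q ^ d * (q : ℝ)⁻¹ ^ (d - 1)) := by
        rw [h2, h3]
    _ = _ := by ring

lemma card_decomposables_eq (hd : 2 ≤ d) :
    ((decomposables F E).card : ℝ) = q ^ (2 * d - 3) * decompDensity d (q : ℝ)⁻¹ := by
  have hq := one_lt_cast_card F
  have h := card_decomposables_mul_eq (F := F) (E := E) hd
  have h2 : (q : ℝ) ^ 2 - 1 ≠ 0 := by nlinarith
  rw [decompDensity]
  obtain ⟨e, he⟩ := Nat.exists_eq_add_of_le hd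
  rw [he] at h ⊢
  rw [show 2 * (2 + e) - 3 = 2 * e + 1 by omega]
  rw [show 1 - (q : ℝ)⁻¹ ^ 2 = (q ^ 2 - 1) / q ^ 2 by field_simp]
  rw [show ((decomposables F E).card : ℝ) =
    q ^ (2 * (2 + e)) * pairDensity (2 + e) (q : ℝ)⁻¹ / (q * (q ^ 2 - 1)) by
      rw [← h]; field_simp]
  field_simp
  ring

open scoped Classical in
/-- An upper bound for the number of decomposables in a hyperplane. -/
lemma exists_card_ker_le (hd : 2 ≤ d) : ∃ h : ℕ,
    (∀ l : Dual F (⋀[F]^2 E), l ≠ 0 → ((decomposables F E).filter fun x => l x = 0).card ≤ h) ∧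
      (decomposables F E).card * avoidDensity d (q : ℝ)⁻¹ ≤
        ((decomposables F E).card - h : ℕ) := by
  have hq := one_lt_cast_card F
  have h1 : 1 < q := Fintype.one_lt_card
  have hf : 0 < q * (q ^ 2 - 1) * q := by
    have : 1 < q ^ 2 := Nat.one_lt_pow (by norm_num) h1
    have : 0 < q ^ 2 - 1 := by omega
    positivity
  refine ⟨2 * q ^ (2 * d) / (q * (q ^ 2 - 1) * q), fun l hl => ?_, ?_⟩
  · rw [Nat.le_div_iff_mul_le hf, ← mul_assoc]
    exact card_decomposables_ker_le l hl
  · have hx := card_decomposables_mul_eq (F := F) (E := E) hd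
    have hp : 0 < pairDensity d (q : ℝ)⁻¹ :=
      pairDensity_pos hd (by positivity) (inv_lt_one_of_one_lt₀ hq)
    have h2 : ((2 * q ^ (2 * d) / (q * (q ^ 2 - 1) * q) : ℕ) : ℝ) ≤
        (decomposables F E).card * (2 * (q : ℝ)⁻¹ / pairDensity d (q : ℝ)⁻¹) := by
      refine Nat.cast_div_le.trans (le_of_eq ?_)
      push_cast [Nat.cast_sub (Nat.one_le_pow 2 _ h1.le)]
      have h3 : (q : ℝ) ^ 2 - 1 ≠ 0 := by nlinarith
      have h4 := hp.ne'
      rw [div_eq_iff (by positivity)]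
      calc _ = 2 * ((q : ℝ) ^ (2 * d) * pairDensity d (q : ℝ)⁻¹) / pairDensity d (q : ℝ)⁻¹ := by
            rw [← mul_assoc, mul_div_cancel_right₀ _ h4]
        _ = _ := by
            rw [← hx]
            linear_combination (-(2 * (decomposables F E).card / pairDensity d (q : ℝ)⁻¹ * q *
              ((q : ℝ) ^ 2 - 1))) * mul_inv_cancel₀ (zero_lt_one.trans hq).ne'
    rw [avoidDensity]
    have h5 : ((decomposables F E).card : ℝ) ≤ ((decomposables F E).card -
        2 * q ^ (2 * d) / (q * (q ^ 2 - 1) * q) : ℕ) +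
        (2 * q ^ (2 * d) / (q * (q ^ 2 - 1) * q) : ℕ) := by
      exact_mod_cast le_tsub_add
    linarith

variable (F) in
lemma card_submodule_mul_frameDensity_le (U : Type*) [AddCommGroup U] [Module F U] [Finite U]
    (r : ℕ) :
    (Nat.card {L : Submodule F U // finrank F L = r} : ℝ) *
      (q ^ (r * r) * frameDensity r (q : ℝ)⁻¹) ≤ q ^ (finrank F U * r) := by
  have hq := one_lt_cast_card F
  have h := card_submodule_finrank_mul_le F U r
  have h1 : ((∏ i : Fin r, (q ^ r - q ^ (i : ℕ)) : ℕ) : ℝ) =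
      q ^ (r * r) * frameDensity r (q : ℝ)⁻¹ := by
    rw [Nat.cast_prod, frameDensity, show (q : ℝ) ^ (r * r) = ∏ _i : Fin r, (q : ℝ) ^ r by
      simp [pow_mul], ← Finset.prod_mul_distrib]
    refine Finset.prod_congr rfl fun i _ => ?_
    rw [Nat.cast_sub (Nat.pow_le_pow_right Fintype.card_pos i.2.le), mul_sub, mul_one]
    push_cast
    rw [inv_pow, ← pow_sub₀ _ (by positivity) (Nat.sub_le _ _), Nat.sub_sub_self i.2.le]
  rw [← h1]
  exact_mod_cast h

end Estimates

lemma mul_le_mul_pow_of_density {Q N A X y φ g σ c S : ℝ} {r e k m : ℕ} (hr : r + e = m + k + 1)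
    (hQ : 0 < Q) (hy : 0 < y) (hg : 0 ≤ g) (hN : 0 ≤ N) (hS : 0 ≤ S) (hX : X = Q ^ e * y)
    (hA : A * (Q ^ (r * r) * φ) ≤ Q ^ (m * r)) (hc : c ^ (r + 1) ≤ N * S ^ r)
    (hgc : X ^ r * g ≤ c) (hσ : S ≤ X ^ r * Q ^ (k + 1) * σ) :
    A * (φ * g ^ (r + 1) * y ^ r) ≤ N * σ ^ r := by
  have hX0 : 0 < X := by rw [hX]; positivity
  have h1 : (X ^ r * g) ^ (r + 1) ≤ N * (X ^ r * Q ^ (k + 1) * σ) ^ r :=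
    (pow_le_pow_left₀ (by positivity) hgc _).trans <| hc.trans <|
      mul_le_mul_of_nonneg_left (pow_le_pow_left₀ hS hσ _) hN
  have h2 : X ^ r * g ^ (r + 1) ≤ N * (Q ^ (k + 1) * σ) ^ r := by
    refine le_of_mul_le_mul_left ?_ (show 0 < (X ^ r) ^ r by positivity)
    calc _ = (X ^ r * g) ^ (r + 1) := by ring
      _ ≤ _ := h1
      _ = _ := by ring
  rw [hX, mul_pow] at h2
  refine le_of_mul_le_mul_left ?_ (show 0 < Q ^ (r * r) * (Q ^ e) ^ r by positivity)
  calc _ = A * (Q ^ (r * r) * φ) * ((Q ^ e) ^ r * y ^ r * g ^ (r + 1)) := by ring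
    _ ≤ Q ^ (m * r) * ((Q ^ e) ^ r * y ^ r * g ^ (r + 1)) :=
        mul_le_mul_of_nonneg_right hA (by positivity)
    _ ≤ Q ^ (m * r) * (N * (Q ^ (k + 1) * σ) ^ r) :=
        mul_le_mul_of_nonneg_left h2 (by positivity)
    _ = Q ^ ((m + k + 1) * r) * (N * σ ^ r) := by
        rw [mul_pow, ← pow_mul, add_assoc, add_mul, pow_add]; ring
    _ = _ := by rw [← hr, ← pow_mul, add_mul, pow_add]

section SpanningProbability
variable {F E : Type*} [Field F] [AddCommGroup E] [Module F E]
  [Fintype F] [Fintype E] [Fintype (⋀[F]^2 E)]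

local notation "q" => Fintype.card F
local notation "d" => Module.finrank F E

lemma numSum_le_of_two_le {r k t : ℕ} (hr : r + (2 * d - 3) = Nat.choose d 2 + k + 1) (ht : t ≤ 1)
    (htd : t + 4 ≤ d) (J : Finset (Fin r)) (hJ : 2 ≤ J.card) :
    (q : ℝ) ^ J.card * numSum F E J ≤ (decomposables F E).card ^ r * q ^ (k + 1) *
      ((decompDensity d (q : ℝ)⁻¹ * (q : ℝ)⁻¹ ^ (r - J.card) + 2 ^ d * (q : ℝ)⁻¹ ^ (t + k)) /
        pairDensity d (q : ℝ)⁻¹ ^ r) := by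
  have hq := one_lt_cast_card F
  have h1 : 1 < q := Fintype.one_lt_card
  have h := Nat.cast_le (α := ℝ).2 (numSum_mul_pow_le (F := F) (E := E) ht htd J hJ)
  push_cast [Nat.cast_sub (Nat.one_le_pow 2 _ h1.le), Fintype.card_fin] at h
  have hp : 0 < pairDensity d (q : ℝ)⁻¹ :=
    pairDensity_pos (by omega) (by positivity) (inv_lt_one_of_one_lt₀ hq)
  have hx := card_decomposables_mul_eq (F := F) (E := E) (by omega)
  have hx' := card_decomposables_eq (F := F) (E := E) (by omega)
  have hf : (0 : ℝ) < q * (q ^ 2 - 1) := by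
    have : (0 : ℝ) < q ^ 2 - 1 := by nlinarith
    positivity
  obtain ⟨i, hi⟩ := Nat.exists_eq_add_of_le' hJ
  obtain ⟨l, hl⟩ : ∃ l, r = J.card + l :=
    Nat.exists_eq_add_of_le (by simpa using Finset.card_le_univ J)
  have hjl : r - J.card = l := by omega
  have hpow : (q : ℝ) ^ (2 * (d * r)) =
      (decomposables F E).card ^ r * (q * (q ^ 2 - 1)) ^ r / pairDensity d (q : ℝ)⁻¹ ^ r := by
    rw [eq_div_iff (by positivity), ← mul_pow, hx, mul_pow, ← pow_mul]
    congr 2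
    ring
  have hz1 : (q : ℝ) ^ J.card * ((decomposables F E).card * q ^ (J.card - 1 + t)) =
      q ^ Nat.choose d 2 * q ^ (J.card - 1 + t) *
        (q ^ (k + 1) * (decompDensity d (q : ℝ)⁻¹ * (q : ℝ)⁻¹ ^ (r - J.card))) := by
    have h3 : (q : ℝ) ^ (J.card + (2 * d - 3)) =
        q ^ (Nat.choose d 2 + k + 1) * (q : ℝ)⁻¹ ^ (r - J.card) := by
      rw [inv_pow, ← pow_sub₀ _ (by positivity) (by omega)]
      congr 1
      omega
    rw [hx']
    rw [pow_add _ J.card, pow_add _ _ 1, pow_add _ _ k] at h3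
    rw [pow_add _ k]
    linear_combination (decompDensity d (q : ℝ)⁻¹ * q ^ (J.card - 1 + t)) * h3
  have hz2 : (q : ℝ) ^ J.card * (2 ^ d * q ^ Nat.choose d 2) =
      q ^ Nat.choose d 2 * q ^ (J.card - 1 + t) *
        (q ^ (k + 1) * (2 ^ d * (q : ℝ)⁻¹ ^ (t + k))) := by
    have h3 : (q : ℝ) ^ J.card = q ^ (J.card - 1 + t + (k + 1)) * (q : ℝ)⁻¹ ^ (t + k) := by
      rw [inv_pow, ← pow_sub₀ _ (by positivity) (by omega)]
      congr 1
      omega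
    rw [pow_add _ (J.card - 1 + t)] at h3
    linear_combination (2 ^ d * (q : ℝ) ^ Nat.choose d 2) * h3
  refine le_of_mul_le_mul_right ?_
    (show (0 : ℝ) < (q * (q ^ 2 - 1)) ^ r * q ^ Nat.choose d 2 * q ^ (J.card - 1 + t) by positivity)
  calc _ = (q : ℝ) ^ J.card * (numSum F E J * (q * (q ^ 2 - 1)) ^ r * q ^ Nat.choose d 2 *
        q ^ (J.card - 1 + t)) := by ring
    _ ≤ (q : ℝ) ^ J.card * (q ^ (2 * (d * r)) * ((decomposables F E).card * q ^ (J.card - 1 + t) +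
        2 ^ d * q ^ Nat.choose d 2)) := mul_le_mul_of_nonneg_left h (by positivity)
    _ = (q : ℝ) ^ (2 * (d * r)) * (q ^ J.card * ((decomposables F E).card * q ^ (J.card - 1 + t)) +
        q ^ J.card * (2 ^ d * q ^ Nat.choose d 2)) := by ring
    _ = _ := by rw [hz1, hz2, hpow]; ring

open scoped Classical in
lemma sum_card_span_le_spanDensity {r k t : ℕ} (hr : r + (2 * d - 3) = Nat.choose d 2 + k + 1)
    (ht : t ≤ 1) (htd : t + 4 ≤ d) (G : Finset (Fin r → ⋀[F]^2 E))
    (hG : G ⊆ Fintype.piFinset fun _ => decomposables F E) :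
    (∑ ω ∈ G, ((decomposables F E).filter
      fun x => x ∈ Submodule.span F (Set.range ω)).card : ℝ) ≤
    (decomposables F E).card ^ r * q ^ (k + 1) * spanDensity d r k t (q : ℝ)⁻¹ := by
  have hq := one_lt_cast_card F
  have h1 : 1 < q := Fintype.one_lt_card
  set B : ℝ := (decomposables F E).card ^ r * q ^ (k + 1) with hB
  have hcard : ∑ J : Finset (Fin r), (if J.card = 1 then (q : ℝ)⁻¹ ^ k else 0) =
      r * (q : ℝ)⁻¹ ^ k := by
    rw [← Finset.sum_filter, Finset.sum_const, nsmul_eq_mul, ← Fintype.card_subtype,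
      Fintype.card_finset_len]
    simp
  rw [spanDensity, ← hcard, ← Finset.sum_add_distrib, Finset.mul_sum]
  have h := Nat.cast_le (α := ℝ).2 (sum_card_span_le G (by convert hG))
  rw [Nat.cast_sum, Nat.cast_sum] at h
  refine h.trans (Finset.sum_le_sum fun J _ => ?_)
  rw [Nat.cast_mul]
  have h2 : (((q - 1) ^ J.card : ℕ) : ℝ) ≤ (q : ℝ) ^ J.card := by
    exact_mod_cast Nat.pow_le_pow_left (Nat.sub_le _ _) _
  refine (mul_le_mul_of_nonneg_right h2 (by positivity)).trans ?_
  rcases Nat.lt_trichotomy J.card 1 with hJ | hJ | hJ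
  · obtain rfl : J = ∅ := by simpa using hJ
    simp [numSum_empty]
  · rw [if_pos hJ, if_neg (by omega), hJ, add_zero, hB, pow_one, pow_succ]
    have h3 : (numSum F E J : ℝ) ≤ (decomposables F E).card ^ r := by
      exact_mod_cast (numSum_le J).trans_eq (by simp)
    calc _ ≤ (q : ℝ) * (decomposables F E).card ^ r :=
          mul_le_mul_of_nonneg_left h3 (by positivity)
      _ = _ := by
        have h4 : (q : ℝ) ^ k * (q : ℝ)⁻¹ ^ k = 1 := by
          rw [← mul_pow, mul_inv_cancel₀ (by positivity), one_pow]
        linear_combination (-((q : ℝ) * (decomposables F E).card ^ r)) * h4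
  · rw [if_neg (by omega), if_pos (show 2 ≤ J.card from hJ), zero_add]
    exact numSum_le_of_two_le hr ht htd J hJ

open scoped Classical in
lemma card_submodule_mul_le_card_spanned_mul {r k : ℕ} (hr0 : r ≠ 0)
    (hr : r + (2 * d - 3) = Nat.choose d 2 + k + 1) (hd : 2 ≤ d)
    (G : Finset (Fin r → ⋀[F]^2 E))
    (hG : G ⊆ Fintype.piFinset fun _ => decomposables F E)
    (hli : ∀ ω ∈ G, LinearIndependent F ω) {g σ : ℝ} (hg : 0 ≤ g)
    (hgG : (decomposables F E).card ^ r * g ≤ G.card)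
    (hσ : (∑ ω ∈ G, ((decomposables F E).filter
      fun x => x ∈ Submodule.span F (Set.range ω)).card : ℝ) ≤
        (decomposables F E).card ^ r * q ^ (k + 1) * σ) :
    (Nat.card {L : Submodule F (⋀[F]^2 E) // finrank F L = r} : ℝ) *
        (frameDensity r (q : ℝ)⁻¹ * g ^ (r + 1) * decompDensity d (q : ℝ)⁻¹ ^ r) ≤
      Nat.card {L : Submodule F (⋀[F]^2 E) //
        finrank F L = r ∧ L = Submodule.span F (L ∩ decomposables F E)} * σ ^ r := by
  have hq := one_lt_cast_card F
  have hfin : finrank F (⋀[F]^2 E) = Nat.choose d 2 := exteriorPower.finrank_eq F 2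
  have hx := card_decomposables_eq (F := F) (E := E) hd
  have hp : 0 < pairDensity d (q : ℝ)⁻¹ :=
    pairDensity_pos hd (by positivity) (inv_lt_one_of_one_lt₀ hq)
  have hy : 0 < decompDensity d (q : ℝ)⁻¹ :=
    div_pos hp (sub_pos.2 (pow_lt_one₀ (by positivity) (inv_lt_one_of_one_lt₀ hq) two_ne_zero))
  have hA := card_submodule_mul_frameDensity_le F (⋀[F]^2 E) r
  have hN := card_pow_le_card_spanned_mul hr0 (decomposables F E) G hG hli
  rw [hfin] at hA
  exact mul_le_mul_pow_of_density hr (by positivity) hy hg (Nat.cast_nonneg _)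
    (Finset.sum_nonneg fun _ _ => Nat.cast_nonneg _) hx hA hN hgG hσ

end SpanningProbability

section SubspaceCounts
variable {F E : Type*} [Field F] [AddCommGroup E] [Module F E]
  [Fintype F] [Fintype E] [Fintype (⋀[F]^2 E)]

local notation "q" => Fintype.card F
local notation "d" => Module.finrank F E

lemma card_submodule_mul_le_of_le_choose {r k t : ℕ} (hr0 : r ≠ 0)
    (hr : r + (2 * d - 3) = Nat.choose d 2 + k + 1) (hrd : r ≤ Nat.choose d 2)
    (ht : t ≤ 1) (htd : t + 4 ≤ d) (ha : 0 ≤ avoidDensity d (q : ℝ)⁻¹) :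
    (Nat.card {L : Submodule F (⋀[F]^2 E) // finrank F L = r} : ℝ) *
        (frameDensity r (q : ℝ)⁻¹ * (avoidDensity d (q : ℝ)⁻¹ ^ r) ^ (r + 1) *
          decompDensity d (q : ℝ)⁻¹ ^ r) ≤
      Nat.card {L : Submodule F (⋀[F]^2 E) //
        finrank F L = r ∧ L = Submodule.span F (L ∩ decomposables F E)} *
          spanDensity d r k t (q : ℝ)⁻¹ ^ r := by
  classical
  obtain ⟨h, hker, hcard⟩ := exists_card_ker_le (F := F) (E := E) (by omega)
  have hG := pow_le_card_linearIndependent (decomposables F E) h (fun l hl => by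
    convert hker l hl) r (hrd.trans_eq (exteriorPower.finrank_eq F 2).symm)
  refine card_submodule_mul_le_card_spanned_mul hr0 hr (by omega)
    ((Fintype.piFinset fun _ : Fin r => decomposables F E).filter
      fun ω => LinearIndependent F ω) (by convert Finset.filter_subset _ _)
    (fun ω hω => (Finset.mem_filter.1 hω).2) (by positivity) ?_ ?_
  · rw [← mul_pow]
    refine (pow_le_pow_left₀ (by positivity) hcard r).trans ?_
    exact_mod_cast hG.trans_eq (by congr!)
  · convert sum_card_span_le_spanDensity hr ht htd
      ((Fintype.piFinset fun _ : Fin r => decomposables F E).filter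
        fun ω => LinearIndependent F ω) (by convert Finset.filter_subset _ _) 

lemma card_submodule_two_mul_le (hd : d = 4) (h2 : (2 : F) ≠ 0)
    (ha : 0 ≤ avoidDensity 4 (q : ℝ)⁻¹) :
    (Nat.card {L : Submodule F (⋀[F]^2 E) // finrank F L = 2} : ℝ) *
        (frameDensity 2 (q : ℝ)⁻¹ * avoidDensity 4 (q : ℝ)⁻¹ ^ 3 *
          decompDensity 4 (q : ℝ)⁻¹ ^ 2) ≤
      Nat.card {L : Submodule F (⋀[F]^2 E) //
        finrank F L = 2 ∧ L = Submodule.span F (L ∩ decomposables F E)} * 2 ^ 2 := by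
  classical
  obtain ⟨h, hker, hcard⟩ := exists_card_ker_le (F := F) (E := E) (by omega)
  have hG := le_card_mul_ne_zero hd h hker
  set G := (Fintype.piFinset fun _ : Fin 2 => decomposables F E).filter
    fun ω => (ω 0 : ExteriorAlgebra F E) * ω 1 ≠ 0
  have hGs : G ⊆ Fintype.piFinset fun _ : Fin 2 => decomposables F E := Finset.filter_subset _ _
  have hGX (ω) (hω : ω ∈ G) (i) : ω i ∈ decomposables F E := Fintype.mem_piFinset.1 (hGs hω) i
  rw [← hd] at ha ⊢
  refine card_submodule_mul_le_card_spanned_mul (k := 0) two_ne_zero (by rw [hd]; rfl) (by omega)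
    G (by convert hGs)
    (fun ω hω => linearIndependent_of_mul_ne_zero ω (hGX ω hω) (Finset.mem_filter.1 hω).2) ha ?_ ?_
  · rw [pow_two, mul_assoc]
    refine (mul_le_mul_of_nonneg_left hcard (by positivity)).trans ?_
    exact_mod_cast hG.trans_eq (by congr!)
  · refine (Finset.sum_le_card_nsmul _ _ (2 * q : ℝ) fun ω hω => ?_).trans ?_
    · exact_mod_cast (card_span_pair_le h2 ω (hGX ω hω) (Finset.mem_filter.1 hω).2).trans_eq'
        (by congr!)
    · rw [nsmul_eq_mul, zero_add, pow_one, mul_comm 2, ← mul_assoc]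
      have : (G.card : ℝ) ≤ (decomposables F E).card ^ 2 := by
        exact_mod_cast (Finset.card_le_card hGs).trans_eq (by simp)
      gcongr

end SubspaceCounts

section Transfer

variable {F E : Type*} [Field F] [AddCommGroup E] [Module F E]

lemma decompSet_eq_image : DecompSet F E =
    (⋀[F]^2 E).subtype '' Set.range fun p : E × E => wedge (F := F) p.1 p.2 := by
  rw [← Set.range_comp]
  ext x
  simp [DecompSet, eq_comm]

lemma grade2_eq_exteriorPower : grade2 F E = ⋀[F]^2 E := by
  rw [grade2, decompSet_eq_image, Submodule.span_image, span_range_wedge, Submodule.map_subtype_top]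

lemma card_le_and_eq (A : Type*) [AddCommGroup A] [Module F A] (W : Submodule F A)
    (P : Submodule F A → Prop) :
    Nat.card {L : Submodule F A // L ≤ W ∧ P L} =
      Nat.card {L : Submodule F W // P (L.map W.subtype)} := by
  refine (Nat.card_congr (Equiv.ofBijective
    (fun L => ⟨L.1.map W.subtype, Submodule.map_subtype_le _ _, L.2⟩) ⟨?_, ?_⟩)).symm
  · intro L L' h
    exact Subtype.ext (Submodule.map_injective_of_injective W.injective_subtype
      (congrArg Subtype.val h))
  · rintro ⟨L, hL, hP⟩
    have h : (L.comap W.subtype).map W.subtype = L := by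
      rw [Submodule.map_comap_subtype, inf_eq_right.2 hL]
    exact ⟨⟨L.comap W.subtype, by rwa [h]⟩, Subtype.ext h⟩

lemma spannedByDecomposables_map_iff [Fintype F] [Fintype E] [Fintype (⋀[F]^2 E)]
    (L : Submodule F (⋀[F]^2 E)) :
    SpannedByDecomposables F E (L.map (⋀[F]^2 E).subtype) ↔
      L = Submodule.span F (L ∩ decomposables F E) := by
  have h1 : ((L.map (⋀[F]^2 E).subtype : Submodule F (ExteriorAlgebra F E)) :
      Set (ExteriorAlgebra F E)) ∩ DecompSet F E =
      (⋀[F]^2 E).subtype '' (L ∩ Set.range fun p : E × E => wedge (F := F) p.1 p.2) := by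
    rw [Set.image_inter (⋀[F]^2 E).injective_subtype, Submodule.map_coe, decompSet_eq_image]
  have h2 : (L : Set (⋀[F]^2 E)) ∩ decomposables F E =
      ((L : Set (⋀[F]^2 E)) ∩ Set.range fun p : E × E => wedge (F := F) p.1 p.2) \ {0} := by
    ext x
    simp only [Set.mem_inter_iff, mem_decomposables, Set.mem_sdiff, Set.mem_range,
      Prod.exists, Set.mem_singleton_iff, SetLike.mem_coe, eq_comm (a := x)]
    tauto
  rw [SpannedByDecomposables, h1, h2, Submodule.span_image, Submodule.span_sdiff_singleton_zero]
  exact (Submodule.map_injective_of_injective (⋀[F]^2 E).injective_subtype).eq_iff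

variable (p e r : ℕ) [Fact p.Prime]

lemma numAll_eq : numAll p e r =
    Nat.card {L : Submodule (ZMod p) (⋀[ZMod p]^2 (Fin e → ZMod p)) //
      finrank (ZMod p) L = r} := by
  rw [numAll, grade2_eq_exteriorPower, card_le_and_eq]
  simp_rw [Submodule.finrank_map_subtype_eq]

lemma numSpanned_eq [Fintype (⋀[ZMod p]^2 (Fin e → ZMod p))] : numSpanned p e r =
    Nat.card {L : Submodule (ZMod p) (⋀[ZMod p]^2 (Fin e → ZMod p)) //
      finrank (ZMod p) L = r ∧
        L = Submodule.span (ZMod p) (L ∩ decomposables (ZMod p) (Fin e → ZMod p))} := by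
  rw [numSpanned, grade2_eq_exteriorPower, card_le_and_eq]
  simp_rw [Submodule.finrank_map_subtype_eq, spannedByDecomposables_map_iff]

instance : Finite (⋀[ZMod p]^2 (Fin e → ZMod p)) := Module.finite_of_finite (ZMod p)

lemma numSpanned_le_numAll : numSpanned p e r ≤ numAll p e r := by
  have := Fintype.ofFinite (⋀[ZMod p]^2 (Fin e → ZMod p))
  rw [numAll_eq, numSpanned_eq]
  exact Nat.card_le_card_of_injective (fun L => ⟨L.1, L.2.1⟩)
    fun L L' h => Subtype.ext (Subtype.ext_iff.1 h :)

lemma numAll_pos (hr : r ≤ e.choose 2) : 0 < numAll p e r := by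
  have hfin : finrank (ZMod p) (⋀[ZMod p]^2 (Fin e → ZMod p)) = e.choose 2 := by
    rw [exteriorPower.finrank_eq]; simp
  rw [numAll_eq]
  let b := Module.finBasisOfFinrankEq _ _ hfin
  have hli := b.linearIndependent.comp _ (Fin.castLE_injective hr)
  have : Nonempty {L : Submodule (ZMod p) (⋀[ZMod p]^2 (Fin e → ZMod p)) //
      finrank (ZMod p) L = r} := ⟨⟨_, by simpa using finrank_span_eq_card hli⟩⟩
  exact Nat.card_pos

end Transfer

section Limits

instance neBot_primesAtTop : primesAtTop.NeBot := by
  rw [primesAtTop, ← Nat.cofinite_eq_atTop]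
  exact Nat.infinite_setOfPred_prime.cofinite_inf_principal_neBot

lemma tendsto_inv_primesAtTop : Tendsto (fun p : ℕ => (p : ℝ)⁻¹) primesAtTop (nhds 0) :=
  tendsto_inv_atTop_nhds_zero_nat.mono_left inf_le_left

lemma eventually_prime : ∀ᶠ p in primesAtTop, p.Prime :=
  mem_inf_of_right (mem_principal_self _)

lemma continuousAt_pairDensity (e : ℕ) : ContinuousAt (pairDensity e) 0 := by
  unfold pairDensity; fun_prop

lemma pairDensity_zero {e : ℕ} (he : 2 ≤ e) : pairDensity e 0 = 1 := by
  simp [pairDensity, show e ≠ 0 by omega, show e - 1 ≠ 0 by omega]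

lemma continuousAt_decompDensity (e : ℕ) : ContinuousAt (decompDensity e) 0 :=
  (continuousAt_pairDensity e).div (by fun_prop) (by norm_num)

lemma decompDensity_zero {e : ℕ} (he : 2 ≤ e) : decompDensity e 0 = 1 := by
  simp [decompDensity, pairDensity_zero he]

lemma continuousAt_avoidDensity {e : ℕ} (he : 2 ≤ e) : ContinuousAt (avoidDensity e) 0 :=
  continuousAt_const.sub (ContinuousAt.div (by fun_prop) (continuousAt_pairDensity e)
    (by simp [pairDensity_zero he]))

lemma avoidDensity_zero (e : ℕ) : avoidDensity e 0 = 1 := by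
  simp [avoidDensity]

lemma continuousAt_frameDensity (r : ℕ) : ContinuousAt (frameDensity r) 0 := by
  unfold frameDensity; fun_prop

lemma frameDensity_zero (r : ℕ) : frameDensity r 0 = 1 := by
  refine Finset.prod_eq_one fun i _ => ?_
  rw [zero_pow (by omega), sub_zero]

lemma continuousAt_spanDensity {e : ℕ} (he : 2 ≤ e) (r k t : ℕ) :
    ContinuousAt (spanDensity e r k t) 0 := by
  have h1 := continuousAt_decompDensity e
  have h2 := continuousAt_pairDensity e
  have h3 := pairDensity_zero he
  unfold spanDensity
  refine ContinuousAt.add (by fun_prop) ?_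
  refine tendsto_finsetSum _ fun J _ => ?_
  split_ifs with hJ
  · exact ContinuousAt.div (by fun_prop) (h2.pow r) (by simp [h3])
  · exact tendsto_const_nhds

lemma spanDensity_zero {e r k t : ℕ} (he : 2 ≤ e) (hr : 2 ≤ r) (htk : t + k ≠ 0) :
    spanDensity e r k t 0 = r * 0 ^ k + 1 := by
  rw [spanDensity, decompDensity_zero he, pairDensity_zero he, zero_pow htk]
  congr 1
  rw [Finset.sum_eq_single Finset.univ]
  · simp [hr]
  · intro J _ hJ
    have : J.card < r := by
      simpa using Finset.card_lt_card (Finset.ssubset_univ_iff.2 hJ)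
    simp [show r - J.card ≠ 0 by omega]
  · simp

lemma two_mul_catalan_le_catalan_succ {n : ℕ} (hn : n ≠ 0) : 2 * catalan n ≤ catalan (n + 1) := by
  obtain ⟨k, rfl⟩ := Nat.exists_eq_succ_of_ne_zero hn
  rw [catalan_succ (k + 1), Fin.sum_univ_succ, Fin.sum_univ_castSucc]
  simp [two_mul]

lemma choose_two_add_two_le_catalan {n : ℕ} (hn : 3 ≤ n) : n.choose 2 + 2 ≤ catalan n := by
  induction n, hn using Nat.le_induction with
  | base => simp [catalan_three, Nat.choose]
  | succ n hn ih =>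
    have h1 : n - 1 ≤ n.choose 2 := by
      rw [Nat.choose_two_right, Nat.le_div_iff_mul_le two_pos, mul_comm]
      gcongr
      omega
    have h2 := two_mul_catalan_le_catalan_succ (n := n) (by omega)
    have h3 : (n + 1).choose 2 = n + n.choose 2 := by
      rw [Nat.choose_succ_succ' n 1, Nat.choose_one_right]
    omega

lemma two_le_catalan {n : ℕ} (hn : 2 ≤ n) : 2 ≤ catalan n := by
  rcases hn.eq_or_lt with rfl | hn
  · simp [catalan_two]
  · exact le_add_self.trans (choose_two_add_two_le_catalan hn)

/-- A lower bound tending to `c⁻¹ ^ r` for the proportion of subspaces spanned by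
decomposables. -/
lemma exists_tendsto_le_decompRatio {e r : ℕ} (he : 4 ≤ e) (hr1 : (e - 2).choose 2 + 1 ≤ r)
    (hr2 : r ≤ e.choose 2) :
    ∃ (c : ℝ) (b : ℕ → ℝ), 0 < c ∧ c ≤ catalan (e - 2) ∧
      Tendsto b primesAtTop (nhds ((1 / c) ^ r)) ∧
        ∀ᶠ p in primesAtTop, b p ≤ decompRatio p e r := by
  have hlim {f : ℝ → ℝ} (hf : ContinuousAt f 0) :
      Tendsto (fun p : ℕ => f (p : ℝ)⁻¹) primesAtTop (nhds (f 0)) :=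
    hf.tendsto.comp tendsto_inv_primesAtTop
  have hav : ∀ᶠ p : ℕ in primesAtTop, 0 ≤ avoidDensity e (p : ℝ)⁻¹ :=
    (hlim (continuousAt_avoidDensity (by omega))).eventually_const_le
      (by simp [avoidDensity_zero])
  have hratio {p : ℕ} (hp : p.Prime) {x y : ℝ} (hy : 0 < y)
      (h : (numAll p e r : ℝ) * x ≤ numSpanned p e r * y) : x / y ≤ decompRatio p e r := by
    have := Fact.mk hp
    have h0 : (0 : ℝ) < numAll p e r := by exact_mod_cast numAll_pos p e r hr2
    rw [decompRatio, div_le_div_iff₀ hy h0]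
    linarith
  have hfr (p : ℕ) [Fact p.Prime] : finrank (ZMod p) (Fin e → ZMod p) = e := by simp
  obtain ⟨k, rfl⟩ := Nat.exists_eq_add_of_le hr1
  have hm : 0 < (e - 2).choose 2 := Nat.choose_pos (by omega)
  have hexp : (e - 2).choose 2 + 1 + k + (2 * e - 3) = e.choose 2 + k + 1 := by
    obtain ⟨n, rfl⟩ := Nat.exists_eq_add_of_le' he
    simp only [Nat.choose_succ_succ' _ 1, Nat.choose_one_right,
      show n + 4 - 2 = n + 1 + 1 by omega]
    omega
  set r := (e - 2).choose 2 + 1 + k with hr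
  by_cases h42 : e = 4 ∧ k = 0
  · obtain ⟨rfl, rfl⟩ := h42
    have hr2' : r = 2 := by rw [hr]; rfl
    refine ⟨2, fun p => frameDensity 2 (p : ℝ)⁻¹ * avoidDensity 4 (p : ℝ)⁻¹ ^ 3 *
      decompDensity 4 (p : ℝ)⁻¹ ^ 2 / 2 ^ 2, two_pos, by simp [catalan_two], ?_, ?_⟩
    · have := hlim ((((continuousAt_frameDensity 2).mul
        ((continuousAt_avoidDensity (e := 4) (by omega)).pow 3)).mul
        ((continuousAt_decompDensity 4).pow 2)).div_const (2 ^ 2))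
      simpa [frameDensity_zero, avoidDensity_zero, decompDensity_zero, hr2'] using this
    · have h3 : ∀ᶠ p in primesAtTop, 3 ≤ p := mem_inf_of_left (eventually_ge_atTop 3)
      filter_upwards [eventually_prime, hav, h3] with p hp ha h3
      have := Fact.mk hp
      have := Fintype.ofFinite (⋀[ZMod p]^2 (Fin 4 → ZMod p))
      refine hratio hp (by positivity) ?_
      have h2 : (2 : ZMod p) ≠ 0 := by
        have : ¬ p ∣ 2 := fun h => absurd (Nat.le_of_dvd two_pos h) (by omega)
        rwa [← ZMod.natCast_eq_zero_iff] at this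
      have := card_submodule_two_mul_le (F := ZMod p) (hfr p) h2 (by rwa [ZMod.card])
      rw [hr2', numAll_eq, numSpanned_eq]
      rwa [ZMod.card] at this
  obtain ⟨t, ht, hte, htk⟩ : ∃ t, t ≤ 1 ∧ t + 4 ≤ e ∧ t + k ≠ 0 := by
    by_cases h : e = 4
    · exact ⟨0, by omega, by omega, by omega⟩
    · exact ⟨1, le_rfl, by omega, by omega⟩
  have hs0 := spanDensity_zero (e := e) (r := r) (k := k) (t := t) (by omega) (by omega) htk
  have hs := continuousAt_spanDensity (e := e) (by omega) r k t
  have hc : 0 < spanDensity e r k t 0 := by rw [hs0]; positivity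
  refine ⟨spanDensity e r k t 0, fun p => frameDensity r (p : ℝ)⁻¹ *
    (avoidDensity e (p : ℝ)⁻¹ ^ r) ^ (r + 1) * decompDensity e (p : ℝ)⁻¹ ^ r /
      spanDensity e r k t (p : ℝ)⁻¹ ^ r, hc, ?_, ?_, ?_⟩
  · rw [hs0]
    rcases eq_or_ne k 0 with hk | hk
    · have := choose_two_add_two_le_catalan (n := e - 2) (by omega)
      rw [hk, pow_zero, mul_one]
      exact_mod_cast show r + 1 ≤ catalan (e - 2) by omega
    · have := two_le_catalan (n := e - 2) (by omega)
      rw [zero_pow hk, mul_zero, zero_add]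
      exact_mod_cast show 1 ≤ catalan (e - 2) by omega
  · have := hlim ((((continuousAt_frameDensity r).mul
      (((continuousAt_avoidDensity (e := e) (by omega)).pow r).pow (r + 1))).mul
      ((continuousAt_decompDensity e).pow r)).div (hs.pow r) (pow_pos hc r).ne')
    simpa [frameDensity_zero, avoidDensity_zero, decompDensity_zero (show 2 ≤ e by omega)]
      using this
  · filter_upwards [eventually_prime, hav, (hlim hs).eventually_const_lt hc] with p hp ha hsp
    have := Fact.mk hp
    have := Fintype.ofFinite (⋀[ZMod p]^2 (Fin e → ZMod p))
    refine hratio hp (pow_pos hsp r) ?_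
    have := card_submodule_mul_le_of_le_choose (F := ZMod p) (E := Fin e → ZMod p) (r := r)
      (k := k) (t := t) (by omega) (by rwa [hfr]) (by rwa [hfr]) ht (by rwa [hfr])
      (by rwa [hfr, ZMod.card])
    rw [numAll_eq, numSpanned_eq]
    rwa [hfr, ZMod.card] at this

end Limits

end ExteriorSquare

/-- for `d ≥ 4` and `binom(d-2,2)+1 ≤ r ≤ binom(d,2)`, the liminf over
primes `p → ∞` of the proportion of `r`-dimensional subspaces of `⋀²(F_p^d)` spanned
by decomposables is at least `(1/C_{d-2})^r`; in particular this proportion is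
bounded away from `0` as `p → ∞`. -/
theorem stmt1 (d r : ℕ) (hd : 4 ≤ d) (hr1 : (d - 2).choose 2 + 1 ≤ r)
    (hr2 : r ≤ d.choose 2) :
    ((1 : ℝ) / (catalan (d - 2) : ℝ)) ^ r ≤
        liminf (fun p : ℕ => decompRatio p d r) primesAtTop ∧
      ∃ ε : ℝ, 0 < ε ∧ ∀ᶠ p in primesAtTop, ε ≤ decompRatio p d r := by
  obtain ⟨c, b, hc0, hc, hb, hle⟩ := ExteriorSquare.exists_tendsto_le_decompRatio hd hr1 hr2
  have hpos : 0 < (1 / c) ^ r := by positivity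
  refine ⟨?_, (1 / c) ^ r / 2, by positivity, ?_⟩
  · calc _ ≤ (1 / c) ^ r := by gcongr
      _ = liminf b primesAtTop := hb.liminf_eq.symm
      _ ≤ _ := by
        refine liminf_le_liminf hle hb.isBoundedUnder_ge ?_
        refine IsCoboundedUnder.of_frequently_le (a := 1) (Eventually.frequently ?_)
        filter_upwards [ExteriorSquare.eventually_prime] with p hp
        have := Fact.mk hp
        refine div_le_one_of_le₀ ?_ (Nat.cast_nonneg _)
        exact_mod_cast ExteriorSquare.numSpanned_le_numAll p d r
  · filter_upwards [hle, hb.eventually_const_lt (half_lt_self hpos)] with p h1 h2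
    exact h2.le.trans h1

end
end

section
/- Let p be a prime with p > 2, let d ≥ 2 and let 1 ≤ r ≤ binom(d,2). Every r-dimensional F_p-subspace of ⋀²(F_p^d) is spanned by decomposables if and only if binom(d,2) − r ≤ 2. -/
open Module

noncomputable section

variable (K : Type*) [CommRing K] (V : Type*) [AddCommGroup V] [Module K V]

section AlternatingForms

variable {F W : Type*} [Field F] [AddCommGroup W] [Module F W]

/-- If `g` vanishes on every pair on which the alternating form `f` vanishes, then `g` is a
multiple of `f`. -/
theorem exists_eq_smul_of_forall_apply_eq_zero {f g : W →ₗ[F] W →ₗ[F] F} (hf : f.IsAlt)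
    (hg : g.IsAlt) (h : ∀ x y, f x y = 0 → g x y = 0) :
    ∃ a : F, ∀ x y, g x y = a * f x y := by
  by_cases h0 : ∀ x y, f x y = 0
  · exact ⟨0, fun x y => by simp [h x y (h0 x y)]⟩
  push Not at h0
  obtain ⟨v, u', hu'⟩ := h0
  obtain ⟨u, hu⟩ : ∃ u, f v u = 1 := ⟨(f v u')⁻¹ • u', by simp [hu']⟩
  have hgv : ∀ z, g v z = g v u * f v z := by
    intro z
    have := h v (z - f v z • u) (by simp [hu])
    simp only [map_sub, map_smul, smul_eq_mul] at this
    linear_combination this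
  have key : ∀ w k, f v k = 0 → g w k = g v u * f w k := by
    intro w k hk
    have e1 := h (v + w) ((1 + f w u) • k - f w k • u) (by simp [hu, hk]; ring)
    have e2 := h w (f w u • k - f w k • u) (by simp; ring)
    have e3 := hgv k
    simp [hk] at e1 e2 e3
    linear_combination e1 - e2 - (1 + f w u) * e3
  have key' : ∀ w, g u w = g v u * f u w := by
    intro w
    have e1 := key u (w - f v w • u) (by simp [hu])
    have e2 := hf u
    have e3 := hg u
    simp [e2, e3] at e1
    exact e1
  refine ⟨g v u, fun x y => ?_⟩
  have e1 := key x (y - f v y • u) (by simp [hu])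
  have e2 := key' x
  have e3 := hf.neg x u
  have e4 := hg.neg x u
  simp at e1
  linear_combination e1 - f v y * e4 - f v y * e2 + f v y * g v u * e3

/-- Normalised form of the two-form case: the functionals `f₁ v` and `f₂ v` are independent, and
`g v = 0`. -/
theorem eq_zero_of_forall_apply_eq_zero (h2 : (2 : F) ≠ 0) {f₁ f₂ g : W →ₗ[F] W →ₗ[F] F}
    (hf₁ : f₁.IsAlt) (hf₂ : f₂.IsAlt) (hg : g.IsAlt)
    (h : ∀ x y, f₁ x y = 0 → f₂ x y = 0 → g x y = 0) {v u₁ u₂ : W}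
    (h11 : f₁ v u₁ = 1) (h12 : f₁ v u₂ = 0) (h21 : f₂ v u₁ = 0) (h22 : f₂ v u₂ = 1)
    (hgv : ∀ x, g v x = 0) (x y : W) : g x y = 0 := by
  have kernel : ∀ w k, f₁ v k = 0 → f₂ v k = 0 → g w k = 0 := by
    intro w k hk₁ hk₂
    have e : ∀ s t : F,
        t * (((s + t * f₁ w u₁) * (s + t * f₂ w u₂) - t * f₁ w u₂ * (t * f₂ w u₁)) * g w k
          - t * ((s + t * f₂ w u₂) * f₁ w k - t * f₁ w u₂ * f₂ w k) * g w u₁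
          - t * ((s + t * f₁ w u₁) * f₂ w k - t * f₂ w u₁ * f₁ w k) * g w u₂) = 0 := by
      intro s t
      have := h (s • v + t • w)
        (((s + t * f₁ w u₁) * (s + t * f₂ w u₂) - t * f₁ w u₂ * (t * f₂ w u₁)) • k
          - (t * ((s + t * f₂ w u₂) * f₁ w k - t * f₁ w u₂ * f₂ w k)) • u₁
          - (t * ((s + t * f₁ w u₁) * f₂ w k - t * f₂ w u₁ * f₁ w k)) • u₂)
        (by simp [h11, h12, hk₁]; ring) (by simp [h21, h22, hk₂]; ring)
      simp [hgv] at this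
      rcases this with ht | ht
      · simp [ht]
      · rw [ht, mul_zero]
    have : 2 * g w k = 0 := by linear_combination e 1 1 - e 1 (-1) - 2 * e 0 1
    exact (mul_eq_zero.1 this).resolve_left h2
  have kernel' : ∀ k w, f₁ v k = 0 → f₂ v k = 0 → g k w = 0 := fun k w hk₁ hk₂ => by
    rw [← hg.neg, kernel w k hk₁ hk₂, neg_zero]
  have split_right : ∀ x y, g x y = f₁ v y * g x u₁ + f₂ v y * g x u₂ := by
    intro x y
    have := kernel x (y - f₁ v y • u₁ - f₂ v y • u₂) (by simp [h11, h12]) (by simp [h21, h22])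
    simp at this
    linear_combination this
  have hu : g u₁ u₂ = 0 := by
    have hv₁ := hf₁.neg u₁ v
    have hv₂ := hf₂.neg u₁ v
    have := h (u₁ - f₂ u₁ u₂ • v) (u₂ + f₁ u₁ u₂ • v)
      (by simp only [map_add, map_sub, map_smul, LinearMap.sub_apply, LinearMap.smul_apply,
        smul_eq_mul, h12, hf₁ v]; linear_combination -f₁ u₁ u₂ * hv₁ - f₁ u₁ u₂ * h11)
      (by simp only [map_add, map_sub, map_smul, LinearMap.sub_apply, LinearMap.smul_apply,
        smul_eq_mul, h22, hf₂ v]; linear_combination -f₁ u₁ u₂ * hv₂ - f₁ u₁ u₂ * h21)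
    have hgv' := hg.neg u₁ v
    simp [hgv] at this hgv'
    simpa [hgv'] using this
  have hu' : g u₂ u₁ = 0 := by rw [← hg.neg, hu, neg_zero]
  have hx₁ : g x u₁ = 0 := by
    rw [← hg.neg, split_right u₁ x, hg u₁, hu]; simp
  have hx₂ : g x u₂ = 0 := by
    rw [← hg.neg, split_right u₂ x, hg u₂, hu']; simp
  rw [split_right x y, hx₁, hx₂]; simp

/-- In characteristic not two, an alternating form vanishing on all common zeros of two alternating
forms is a linear combination of them. -/
theorem exists_eq_add_smul_of_forall_apply_eq_zero (h2 : (2 : F) ≠ 0)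
    {f₁ f₂ g : W →ₗ[F] W →ₗ[F] F} (hf₁ : f₁.IsAlt) (hf₂ : f₂.IsAlt) (hg : g.IsAlt)
    (h : ∀ x y, f₁ x y = 0 → f₂ x y = 0 → g x y = 0) :
    ∃ a b : F, ∀ x y, g x y = a * f₁ x y + b * f₂ x y := by
  by_cases hind : ∃ v x y, f₁ v x * f₂ v y - f₁ v y * f₂ v x ≠ 0
  · obtain ⟨v, x, y, hD⟩ := hind
    set D := f₁ v x * f₂ v y - f₁ v y * f₂ v x with hD'
    set u₁ := D⁻¹ • (f₂ v y • x - f₂ v x • y) with hu₁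
    set u₂ := D⁻¹ • (f₁ v x • y - f₁ v y • x) with hu₂
    have h11 : f₁ v u₁ = 1 := by
      simp only [hu₁, map_smul, map_sub, smul_eq_mul]; field_simp; rw [hD']; ring
    have h12 : f₁ v u₂ = 0 := by simp only [hu₂, map_smul, map_sub, smul_eq_mul]; ring
    have h21 : f₂ v u₁ = 0 := by simp only [hu₁, map_smul, map_sub, smul_eq_mul]; ring
    have h22 : f₂ v u₂ = 1 := by
      simp only [hu₂, map_smul, map_sub, smul_eq_mul]; field_simp; rw [hD']
    clear_value u₁ u₂
    refine ⟨g v u₁, g v u₂, fun x y => ?_⟩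
    have := eq_zero_of_forall_apply_eq_zero h2 (g := g - g v u₁ • f₁ - g v u₂ • f₂) hf₁ hf₂
      (fun z => by simp [hf₁ z, hf₂ z, hg z])
      (fun x y h₁ h₂ => by simp [h₁, h₂, h x y h₁ h₂]) h11 h12 h21 h22
      (fun z => by
        have := h v (z - f₁ v z • u₁ - f₂ v z • u₂) (by simp [h11, h12]) (by simp [h21, h22])
        simp at this ⊢
        linear_combination this) x y
    simp at this
    linear_combination this
  · push Not at hind
    by_cases h0 : ∀ x y, f₁ x y = 0
    · obtain ⟨b, hb⟩ := exists_eq_smul_of_forall_apply_eq_zero hf₂ hg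
        (fun x y => h x y (h0 x y))
      exact ⟨0, b, fun x y => by simp [hb]⟩
    push Not at h0
    obtain ⟨v, u', hu'⟩ := h0
    obtain ⟨u, hu⟩ : ∃ u, f₁ v u = 1 := ⟨(f₁ v u')⁻¹ • u', by simp [hu']⟩
    have hv : ∀ x, f₂ v x = f₂ v u * f₁ v x := fun x => by
      linear_combination hind v u x - f₂ v x * hu
    have polar : ∀ w x y, f₁ v x * (f₂ w y - f₂ v u * f₁ w y)
        = f₁ v y * (f₂ w x - f₂ v u * f₁ w x) := by
      intro w x y
      have e := hind (v + w) x y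
      simp only [map_add, LinearMap.add_apply] at e
      linear_combination e - hind w x y - (f₁ v x + f₁ w x) * hv y + (f₁ v y + f₁ w y) * hv x
    have huw : ∀ w, f₂ w u - f₂ v u * f₁ w u = 0 := by
      intro w
      have e := polar u u w
      rw [hf₁ u, hf₂ u, hu] at e
      linear_combination -e - hf₂.neg u w + f₂ v u * hf₁.neg u w
    have hprop : ∀ x y, f₂ x y = f₂ v u * f₁ x y := fun x y => by
      have e := polar x u y
      rw [huw, hu] at e
      linear_combination e
    obtain ⟨a, ha⟩ := exists_eq_smul_of_forall_apply_eq_zero hf₁ hg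
      (fun x y h₁ => h x y h₁ (by rw [hprop, h₁, mul_zero]))
    exact ⟨a, 0, fun x y => by simp [ha]⟩

end AlternatingForms

section ExteriorSquare

variable {F W : Type*} [Field F] [AddCommGroup W] [Module F W]

theorem grade2_eq_exteriorPower : grade2 F W = ⋀[F]^2 W := by
  rw [← ExteriorAlgebra.ιMulti_span_fixedDegree, grade2]
  congr 1
  ext x
  constructor
  · rintro ⟨v, w, rfl⟩
    exact ⟨![v, w], by simp [ExteriorAlgebra.ιMulti_apply]⟩
  · rintro ⟨v, rfl⟩
    exact ⟨v 0, v 1, by simp [ExteriorAlgebra.ιMulti_apply, Matrix.vecTail]⟩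

theorem finite_grade2 [Module.Finite F W] : Module.Finite F (grade2 F W) := by
  rw [grade2_eq_exteriorPower]; infer_instance

theorem finrank_grade2 [Module.Finite F W] :
    finrank F (grade2 F W) = (finrank F W).choose 2 := by
  rw [grade2_eq_exteriorPower, exteriorPower.finrank_eq]

/-- The bilinear form on `W` obtained by restricting a functional to wedges. -/
def wedgeForm (a : ExteriorAlgebra F W →ₗ[F] F) : W →ₗ[F] W →ₗ[F] F :=
  ((LinearMap.mul F (ExteriorAlgebra F W)).compl₁₂ (ExteriorAlgebra.ι F)
    (ExteriorAlgebra.ι F)).compr₂ a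

theorem wedgeForm_apply (a : ExteriorAlgebra F W →ₗ[F] F) (v w : W) :
    wedgeForm a v w = a (ExteriorAlgebra.ι F v * ExteriorAlgebra.ι F w) := rfl

theorem wedgeForm_isAlt (a : ExteriorAlgebra F W →ₗ[F] F) : (wedgeForm a).IsAlt := fun v => by
  simp [wedgeForm_apply]

/-- The common kernel in the exterior square of two functionals is spanned by decomposables. -/
theorem spannedByDecomposables_of_mem_iff (h2 : (2 : F) ≠ 0)
    {L : Submodule F (ExteriorAlgebra F W)} (hL : L ≤ grade2 F W)
    (a b : ExteriorAlgebra F W →ₗ[F] F)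
    (hab : ∀ x ∈ grade2 F W, x ∈ L ↔ a x = 0 ∧ b x = 0) :
    SpannedByDecomposables F W L := by
  refine le_antisymm (fun x hx => ?_) (Submodule.span_le.2 Set.inter_subset_left)
  by_contra hxS
  obtain ⟨g, hgx, hg⟩ := Submodule.exists_le_ker_of_notMem hxS
  obtain ⟨s, t, hst⟩ := exists_eq_add_smul_of_forall_apply_eq_zero h2 (wedgeForm_isAlt a)
    (wedgeForm_isAlt b) (wedgeForm_isAlt g) (fun v w h₁ h₂ => hg (Submodule.subset_span
      ⟨(hab _ (Submodule.subset_span ⟨v, w, rfl⟩)).2 ⟨h₁, h₂⟩, v, w, rfl⟩))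
  have hle : grade2 F W ≤ LinearMap.ker (g - s • a - t • b) := by
    refine Submodule.span_le.2 ?_
    rintro _ ⟨v, w, rfl⟩
    have := hst v w
    simp only [wedgeForm_apply] at this
    simp [this]
  have hx0 := hle (hL hx)
  obtain ⟨ha, hb⟩ := (hab x (hL hx)).1 hx
  simp [ha, hb] at hx0
  exact hgx hx0

/-- A subspace of codimension at most two is the common kernel of two functionals. -/
theorem exists_mem_iff_of_finrank_le {E : Type*} [AddCommGroup E] [Module F E]
    {L G : Submodule F E} [Module.Finite F G] (hLG : L ≤ G)
    (h : finrank F G ≤ finrank F L + 2) :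
    ∃ a b : E →ₗ[F] F, ∀ x ∈ G, x ∈ L ↔ a x = 0 ∧ b x = 0 := by
  have hq := (L.comap G.subtype).finrank_quotient_add_finrank
  rw [(Submodule.comapSubtypeEquivOfLe hLG).finrank_eq] at hq
  obtain ⟨i, hi⟩ := (finrank_le_iff_exists_linearMap
    (R := F) (M := G ⧸ L.comap G.subtype) (M' := Fin 2 → F)).1 (by simp; omega)
  obtain ⟨c, hc⟩ := (i ∘ₗ (L.comap G.subtype).mkQ).exists_extend
  refine ⟨LinearMap.proj 0 ∘ₗ c, LinearMap.proj 1 ∘ₗ c, fun x hx => ?_⟩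
  have hcx : c x = i ((L.comap G.subtype).mkQ ⟨x, hx⟩) := LinearMap.congr_fun hc ⟨x, hx⟩
  have : x ∈ L ↔ c x = 0 := by
    rw [hcx, map_eq_zero_iff i hi, Submodule.mkQ_apply, Submodule.Quotient.mk_eq_zero]
    rfl
  rw [this, funext_iff, Fin.forall_fin_two]
  rfl

/-- There are intermediate subspaces of every dimension between a line and a larger subspace. -/
theorem exists_le_finrank_eq {E : Type*} [AddCommGroup E] [Module F E] {M : Submodule F E}
    [Module.Finite F M] {e : E} (he : e ∈ M) (he0 : e ≠ 0) {r : ℕ} (hr : 1 ≤ r)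
    (hrM : r ≤ finrank F M) : ∃ L ≤ M, e ∈ L ∧ finrank F L = r := by
  induction r, hr using Nat.le_induction with
  | base =>
    exact ⟨F ∙ e, by simpa using he, Submodule.mem_span_singleton_self e,
      finrank_span_singleton he0⟩
  | succ n hn ih =>
    obtain ⟨L, hLM, heL, hL⟩ := ih (by omega)
    have : Module.Finite F L := Submodule.finiteDimensional_of_le hLM
    obtain ⟨x, hxM, hxL⟩ := SetLike.exists_of_lt (lt_of_le_of_ne hLM fun h => by
      rw [h] at hL; omega)
    refine ⟨L ⊔ F ∙ x, sup_le hLM (by simpa using hxM), Submodule.mem_sup_left heL, ?_⟩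
    have hlt : finrank F L < finrank F ↥(L ⊔ F ∙ x) := Submodule.finrank_lt_finrank_of_lt
      (left_lt_sup.2 fun h => hxL (h (Submodule.mem_span_singleton_self x)))
    have hle := Submodule.finrank_add_le_finrank_add_finrank L (F ∙ x)
    have hx := finrank_span_le_card (R := F) ({x} : Set E)
    simp only [Set.toFinset_singleton, Finset.card_singleton] at hx
    omega

/-- The functional on the exterior algebra taking `v ∧ w` to `v i * w j - v j * w i`. -/
def pluckerCoord {ι : Type*} (i j : ι) : ExteriorAlgebra F (ι → F) →ₗ[F] F :=
  ExteriorAlgebra.liftAlternating (Pi.single 2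
    ((Matrix.detRowAlternating (n := Fin 2)).compLinearMap
      (LinearMap.funLeft F F ![i, j])))

theorem pluckerCoord_apply {ι : Type*} (i j : ι) (v w : ι → F) :
    pluckerCoord i j (ExteriorAlgebra.ι F v * ExteriorAlgebra.ι F w)
      = v i * w j - v j * w i := by
  have : ExteriorAlgebra.ι F v * ExteriorAlgebra.ι F w
      = ExteriorAlgebra.ιMulti F 2 ![v, w] := by
    simp [ExteriorAlgebra.ιMulti_apply]
  rw [this, pluckerCoord, ExteriorAlgebra.liftAlternating_apply_ιMulti, Pi.single_eq_same,
    AlternatingMap.compLinearMap_apply]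
  change (Matrix.of fun k => LinearMap.funLeft F F ![i, j] (![v, w] k)).det = _
  rw [Matrix.det_fin_two]
  simp [LinearMap.funLeft_apply]

/-- For `d ≥ 4`, the exterior square of `F ^ d` has a subspace of each positive dimension of
codimension at least three which is not spanned by decomposables. -/
theorem exists_not_spannedByDecomposables {d r : ℕ} (hd : 4 ≤ d) (hr : 1 ≤ r)
    (hrd : r + 3 ≤ d.choose 2) :
    ∃ L ≤ grade2 F (Fin d → F), finrank F L = r ∧
      ¬ SpannedByDecomposables F (Fin d → F) L := by
  obtain ⟨i, hi⟩ : ∃ i : Fin 4 → Fin d, Function.Injective i :=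
    ⟨Fin.castLE hd, Fin.castLE_injective hd⟩
  let c : ExteriorAlgebra F (Fin d → F) →ₗ[F] Fin 3 → F :=
    LinearMap.pi ![pluckerCoord (i 1) (i 3), pluckerCoord (i 2) (i 3),
      pluckerCoord (i 0) (i 3) - pluckerCoord (i 1) (i 2)]
  have hc : ∀ x, c x = 0 ↔ pluckerCoord (i 1) (i 3) x = 0 ∧ pluckerCoord (i 2) (i 3) x = 0 ∧
      pluckerCoord (i 0) (i 3) x = pluckerCoord (i 1) (i 2) x := by
    intro x
    rw [funext_iff]
    simp [c, Fin.forall_fin_succ, sub_eq_zero]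
  let E : Fin 4 → ExteriorAlgebra F (Fin d → F) := fun k => ExteriorAlgebra.ι F (Pi.single (i k) 1)
  let e := E 0 * E 3 + E 1 * E 2
  have hp : ∀ j k l m, pluckerCoord (i j) (i k) (E l * E m)
      = (if j = l then 1 else 0) * (if k = m then 1 else 0)
        - (if k = l then 1 else 0) * (if j = m then (1 : F) else 0) := by
    intro j k l m
    simp only [E, pluckerCoord_apply, Pi.single_apply, hi.eq_iff]
  have he1 : pluckerCoord (i 0) (i 3) e = 1 := by simp [e, hp]
  have hce : c e = 0 := by
    rw [hc]; simp [e, hp]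
  have heG : e ∈ grade2 F (Fin d → F) :=
    add_mem (Submodule.subset_span ⟨_, _, rfl⟩) (Submodule.subset_span ⟨_, _, rfl⟩)
  have := finite_grade2 (F := F) (W := Fin d → F)
  let M := grade2 F (Fin d → F) ⊓ LinearMap.ker c
  have hM : finrank F (grade2 F (Fin d → F)) ≤ finrank F M + 3 := by
    let c' := c.domRestrict (grade2 F (Fin d → F))
    have h₁ := c'.finrank_range_add_finrank_ker
    have h₂ : finrank F (LinearMap.range c') ≤ 3 := by
      simpa using (LinearMap.range c').finrank_le
    have h₃ : finrank F ((LinearMap.ker c').map (grade2 F (Fin d → F)).subtype)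
        = finrank F (LinearMap.ker c') :=
      (Submodule.equivSubtypeMap _ _).finrank_eq.symm
    have h₄ : (LinearMap.ker c').map (grade2 F (Fin d → F)).subtype = M := by
      rw [LinearMap.ker_domRestrict]
      exact Submodule.map_comap_subtype _ _
    rw [h₄] at h₃
    omega
  have : Module.Finite F M := Submodule.finiteDimensional_of_le inf_le_left
  rw [finrank_grade2, finrank_fin_fun] at hM
  obtain ⟨L, hLM, heL, hL⟩ := exists_le_finrank_eq (M := M) ⟨heG, hce⟩
    (fun h => by rw [h, map_zero] at he1; exact zero_ne_one he1) hr (by omega)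
  refine ⟨L, hLM.trans inf_le_left, hL, fun hspan => ?_⟩
  have hle : L ≤ LinearMap.ker (pluckerCoord (i 0) (i 3)) := by
    rw [hspan, Submodule.span_le]
    rintro _ ⟨hx, v, w, rfl⟩
    obtain ⟨h13, h23, h03⟩ := (hc _).1 (hLM hx).2
    simp only [pluckerCoord_apply] at h13 h23 h03
    rw [SetLike.mem_coe, LinearMap.mem_ker, pluckerCoord_apply, ← sq_eq_zero_iff]
    linear_combination (v (i 0) * w (i 3) - v (i 3) * w (i 0)) * h03
      + (v (i 0) * w (i 2) - v (i 2) * w (i 0)) * h13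
      - (v (i 0) * w (i 1) - v (i 1) * w (i 0)) * h23
  have := hle heL
  rw [LinearMap.mem_ker, he1] at this
  exact one_ne_zero this

end ExteriorSquare

/-- for a prime `p > 2`, `d ≥ 2` and `1 ≤ r ≤ binom(d,2)`, every
`r`-dimensional subspace of `⋀²(F_p^d)` is spanned by decomposables iff
`binom(d,2) - r ≤ 2`. -/
theorem stmt2 (p : ℕ) (hp : p.Prime) (hp2 : 2 < p) (d r : ℕ) (hd : 2 ≤ d)
    (hr1 : 1 ≤ r) (hr2 : r ≤ d.choose 2) :
    (∀ L : Submodule (ZMod p) (ExteriorAlgebra (ZMod p) (Fin d → ZMod p)),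
        L ≤ grade2 (ZMod p) (Fin d → ZMod p) →
        finrank (ZMod p) L = r →
        SpannedByDecomposables (ZMod p) (Fin d → ZMod p) L) ↔
      d.choose 2 - r ≤ 2 := by
  have : Fact p.Prime := ⟨hp⟩
  have h2 : (2 : ZMod p) ≠ 0 :=
    Ring.two_ne_zero (by rw [ZMod.ringChar_zmod_n]; exact hp2.ne')
  have := finite_grade2 (F := ZMod p) (W := Fin d → ZMod p)
  constructor
  · intro h
    by_contra hlt
    have hd4 : 4 ≤ d := by
      by_contra hd4
      interval_cases d <;> (simp only [Nat.choose] at hlt; omega)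
    obtain ⟨L, hL, hLr, hLs⟩ :=
      exists_not_spannedByDecomposables (F := ZMod p) (r := r) hd4 hr1 (by omega)
    exact hLs (h L hL hLr)
  · intro h L hL hLr
    obtain ⟨a, b, hab⟩ := exists_mem_iff_of_finrank_le hL (by
      rw [finrank_grade2, finrank_fin_fun]; omega)
    exact spannedByDecomposables_of_mem_iff h2 hL a b hab


end
end

section
/- Let d ≥ 4 and 1 ≤ r ≤ binom(d−2,2), and set δ = binom(d−2,2) − r − 3. Then for every prime p, the ratio (number of r-dimensional F_p-subspaces of ⋀²(F_p^d) that are spanned by decomposables) / (number of all r-dimensional F_p-subspaces of ⋀²(F_p^d)) is at most p^{−δr}; moreover this ratio tends to 0 as p → ∞. -/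
open Module Filter

noncomputable section

variable (K : Type*) [CommRing K] (V : Type*) [AddCommGroup V] [Module K V]

open ExteriorAlgebra in
theorem grade2_eq_exteriorPower_s3 (R M : Type*) [CommRing R] [AddCommGroup M] [Module R M] :
    grade2 R M = ⋀[R]^2 M := by
  refine le_antisymm (Submodule.span_le.2 ?_) ?_
  · rintro _ ⟨v, w, rfl⟩
    change _ ∈ LinearMap.range (ι R) ^ 2
    rw [pow_two]
    exact Submodule.mul_mem_mul ⟨v, rfl⟩ ⟨w, rfl⟩
  · change LinearMap.range (ι R) ^ 2 ≤ _
    rw [pow_two, Submodule.mul_le]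
    rintro _ ⟨v, rfl⟩ _ ⟨w, rfl⟩
    exact Submodule.subset_span ⟨v, w, rfl⟩

/-- A subspace of dimension `r` spanned by vectors proportional to values of `F` is spanned by
`r` values of `F`, so there are at most `|S| ^ r` of them. -/
theorem natCard_spanned_le {k E S : Type*} [Field k] [AddCommGroup E] [Module k E] [Finite S]
    (D : Set E) (F : S → E) (hF : ∀ x ∈ D, ∃ (c : k) (s : S), x = c • F s) {r : ℕ}
    (hr : 0 < r) (P : Submodule k E → Prop)
    (hP : ∀ L, P L → finrank k L = r ∧ L = Submodule.span k ((L : Set E) ∩ D)) :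
    Nat.card {L : Submodule k E // P L} ≤ Nat.card S ^ r := by
  have key : ∀ L : {L : Submodule k E // P L}, ∃ g : Fin r → S,
      (L : Submodule k E) = Submodule.span k (Set.range (F ∘ g)) := by
    rintro ⟨L, hL⟩
    obtain ⟨hrank, hspan⟩ := hP L hL
    have : FiniteDimensional k (Submodule.span k ((L : Set E) ∩ D)) := by
      rw [← hspan]
      exact FiniteDimensional.of_finrank_pos (hrank ▸ hr)
    obtain ⟨f, hf, hfs, hfl⟩ :=
      Submodule.exists_fun_fin_finrank_span_eq k ((L : Set E) ∩ D)
    replace hfs := hfs.trans hspan.symm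
    have hn : finrank k (Submodule.span k ((L : Set E) ∩ D)) = r := by rw [← hspan, hrank]
    generalize finrank k (Submodule.span k ((L : Set E) ∩ D)) = n at f hn
    subst hn
    choose c g hcg using fun i => hF (f i) (hf i).2
    refine ⟨g, hfs.symm.trans ?_⟩
    refine le_antisymm (Submodule.span_le.2 ?_) (Submodule.span_le.2 ?_)
    · rintro _ ⟨i, rfl⟩
      rw [hcg i]
      exact Submodule.smul_mem _ _ (Submodule.subset_span ⟨i, rfl⟩)
    · rintro _ ⟨i, rfl⟩
      have hc : c i ≠ 0 := by
        intro h
        exact hfl.ne_zero i (by rw [hcg i, h, zero_smul])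
      have : (F ∘ g) i = (c i)⁻¹ • f i := by
        rw [hcg i, smul_smul, inv_mul_cancel₀ hc, one_smul, Function.comp_apply]
      rw [this]
      exact Submodule.smul_mem _ _ (Submodule.subset_span ⟨i, rfl⟩)
  choose g hg using key
  have hinj : Function.Injective g := fun L₁ L₂ h => Subtype.ext (by rw [hg L₁, hg L₂, h])
  calc Nat.card {L : Submodule k E // P L} ≤ Nat.card (Fin r → S) :=
        Nat.card_le_card_of_injective g hinj
    _ = Nat.card S ^ r := by simp [Nat.card_fun]

/-- Graphs of linear maps give at least `q ^ (r * m)` subspaces of dimension `r` in a space of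
dimension `r + m`. -/
theorem pow_le_natCard_submodule {k E : Type*} [Field k] [Finite k] [AddCommGroup E] [Module k E]
    (W : Submodule k E) [FiniteDimensional k W] {r m : ℕ} (h : finrank k W = r + m) :
    Nat.card k ^ (r * m) ≤ Nat.card {L : Submodule k E // L ≤ W ∧ finrank k L = r} := by
  have : Finite W := Module.finite_of_finite k
  have : Finite (Submodule k W) := Finite.of_injective _ SetLike.coe_injective
  have : Finite {L : Submodule k E // L ≤ W ∧ finrank k L = r} := by
    refine Finite.of_injective (fun L => Submodule.comap W.subtype L.1) fun L₁ L₂ h => ?_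
    refine Subtype.ext ?_
    have := congrArg (Submodule.map W.subtype) h
    simpa [Submodule.map_comap_eq, inf_eq_right.2 L₁.2.1, inf_eq_right.2 L₂.2.1] using this
  let e : ((Fin r → k) × (Fin m → k)) ≃ₗ[k] W := LinearEquiv.ofFinrankEq _ _ (by simp [h])
  let j : ((Fin r → k) × (Fin m → k)) →ₗ[k] E := W.subtype ∘ₗ e.toLinearMap
  have hj : Function.Injective j := W.injective_subtype.comp e.injective
  have hA (A : (Fin r → k) →ₗ[k] (Fin m → k)) :
      Function.Injective (j ∘ₗ LinearMap.id.prod A) :=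
    hj.comp fun x y hxy => congrArg Prod.fst hxy
  let G (A : (Fin r → k) →ₗ[k] (Fin m → k)) :
      {L : Submodule k E // L ≤ W ∧ finrank k L = r} :=
    ⟨LinearMap.range (j ∘ₗ LinearMap.id.prod A), by
      rintro _ ⟨x, rfl⟩
      exact (e _).2, by
      rw [LinearMap.finrank_range_of_inj (hA A)]
      simp⟩
  have hG : Function.Injective G := by
    intro A B hAB
    have hR : LinearMap.range (j ∘ₗ LinearMap.id.prod A) =
      LinearMap.range (j ∘ₗ LinearMap.id.prod B) := congrArg Subtype.val hAB
    refine LinearMap.ext fun x => ?_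
    obtain ⟨y, hy⟩ : (j ∘ₗ LinearMap.id.prod A) x ∈
      LinearMap.range (j ∘ₗ LinearMap.id.prod B) := hR ▸ ⟨x, rfl⟩
    have hxy := hj hy
    have h₁ : y = x := congrArg Prod.fst hxy
    have h₂ : B y = A x := congrArg Prod.snd hxy
    rw [← h₂, h₁]
  calc Nat.card k ^ (r * m) = Nat.card ((Fin r → k) →ₗ[k] (Fin m → k)) := by
        rw [Module.natCard_eq_pow_finrank (K := k) (V := (Fin r → k) →ₗ[k] (Fin m → k)),
          Module.finrank_linearMap]
        simp
    _ ≤ _ := Nat.card_le_card_of_injective G hG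

/-- Row reduction: a decomposable bivector is proportional to `v ∧ w` with `v`, `w` restricting
to the two standard basis vectors on some pair of coordinates. -/
theorem exists_reduced_wedge {k I : Type*} [Field k] [Nontrivial I] (v w : I → k) :
    ∃ (c : k) (i j : I) (v' w' : I → k), i ≠ j ∧ v' i = 1 ∧ v' j = 0 ∧ w' i = 0 ∧ w' j = 1 ∧
      ExteriorAlgebra.ι k v * ExteriorAlgebra.ι k w =
        c • (ExteriorAlgebra.ι k v' * ExteriorAlgebra.ι k w') := by
  classical
  by_cases h0 : ExteriorAlgebra.ι k v * ExteriorAlgebra.ι k w = 0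
  · obtain ⟨i, j, hij⟩ := exists_pair_ne I
    refine ⟨0, i, j, Pi.single i 1, Pi.single j 1, hij, ?_⟩
    simp [hij, hij.symm, h0]
  obtain ⟨i, hi⟩ : ∃ i, v i ≠ 0 := by
    by_contra! h
    exact h0 (by simp [show v = 0 from funext h])
  obtain ⟨w₁, hw₁⟩ : ∃ w₁, w₁ = w - (w i / v i) • v := ⟨_, rfl⟩
  have h1 : ExteriorAlgebra.ι k v * ExteriorAlgebra.ι k w =
      ExteriorAlgebra.ι k v * ExteriorAlgebra.ι k w₁ := by
    simp [hw₁, mul_sub]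
  have hw₁i : w₁ i = 0 := by simp [hw₁, hi]
  obtain ⟨j, hj⟩ : ∃ j, w₁ j ≠ 0 := by
    by_contra! h
    exact h0 (by simp [h1, show w₁ = 0 from funext h])
  have hij : i ≠ j := by
    rintro rfl
    exact hj hw₁i
  obtain ⟨v₁, hv₁⟩ : ∃ v₁, v₁ = v - (v j / w₁ j) • w₁ := ⟨_, rfl⟩
  have h2 : ExteriorAlgebra.ι k v * ExteriorAlgebra.ι k w₁ =
      ExteriorAlgebra.ι k v₁ * ExteriorAlgebra.ι k w₁ := by
    simp [hv₁, sub_mul]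
  have hv₁i : v₁ i = v i := by simp [hv₁, hw₁i]
  have hv₁j : v₁ j = 0 := by simp [hv₁, hj]
  refine ⟨v i * w₁ j, i, j, (v i)⁻¹ • v₁, (w₁ j)⁻¹ • w₁, hij, ?_, ?_, ?_, ?_, ?_⟩
  · simp [hv₁i, hi]
  · simp [hv₁j]
  · simp [hw₁i]
  · simp [hj]
  · rw [h1, h2]
    simp only [map_smul, smul_mul_assoc, mul_smul_comm, smul_smul]
    rw [show v i * w₁ j * ((w₁ j)⁻¹ * (v i)⁻¹) = 1 by field_simp, one_smul]

theorem numSpanned_le_pow (p d : ℕ) {r : ℕ} [Fact p.Prime] (hr : 0 < r) :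
    numSpanned p d r ≤ (p ^ (2 * d)) ^ r := by
  have h := natCard_spanned_le (k := ZMod p) (DecompSet (ZMod p) (Fin d → ZMod p))
    (fun s : (Fin d → ZMod p) × (Fin d → ZMod p) =>
      ExteriorAlgebra.ι (ZMod p) s.1 * ExteriorAlgebra.ι (ZMod p) s.2)
    (by
      rintro _ ⟨v, w, rfl⟩
      exact ⟨1, (v, w), (one_smul _ _).symm⟩)
    hr (fun L => L ≤ grade2 (ZMod p) (Fin d → ZMod p) ∧ finrank (ZMod p) L = r ∧
      SpannedByDecomposables (ZMod p) (Fin d → ZMod p) L) fun L hL => hL.2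
  refine h.trans_eq ?_
  simp [two_mul, pow_add]

theorem numSpanned_le_mul_pow (p : ℕ) {d r : ℕ} [Fact p.Prime] (hd : 2 ≤ d) (hr : 0 < r) :
    numSpanned p d r ≤ (d ^ 2 * p ^ (2 * (d - 2))) ^ r := by
  let T (x : {x : Fin d × Fin d // x.1 ≠ x.2}) := {l : Fin d // l ≠ x.1.1 ∧ l ≠ x.1.2}
  have hT (x) : Nat.card (T x) = d - 2 := by
    have : (Finset.univ.filter fun l : Fin d => l ≠ x.1.1 ∧ l ≠ x.1.2) =
        ({x.1.1, x.1.2} : Finset (Fin d))ᶜ := by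
      ext l
      simp
    rw [Nat.card_eq_fintype_card, Fintype.card_subtype, this, Finset.card_compl,
      Finset.card_pair x.2, Fintype.card_fin]
  let glue (x : {x : Fin d × Fin d // x.1 ≠ x.2}) (i : Fin d) (u : T x → ZMod p) :
      Fin d → ZMod p :=
    fun l => if h : l ≠ x.1.1 ∧ l ≠ x.1.2 then u ⟨l, h⟩ else if l = i then 1 else 0
  have : Nontrivial (Fin d) := Fin.nontrivial_iff_two_le.2 hd
  have h := natCard_spanned_le (k := ZMod p) (DecompSet (ZMod p) (Fin d → ZMod p))
    (fun s : Σ x : {x : Fin d × Fin d // x.1 ≠ x.2}, (T x → ZMod p) × (T x → ZMod p) =>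
      ExteriorAlgebra.ι (ZMod p) (glue s.1 s.1.1.1 s.2.1) *
        ExteriorAlgebra.ι (ZMod p) (glue s.1 s.1.1.2 s.2.2))
    (by
      rintro _ ⟨v, w, rfl⟩
      obtain ⟨c, i, j, v', w', hij, hvi, hvj, hwi, hwj, h⟩ := exists_reduced_wedge v w
      refine ⟨c, ⟨⟨(i, j), hij⟩, fun l => v' l.1, fun l => w' l.1⟩, ?_⟩
      rw [h]
      congr 3
      · funext l
        by_cases hi : l = i
        · subst hi
          simp [glue, hvi]
        · by_cases hj : l = j
          · subst hj
            simp [glue, hvj, hi]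
          · simp [glue, hi, hj]
      · funext l
        by_cases hj : l = j
        · subst hj
          simp [glue, hwj]
        · by_cases hi : l = i
          · subst hi
            simp [glue, hwi, hj]
          · simp [glue, hi, hj])
    hr (fun L => L ≤ grade2 (ZMod p) (Fin d → ZMod p) ∧ finrank (ZMod p) L = r ∧
      SpannedByDecomposables (ZMod p) (Fin d → ZMod p) L) fun L hL => hL.2
  refine h.trans (Nat.pow_le_pow_left ?_ r)
  rw [Nat.card_sigma]
  simp only [Nat.card_prod, Nat.card_fun, hT, Nat.card_zmod, Finset.sum_const, smul_eq_mul,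
    Finset.card_univ]
  rw [two_mul, pow_add]
  refine Nat.mul_le_mul_right _ ((Fintype.card_subtype_le _).trans_eq ?_)
  simp [pow_two]

theorem pow_le_numAll (p d r m : ℕ) [Fact p.Prime] (h : d.choose 2 = r + m) :
    p ^ (r * m) ≤ numAll p d r := by
  have hW := grade2_eq_exteriorPower_s3 (ZMod p) (Fin d → ZMod p)
  have : FiniteDimensional (ZMod p) (grade2 (ZMod p) (Fin d → ZMod p)) := by
    rw [hW]
    infer_instance
  have hrank : finrank (ZMod p) (grade2 (ZMod p) (Fin d → ZMod p)) = r + m := by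
    rw [hW, exteriorPower.finrank_eq, finrank_fin_fun, h]
  have hle := pow_le_natCard_submodule _ hrank
  rwa [Nat.card_zmod] at hle

/-- for `d ≥ 4` and `1 ≤ r ≤ binom(d-2,2)`, with
`δ = binom(d-2,2) - r - 3`, the proportion of `r`-dimensional subspaces of
`⋀²(F_p^d)` spanned by decomposables is at most `p^(-δ r)` for every prime `p`,
and this proportion tends to `0` as `p → ∞` along primes. -/
theorem stmt3 (d r : ℕ) (hd : 4 ≤ d) (hr1 : 1 ≤ r) (hr2 : r ≤ (d - 2).choose 2) :
    (∀ p : ℕ, p.Prime →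
        decompRatio p d r ≤
          (p : ℝ) ^ (-((((d - 2).choose 2 : ℤ) - (r : ℤ) - 3) * (r : ℤ)))) ∧
      Tendsto (fun p : ℕ => decompRatio p d r) primesAtTop (nhds 0) := by
  obtain ⟨e, rfl⟩ : ∃ e, d = e + 2 := ⟨d - 2, by omega⟩
  simp only [Nat.add_sub_cancel] at hr2 ⊢
  obtain ⟨t, ht⟩ := Nat.exists_eq_add_of_le hr2
  have hchoose : (e + 2).choose 2 = r + (t + (2 * e + 1)) := by
    have : (e + 2).choose 2 = e.choose 2 + (2 * e + 1) := by
      simp [Nat.choose_succ_succ' _ 1]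
      ring
    omega
  have hall (p : ℕ) (hp : p.Prime) : (p : ℝ) ^ (r * (t + (2 * e + 1))) ≤ numAll p (e + 2) r := by
    have : Fact p.Prime := ⟨hp⟩
    exact_mod_cast pow_le_numAll p (e + 2) r _ hchoose
  constructor
  · intro p hp
    have : Fact p.Prime := ⟨hp⟩
    have hp0 : (0 : ℝ) < p := by exact_mod_cast hp.pos
    have hs : (numSpanned p (e + 2) r : ℝ) ≤ ((p : ℝ) ^ (2 * (e + 2))) ^ r := by
      exact_mod_cast numSpanned_le_pow p (e + 2) hr1
    refine (div_le_div₀ (by positivity) hs (by positivity) (hall p hp)).trans_eq ?_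
    rw [← pow_mul, ← zpow_natCast, ← zpow_natCast, ← zpow_sub₀ hp0.ne', ht]
    congr 1
    push_cast
    ring
  · have hlim : Tendsto (fun p : ℕ => (((e + 2 : ℕ) : ℝ) ^ 2 / p) ^ r) primesAtTop (nhds 0) := by
      have h := (tendsto_const_div_atTop_nhds_zero_nat (((e + 2 : ℕ) : ℝ) ^ 2)).pow r
      rw [zero_pow (by omega)] at h
      exact h.mono_left inf_le_left
    refine squeeze_zero' (Eventually.of_forall fun p => div_nonneg (by positivity) (by positivity))
      ?_ hlim
    filter_upwards [mem_inf_of_right (mem_principal_self {p : ℕ | p.Prime})] with p hp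
    have : Fact p.Prime := ⟨hp⟩
    have hp1 : (1 : ℝ) ≤ p := by exact_mod_cast hp.one_le
    have hs : (numSpanned p (e + 2) r : ℝ) ≤
        (((e + 2 : ℕ) : ℝ) ^ 2 * (p : ℝ) ^ (2 * e)) ^ r := by
      exact_mod_cast numSpanned_le_mul_pow p (by omega) hr1
    have hb : ((p : ℝ) ^ (2 * e + 1)) ^ r ≤ numAll p (e + 2) r := by
      refine le_trans ?_ (hall p hp)
      rw [← pow_mul, mul_comm r]
      exact pow_le_pow_right₀ hp1 (Nat.mul_le_mul_right _ (by omega))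
    refine (div_le_div₀ (by positivity) hs (by positivity) hb).trans_eq ?_
    rw [← div_pow]
    congr 1
    field_simp
    ring

end
end
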